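/- Let K be a number field and let c₁,…,c₆ ∈ K. Suppose that for every ring homomorphism σ : K → ℝ there exists a nonzero (x₁,…,x₆) ∈ ℝ⁶ with σ(c₁)x₁² + ⋯ + σ(c₆)x₆² = 0. Then there exists a nonzero (x₁,…,x₆) ∈ K⁶ with c₁x₁² + ⋯ + c₆x₆² = 0. -/

import Mathlib

open NumberField IsDedekindDomain
open scoped WithZero
namespace HM

section val
variable {F : Type*} [Field F] [CharZero F]

/-- units close to one -/
def One4 (w : Valuation F ℤᵐ⁰) (hw : w 4 ≤ 1) : Subgroup Fˣ where
  carrier := {u | w ((u : F) - 1) < w 4}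
  one_mem' := by simp [zero_lt_iff]
  mul_mem' := by
    rintro a b ha hb
    simp only [Set.mem_ofPred_eq] at ha hb ⊢
    have h1 : w (b : F) = 1 := by
      have := Valuation.map_one_add_of_lt (v := w) (x := (b : F) - 1) (hb.trans_le hw)
      simpa using this
    have : ((a * b : Fˣ) : F) - 1 = (a - 1) * b + (b - 1) := by push_cast; ring
    rw [this]
    refine w.map_add_lt ?_ hb
    rw [map_mul, h1, mul_one]; exact ha
  inv_mem' := by
    rintro a ha
    simp only [Set.mem_ofPred_eq] at ha ⊢
    have h1 : w (a : F) = 1 := by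
      have := Valuation.map_one_add_of_lt (v := w) (x := (a : F) - 1) (ha.trans_le hw)
      simpa using this
    have : ((a⁻¹ : Fˣ) : F) - 1 = - ((a - 1) * (a : F)⁻¹) := by
      have := a.ne_zero
      push_cast; field_simp; ring
    rw [this, Valuation.map_neg, map_mul, map_inv₀, h1]; simpa using ha

/-- squares -/
def Q (F : Type*) [Field F] : Subgroup Fˣ := (powMonoidHom 2 : Fˣ →* Fˣ).range

lemma mem_Q {u : Fˣ} : u ∈ Q F ↔ ∃ y : F, (u : F) = y ^ 2 := by
  constructor
  · rintro ⟨y, rfl⟩; exact ⟨y, by simp⟩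
  · rintro ⟨y, hy⟩
    have : y ≠ 0 := by rintro rfl; exact u.ne_zero (by simpa using hy)
    exact ⟨Units.mk0 y this, by ext; simp [hy]⟩

lemma sq_mem_Q (u : Fˣ) : u ^ 2 ∈ Q F := ⟨u, rfl⟩

end val

section nf
variable {F : Type*} [Field F] [NumberField F]

noncomputable abbrev vl (v : HeightOneSpectrum (𝓞 F)) : Valuation F ℤᵐ⁰ := v.valuation F

lemma vl_int_le (v : HeightOneSpectrum (𝓞 F)) (r : 𝓞 F) : vl v (algebraMap (𝓞 F) F r) ≤ 1 := v.valuation_le_one r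

lemma vl_two_le (v : HeightOneSpectrum (𝓞 F)) : vl v (2 : F) ≤ 1 := by
  have h := vl_int_le v 2
  rwa [map_ofNat] at h
lemma vl_four_eq (v : HeightOneSpectrum (𝓞 F)) : vl v (4 : F) = vl v 2 * vl v 2 := by
  rw [← map_mul]; norm_num
lemma vl_four_le (v : HeightOneSpectrum (𝓞 F)) : vl v (4 : F) ≤ 1 := by
  rw [vl_four_eq]; exact mul_le_one' (vl_two_le v) (vl_two_le v)
lemma vl_two_ne (v : HeightOneSpectrum (𝓞 F)) : vl v (2 : F) ≠ 0 := by simp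
lemma vl_four_ne (v : HeightOneSpectrum (𝓞 F)) : vl v (4 : F) ≠ 0 := by simp

/-- local squares -/
noncomputable def Sq (v : HeightOneSpectrum (𝓞 F)) : Subgroup Fˣ := One4 (vl v) (vl_four_le v) ⊔ Q F

lemma Q_le_Sq (v : HeightOneSpectrum (𝓞 F)) : Q F ≤ Sq v := le_sup_right

lemma mem_Sq_of_sub_one {v : HeightOneSpectrum (𝓞 F)} {u : Fˣ} (h : vl v ((u : F) - 1) < vl v 4) :
    u ∈ Sq v := Subgroup.mem_sup_left h

lemma mem_Sq {v : HeightOneSpectrum (𝓞 F)} {u : Fˣ} :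
    u ∈ Sq v ↔ ∃ y : F, y ≠ 0 ∧ vl v ((u : F) - y ^ 2) < vl v (4 * u) := by
  constructor
  · intro h
    obtain ⟨a, ha, b, ⟨c, rfl⟩, rfl⟩ := Subgroup.mem_sup.mp h
    replace ha : vl v ((a : F) - 1) < vl v 4 := ha
    have h1 : vl v (a : F) = 1 := by
      have := Valuation.map_one_add_of_lt (v := vl v) (x := (a : F) - 1) (ha.trans_le (vl_four_le v))
      simpa using this
    refine ⟨c, c.ne_zero, ?_⟩
    have : ((a * powMonoidHom 2 c : Fˣ) : F) - (c : F) ^ 2 = (a - 1) * c ^ 2 := by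
      simp; ring
    rw [this]
    simp only [map_mul, Units.val_mul, h1, one_mul, powMonoidHom_apply, Units.val_pow_eq_pow_val]
    exact mul_lt_mul_of_pos_right ha (by simp [zero_lt_iff])
  · rintro ⟨y, hy, h⟩
    have hq : (Units.mk0 y hy) ^ 2 ∈ Sq v := Q_le_Sq v (sq_mem_Q _)
    have hu : u / (Units.mk0 y hy) ^ 2 ∈ Sq v := by
      apply mem_Sq_of_sub_one
      have hlt : vl v ((u : F) - y ^ 2) < vl v u := h.trans_le (by
        rw [map_mul]; exact mul_le_of_le_one_left' (vl_four_le v))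
      have e : vl v (y ^ 2) = vl v u := by
        have := Valuation.map_sub_eq_of_lt_right (vl v) hlt
        rw [← this, show (u : F) - y ^ 2 - u = - y ^ 2 by ring, Valuation.map_neg]
      have : ((u / (Units.mk0 y hy) ^ 2 : Fˣ) : F) - 1 = (u - y ^ 2) * (y ^ 2)⁻¹ := by
        push_cast [Units.val_mk0]; field_simp
      rw [this, map_mul, map_inv₀, e]
      rw [map_mul] at h
      rw [mul_inv_lt_iff₀ (by simp [zero_lt_iff])]
      exact h
    have := mul_mem hu hq
    simpa using this

/-- openness -/
lemma div_mem_Sq {v : HeightOneSpectrum (𝓞 F)} {u a : Fˣ} (h : vl v ((u : F) - a) < vl v (4 * a)) :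
    u / a ∈ Sq v := by
  apply mem_Sq_of_sub_one
  have : ((u / a : Fˣ) : F) - 1 = (u - a) * (a : F)⁻¹ := by
    have := a.ne_zero
    push_cast; field_simp
  rw [this, map_mul, map_inv₀, mul_inv_lt_iff₀ (by simp [zero_lt_iff]), ← map_mul]
  exact h

lemma sq_mem_Sq (v : HeightOneSpectrum (𝓞 F)) (u : Fˣ) : u ^ 2 ∈ Sq v := Q_le_Sq v (sq_mem_Q _)

/-- modulo a group containing squares, dividing is like multiplying -/
lemma mul_mem_iff_div_mem {G : Type*} [CommGroup G] {H : Subgroup G} (hH : ∀ g : G, g ^ 2 ∈ H)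
    (a b : G) : a * b ∈ H ↔ a / b ∈ H := by
  have : a * b = a / b * b ^ 2 := by simp [pow_two, div_mul_eq_mul_div, ← mul_assoc]
  rw [this, Subgroup.mul_mem_cancel_right _ (hH b)]

/-- weak approximation at finitely many finite places -/
lemma weak_approx (S : Finset (HeightOneSpectrum (𝓞 F))) (a : HeightOneSpectrum (𝓞 F) → F)
    (γ : HeightOneSpectrum (𝓞 F) → ℤᵐ⁰) (hγ : ∀ v, γ v ≠ 0) :
    ∃ f : F, ∀ v ∈ S, vl v (f - a v) < γ v := by
  classical
  obtain ⟨d, hd⟩ := IsLocalization.exist_integer_multiples_of_finset (nonZeroDivisors (𝓞 F))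
    (S.image a)
  have hd0 : (algebraMap (𝓞 F) F d) ≠ 0 := by
    have := nonZeroDivisors.coe_ne_zero d
    simpa using this
  have h1 : ∀ v ∈ S, ∃ r : 𝓞 F, algebraMap (𝓞 F) F r = (algebraMap (𝓞 F) F d) * a v := by
    intro v hv
    obtain ⟨r, hr⟩ := hd (a v) (Finset.mem_image_of_mem a hv)
    exact ⟨r, by rw [hr, Algebra.smul_def]⟩
  choose! r hr using h1
  have h2 : ∀ v : HeightOneSpectrum (𝓞 F), ∃ n : ℕ, WithZero.exp (-(n : ℤ)) < γ v * vl v (algebraMap (𝓞 F) F d) := by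
    intro v
    have : γ v * vl v (algebraMap (𝓞 F) F d) ≠ 0 := mul_ne_zero (hγ v) (by simpa using hd0)
    obtain ⟨k, hk⟩ : ∃ k : ℤ, γ v * vl v (algebraMap (𝓞 F) F d) = WithZero.exp k :=
      ⟨_, (WithZero.exp_log this).symm⟩
    refine ⟨(-k).toNat + 1, ?_⟩
    rw [hk, WithZero.exp_lt_exp]
    have := Int.self_le_toNat (-k)
    push_cast; omega
  choose n hn using h2
  obtain ⟨y, hy⟩ := IsDedekindDomain.exists_forall_sub_mem_ideal (s := S)
    (fun v => v.asIdeal) n (fun v _ => v.prime) (fun v _ w _ h => fun h' => h (HeightOneSpectrum.ext h'))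
    (fun v => r v)
  refine ⟨(algebraMap (𝓞 F) F y) / (algebraMap (𝓞 F) F d), fun v hv => ?_⟩
  have h3 := hy v hv
  have h4 : vl v (algebraMap (𝓞 F) F (y - r v)) ≤ WithZero.exp (-(n v : ℤ)) := by
    rw [vl, HeightOneSpectrum.valuation_of_algebraMap]
    exact (v.intValuation_le_pow_iff_mem _ _).mpr h3
  have h5 : (algebraMap (𝓞 F) F y) / (algebraMap (𝓞 F) F d) - a v = (algebraMap (𝓞 F) F (y - r v)) * ((algebraMap (𝓞 F) F d))⁻¹ := by
    rw [map_sub, hr v hv]; field_simp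
  rw [h5, map_mul, map_inv₀, mul_inv_lt_iff₀ (by simpa [zero_lt_iff] using hd0)]
  exact h4.trans_lt (hn v)

/-- weak approximation modulo local squares -/
lemma weak_approx_Sq (S : Finset (HeightOneSpectrum (𝓞 F))) (a : HeightOneSpectrum (𝓞 F) → Fˣ) :
    ∃ f : Fˣ, ∀ v ∈ S, f / a v ∈ Sq v := by
  classical
  rcases S.eq_empty_or_nonempty with rfl | ⟨v0, hv0⟩
  · exact ⟨1, by simp⟩
  obtain ⟨f, hf⟩ := weak_approx S (fun v => (a v : F)) (fun v => vl v (4 * (a v : F)))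
    (fun v => by simp)
  have h0 : f ≠ 0 := by
    rintro rfl
    have := hf v0 hv0
    rw [zero_sub, Valuation.map_neg, map_mul] at this
    exact absurd this (not_lt.mpr (mul_le_of_le_one_left' (vl_four_le v0)))
  exact ⟨Units.mk0 f h0, fun v hv => div_mem_Sq (hf v hv)⟩

/-- index lower bound by independence -/
lemma index_inf_ge (S : Finset (HeightOneSpectrum (𝓞 F)))
    (N : HeightOneSpectrum (𝓞 F) → Subgroup Fˣ) (hS : ∀ v ∈ S, Sq v ≤ N v)
    (hN : ∀ v ∈ S, N v ≠ ⊤) (h0 : (⨅ v ∈ S, N v).index ≠ 0) :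
    2 ^ S.card ≤ (⨅ v ∈ S, N v).index := by
  classical
  have h1 : ∀ v ∈ S, ∃ a : Fˣ, a ∉ N v := by
    intro v hv
    by_contra! h
    exact hN v hv ((Subgroup.eq_top_iff' _).mpr h)
  choose! a ha using h1
  have h2 : ∀ A : Finset (HeightOneSpectrum (𝓞 F)), ∃ f : Fˣ, ∀ v ∈ S,
      f / (if v ∈ A then a v else 1) ∈ Sq v := fun A => weak_approx_Sq S _
  choose f hf using h2
  have h3 : ∀ A v, v ∈ S → (f A ∈ N v ↔ v ∉ A) := by
    intro A v hv
    have := hS v hv (hf A v hv)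
    by_cases hA : v ∈ A
    · simp only [hA, if_true, not_true, iff_false] at this ⊢
      intro h
      apply ha v hv
      have h' := (N v).div_mem h this
      simpa using h'
    · simpa [hA] using this
  have : (⨅ v ∈ S, N v).FiniteIndex := ⟨h0⟩
  have := Fintype.ofFinite (Fˣ ⧸ (⨅ v ∈ S, N v))
  rw [Subgroup.index_eq_card, Nat.card_eq_fintype_card, ← Finset.card_powerset]
  refine Finset.card_le_card_of_injOn (fun A => (f A : Fˣ ⧸ (⨅ v ∈ S, N v))) (by simp) ?_
  intro A hA B hB hAB
  simp only [Finset.coe_powerset, Set.mem_preimage, Set.mem_powerset_iff, Finset.coe_subset] at hA hB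
  have h4 := QuotientGroup.eq.mp hAB
  simp only [Subgroup.mem_iInf] at h4
  ext v
  by_cases hv : v ∈ S
  · have h5 := h4 v hv
    have : f A ∈ N v ↔ f B ∈ N v := by
      constructor
      · intro h; have := mul_mem h h5; simpa using this
      · intro h; have := mul_mem h (inv_mem h5); simpa using this
    rw [h3 A v hv, h3 B v hv] at this
    tauto
  · exact ⟨fun h => absurd (hA h) hv, fun h => absurd (hB h) hv⟩

end nf
end HM

open NumberField IsDedekindDomain
open scoped WithZero
namespace HM
section nf
variable {F : Type*} [Field F] [NumberField F]

noncomputable def ord (v : HeightOneSpectrum (𝓞 F)) (u : Fˣ) : ℤ := WithZero.log (vl v (u : F))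

lemma vl_eq_exp (v : HeightOneSpectrum (𝓞 F)) (u : Fˣ) : vl v (u : F) = WithZero.exp (ord v u) := by
  rw [ord, WithZero.exp_log (by simp)]

lemma ord_mul (v : HeightOneSpectrum (𝓞 F)) (u u' : Fˣ) : ord v (u * u') = ord v u + ord v u' := by
  simp only [ord, Units.val_mul, map_mul]
  rw [WithZero.log_mul (by simp) (by simp)]

lemma ord_sq (v : HeightOneSpectrum (𝓞 F)) (u : Fˣ) : ord v (u ^ 2) = 2 * ord v u := by
  rw [pow_two, ord_mul]; ring

lemma ord_one (v : HeightOneSpectrum (𝓞 F)) : ord v (1 : Fˣ) = 0 := by simp [ord]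

lemma ord_inv (v : HeightOneSpectrum (𝓞 F)) (u : Fˣ) : ord v u⁻¹ = - ord v u := by
  have := ord_mul v u u⁻¹
  rw [mul_inv_cancel, ord_one] at this; omega

lemma ord_div (v : HeightOneSpectrum (𝓞 F)) (u u' : Fˣ) : ord v (u / u') = ord v u - ord v u' := by
  rw [div_eq_mul_inv, ord_mul, ord_inv]; ring

lemma ord_zpow (v : HeightOneSpectrum (𝓞 F)) (u : Fˣ) (n : ℤ) : ord v (u ^ n) = n * ord v u := by
  simp only [ord, Units.val_zpow_eq_zpow_val, map_zpow₀]
  rw [WithZero.log_zpow]; simp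

lemma exists_ord (v : HeightOneSpectrum (𝓞 F)) (n : ℤ) : ∃ u : Fˣ, ord v u = n := by
  obtain ⟨x, hx⟩ := v.valuation_surjective F (WithZero.exp n)
  have : x ≠ 0 := by rintro rfl; rw [map_zero] at hx; exact WithZero.exp_ne_zero hx.symm
  exact ⟨Units.mk0 x this, by simp [ord, hx]⟩

/-- local units -/
noncomputable def W (v : HeightOneSpectrum (𝓞 F)) : Subgroup Fˣ where
  carrier := {u | vl v (u : F) = 1}
  one_mem' := by simp
  mul_mem' := by
    intro a b ha hb
    simp only [Set.mem_ofPred_eq] at ha hb ⊢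
    simp [ha, hb]
  inv_mem' := by
    intro a ha
    simp only [Set.mem_ofPred_eq] at ha ⊢
    simp [ha]

lemma mem_W {v : HeightOneSpectrum (𝓞 F)} {u : Fˣ} : u ∈ W v ↔ vl v (u : F) = 1 := Iff.rfl
lemma mem_W_iff_ord {v : HeightOneSpectrum (𝓞 F)} {u : Fˣ} : u ∈ W v ↔ ord v u = 0 := by
  rw [mem_W, vl_eq_exp, ← WithZero.exp_zero, WithZero.exp_inj]

lemma ord_even_of_mem_Sq {v : HeightOneSpectrum (𝓞 F)} {u : Fˣ} (h : u ∈ Sq v) : Even (ord v u) := by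
  obtain ⟨a, ha, b, ⟨c, rfl⟩, rfl⟩ := Subgroup.mem_sup.mp h
  replace ha : vl v ((a : F) - 1) < vl v 4 := ha
  have h1 : a ∈ W v := by
    have := Valuation.map_one_add_of_lt (v := vl v) (x := (a : F) - 1) (ha.trans_le (vl_four_le v))
    rw [mem_W]; simpa using this
  rw [ord_mul, mem_W_iff_ord.mp h1, powMonoidHom_apply, ord_sq]
  simp

/-- residue representation of a unit -/
lemma exists_res (v : HeightOneSpectrum (𝓞 F)) {x : F} (hx : vl v x ≤ 1) :
    ∃ r : 𝓞 F, vl v (x - algebraMap (𝓞 F) F r) < 1 := by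
  obtain ⟨r, hr⟩ := v.exists_valuation_sub_lt_of_integer (γ := 1) hx
  refine ⟨r, ?_⟩
  rw [Valuation.map_sub_swap]
  simpa using hr

lemma vl_lt_one_iff (v : HeightOneSpectrum (𝓞 F)) (r : 𝓞 F) :
    vl v (algebraMap (𝓞 F) F r) < 1 ↔ r ∈ v.asIdeal := v.valuation_lt_one_iff_mem r

lemma vl_four_odd {v : HeightOneSpectrum (𝓞 F)} (h2 : vl v 2 = 1) : vl v 4 = 1 := by
  rw [vl_four_eq, h2, mul_one]

noncomputable instance (v : HeightOneSpectrum (𝓞 F)) : Field (𝓞 F ⧸ v.asIdeal) :=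
  @Ideal.Quotient.field _ _ v.asIdeal v.isMaximal

instance (v : HeightOneSpectrum (𝓞 F)) : Finite (𝓞 F ⧸ v.asIdeal) :=
  Ideal.finiteQuotientOfFreeOfNeBot _ v.ne_bot

lemma mem_Sq_iff_res {v : HeightOneSpectrum (𝓞 F)} (h2 : vl v 2 = 1) {u : Fˣ} (hu : u ∈ W v) {r : 𝓞 F}
    (hr : vl v (u - algebraMap (𝓞 F) F r) < 1) :
    u ∈ Sq v ↔ IsSquare (Ideal.Quotient.mk v.asIdeal r) := by
  rw [mem_W] at hu
  constructor
  · intro h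
    obtain ⟨y, hy0, hy⟩ := mem_Sq.mp h
    rw [map_mul, vl_four_odd h2, hu, one_mul] at hy
    have hy1 : vl v y ≤ 1 := by
      have : vl v (y ^ 2) ≤ 1 := by
        have : y ^ 2 = u - (u - y ^ 2) := by ring
        rw [this]
        exact Valuation.map_sub_le _ hu.le hy.le
      rw [map_pow] at this
      exact (pow_le_one_iff (by norm_num)).mp this
    obtain ⟨s, hs⟩ := exists_res v hy1
    refine ⟨Ideal.Quotient.mk _ s, ?_⟩
    rw [← map_mul, Ideal.Quotient.eq, ← vl_lt_one_iff]
    have : algebraMap (𝓞 F) F (r - s * s) = -(u - algebraMap (𝓞 F) F r) + (u - y ^ 2) + (y - algebraMap (𝓞 F) F s) * (y + algebraMap (𝓞 F) F s) := by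
      rw [map_sub, map_mul]; ring
    rw [this]
    refine Valuation.map_add_lt _ (Valuation.map_add_lt _ ?_ hy) ?_
    · rwa [Valuation.map_neg]
    · rw [map_mul]
      exact mul_lt_one_of_lt_of_le hs (Valuation.map_add_le _ hy1 (vl_int_le v s))
  · rintro ⟨s, hs⟩
    obtain ⟨s, rfl⟩ := Ideal.Quotient.mk_surjective s
    rw [← map_mul, Ideal.Quotient.eq, ← vl_lt_one_iff] at hs
    have h3 : vl v (u - (algebraMap (𝓞 F) F s) ^ 2) < 1 := by
      have : (u : F) - (algebraMap (𝓞 F) F s) ^ 2 = (u - algebraMap (𝓞 F) F r) + algebraMap (𝓞 F) F (r - s * s) := by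
        rw [map_sub, map_mul]; ring
      rw [this]; exact Valuation.map_add_lt _ hr hs
    refine mem_Sq.mpr ⟨algebraMap (𝓞 F) F s, ?_, ?_⟩
    · intro h0
      rw [h0] at h3; simp [hu] at h3
    · rwa [map_mul, vl_four_odd h2, hu, one_mul]

lemma res_char {v : HeightOneSpectrum (𝓞 F)} (h2 : vl v 2 = 1) : ringChar (𝓞 F ⧸ v.asIdeal) ≠ 2 := by
  intro h
  have : ((2 : ℕ) : 𝓞 F ⧸ v.asIdeal) = 0 := by rw [← h]; exact ringChar.Nat.cast_ringChar
  have h3 : (Ideal.Quotient.mk v.asIdeal (2 : 𝓞 F)) = 0 := by rw [map_ofNat]; exact_mod_cast this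
  rw [Ideal.Quotient.eq_zero_iff_mem, ← vl_lt_one_iff, map_ofNat, h2] at h3
  exact lt_irrefl _ h3

lemma odd_mul_mem {v : HeightOneSpectrum (𝓞 F)} (h2 : vl v 2 = 1) {u u' : Fˣ} (hu : u ∈ W v)
    (hu' : u' ∈ W v) (h : u ∉ Sq v) (h' : u' ∉ Sq v) : u * u' ∈ Sq v := by
  classical
  have := Fintype.ofFinite (𝓞 F ⧸ v.asIdeal)
  obtain ⟨r, hr⟩ := exists_res v (mem_W.mp hu).le
  obtain ⟨r', hr'⟩ := exists_res v (mem_W.mp hu').le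
  have hrr : vl v ((u * u' : Fˣ) - algebraMap (𝓞 F) F (r * r')) < 1 := by
    have : ((u * u' : Fˣ) : F) - algebraMap (𝓞 F) F (r * r') = (u - algebraMap (𝓞 F) F r) * u' + algebraMap (𝓞 F) F r * (u' - algebraMap (𝓞 F) F r') := by
      rw [Units.val_mul, map_mul]; ring
    rw [this]
    refine Valuation.map_add_lt _ ?_ ?_
    · rw [map_mul, mem_W.mp hu', mul_one]; exact hr
    · rw [map_mul]
      rw [mul_comm]; exact mul_lt_one_of_lt_of_le hr' (vl_int_le v r)
  rw [mem_Sq_iff_res h2 hu hr] at h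
  rw [mem_Sq_iff_res h2 hu' hr'] at h'
  rw [mem_Sq_iff_res h2 (mul_mem hu hu') hrr, map_mul]
  have e1 := quadraticChar_neg_one_iff_not_isSquare.mpr h
  have e2 := quadraticChar_neg_one_iff_not_isSquare.mpr h'
  have e3 : quadraticChar (𝓞 F ⧸ v.asIdeal) (Ideal.Quotient.mk v.asIdeal r * Ideal.Quotient.mk v.asIdeal r') ≠ -1 := by
    rw [map_mul, e1, e2]; norm_num
  by_contra hc
  exact e3 (quadraticChar_neg_one_iff_not_isSquare.mpr hc)

lemma exists_nonsq_unit {v : HeightOneSpectrum (𝓞 F)} (h2 : vl v 2 = 1) : ∃ u ∈ W v, u ∉ Sq v := by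
  obtain ⟨a, ha⟩ := FiniteField.exists_nonsquare (res_char h2)
  obtain ⟨r, rfl⟩ := Ideal.Quotient.mk_surjective a
  have h0 : r ∉ v.asIdeal := by
    intro h
    rw [Ideal.Quotient.eq_zero_iff_mem.mpr h] at ha
    exact ha (by simp)
  have hr0 : algebraMap (𝓞 F) F r ≠ 0 := by
    intro h; apply h0; rw [← vl_lt_one_iff, h]; simp
  have hW : Units.mk0 _ hr0 ∈ W v := by
    rw [mem_W]
    refine le_antisymm (vl_int_le v r) ?_
    rw [← not_lt]
    simpa [vl_lt_one_iff] using h0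
  exact ⟨Units.mk0 _ hr0, hW, fun h => ha ((mem_Sq_iff_res h2 hW (by simp)).mp h)⟩

/-- The group of norms from `F(√b)`. -/
def Nx (b : F) : Subgroup Fˣ where
  carrier := {u | ∃ p q : F, (u : F) = p ^ 2 - b * q ^ 2}
  one_mem' := ⟨1, 0, by simp⟩
  mul_mem' := by
    rintro a a' ⟨p, q, h⟩ ⟨p', q', h'⟩
    exact ⟨p * p' + b * q * q', p * q' + q * p', by push_cast; rw [h, h']; ring⟩
  inv_mem' := by
    rintro a ⟨p, q, h⟩
    refine ⟨p / a, q / a, ?_⟩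
    have := a.ne_zero
    rw [div_pow, div_pow, mul_div_assoc', ← sub_div, ← h]
    push_cast; field_simp

lemma mem_Nx {b : F} {u : Fˣ} : u ∈ Nx b ↔ ∃ p q : F, (u : F) = p ^ 2 - b * q ^ 2 := Iff.rfl

lemma Q_le_Nx (b : F) : Q F ≤ Nx b := by
  rintro _ ⟨y, rfl⟩
  exact ⟨y, 0, by simp⟩

noncomputable def Nv (b : F) (v : HeightOneSpectrum (𝓞 F)) : Subgroup Fˣ := Nx b ⊔ Sq v

lemma Sq_le_Nv (b : F) (v : HeightOneSpectrum (𝓞 F)) : Sq v ≤ Nv b v := le_sup_right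
lemma Nx_le_Nv (b : F) (v : HeightOneSpectrum (𝓞 F)) : Nx b ≤ Nv b v := le_sup_left

lemma Nv_ne_top {v : HeightOneSpectrum (𝓞 F)} (h2 : vl v 2 = 1) {b : Fˣ} (hb : b ∉ Sq v) :
    Nv (b : F) v ≠ ⊤ := by
  intro htop
  rcases Int.even_or_odd (ord v b) with he | ho
  · -- even order : uniformizer
    obtain ⟨π, hπ⟩ := exists_ord v (F := F) 1
    have : π ∈ Nv (b : F) v := by rw [htop]; trivial
    obtain ⟨n, ⟨p, q, hn⟩, s, hs, hns⟩ := Subgroup.mem_sup.mp this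
    have hs' := ord_even_of_mem_Sq hs
    have hsum : ord v n + ord v s = 1 := by rw [← ord_mul, hns, hπ]
    have hno : Odd (ord v n) := by
      rw [← Int.not_even_iff_odd]
      intro h
      have := h.add hs'
      rw [hsum] at this
      exact absurd this (by decide)
    by_cases hq : q = 0
    · have hp : p ≠ 0 := by rintro rfl; simp [hq] at hn
      have : n = (Units.mk0 p hp) ^ 2 := by ext; simp [hn, hq]
      rw [this, ord_sq] at hno
      exact absurd (even_two_mul _) (Int.not_even_iff_odd.mpr hno)
    · by_cases hp : p = 0
      · have : n = -b * (Units.mk0 q hq) ^ 2 := by ext; simp [hn, hp]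
        have e : ord v (-b) = ord v b := by simp [ord]
        rw [this, ord_mul, ord_sq, e] at hno
        exact absurd (he.add (even_two_mul _)) (Int.not_even_iff_odd.mpr hno)
      · -- compare valuations
        set P := (Units.mk0 p hp) ^ 2 with hP
        set R := b * (Units.mk0 q hq) ^ 2 with hR
        have hnPR : (n : F) = P - R := by simp [hn, hP, hR]
        have hR' : Even (ord v R) := by rw [hR, ord_mul, ord_sq]; exact he.add (even_two_mul _)
        have hP' : Even (ord v P) := by rw [hP, ord_sq]; exact even_two_mul _
        rcases lt_trichotomy (vl v (P : F)) (vl v (R : F)) with h | h | h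
        · have : ord v n = ord v R := by
            rw [ord, ord, hnPR, Valuation.map_sub_eq_of_lt_right _ h]
          rw [this] at hno; exact absurd hR' (Int.not_even_iff_odd.mpr hno)
        · have hlt : vl v (n : F) < vl v (R : F) := by
            refine lt_of_le_of_ne ?_ ?_
            · rw [hnPR]; exact Valuation.map_sub_le _ h.le le_rfl
            · intro h'
              have : ord v n = ord v R := by rw [ord, ord, h']
              rw [this] at hno; exact absurd hR' (Int.not_even_iff_odd.mpr hno)
          apply hb
          have : P / R ∈ Sq v := div_mem_Sq (by
            rw [← hnPR, map_mul, vl_four_odd h2, one_mul]; exact hlt)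
          have h3 : R ∈ Sq v := by
            have := (Sq v).div_mem (sq_mem_Sq v (Units.mk0 p hp)) this
            simpa [← hP] using this
          have := (Sq v).div_mem h3 (sq_mem_Sq v (Units.mk0 q hq))
          simpa [hR] using this
        · have : ord v n = ord v P := by
            rw [ord, ord, hnPR, Valuation.map_sub_eq_of_lt_left _ h]
          rw [this] at hno; exact absurd hP' (Int.not_even_iff_odd.mpr hno)
  · obtain ⟨ε, hε, hε'⟩ := exists_nonsq_unit h2
    have : ε ∈ Nv (b : F) v := by rw [htop]; trivial
    obtain ⟨n, ⟨p, q, hn⟩, s, hs, hns⟩ := Subgroup.mem_sup.mp this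
    have hs' := ord_even_of_mem_Sq hs
    have hsum : ord v n + ord v s = 0 := by rw [← ord_mul, hns, mem_W_iff_ord.mp hε]
    have hne : Even (ord v n) := by
      have : ord v n = - ord v s := by omega
      rw [this]; exact hs'.neg
    suffices n ∈ Sq v by
      apply hε'; rw [← hns]; exact mul_mem this hs
    by_cases hq : q = 0
    · have hp : p ≠ 0 := by rintro rfl; simp [hq] at hn
      have : n = (Units.mk0 p hp) ^ 2 := by ext; simp [hn, hq]
      rw [this]; exact sq_mem_Sq v _
    · have hRo : Odd (ord v (b * (Units.mk0 q hq) ^ 2)) := by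
        rw [ord_mul, ord_sq]; exact ho.add_even (even_two_mul _)
      by_cases hp : p = 0
      · exfalso
        have : ord v n = ord v (b * (Units.mk0 q hq) ^ 2) := by simp [ord, hn, hp]
        rw [this] at hne
        exact absurd hne (Int.not_even_iff_odd.mpr hRo)
      · set P := (Units.mk0 p hp) ^ 2 with hP
        set R := b * (Units.mk0 q hq) ^ 2 with hR
        have hnPR : (n : F) = P - R := by simp [hn, hP, hR]
        have hP' : Even (ord v P) := by rw [hP, ord_sq]; exact even_two_mul _
        rcases lt_trichotomy (vl v (P : F)) (vl v (R : F)) with h | h | h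
        · exfalso
          have : ord v n = ord v R := by
            rw [ord, ord, hnPR, Valuation.map_sub_eq_of_lt_right _ h]
          rw [this] at hne; exact absurd hne (Int.not_even_iff_odd.mpr hRo)
        · exfalso
          have : ord v P = ord v R := by rw [ord, ord, h]
          rw [this] at hP'; exact absurd hP' (Int.not_even_iff_odd.mpr hRo)
        · have h3 : n / P ∈ Sq v := div_mem_Sq (by
            rw [map_mul, vl_four_odd h2, one_mul, hnPR, sub_sub_cancel_left, Valuation.map_neg]
            exact h)
          have := mul_mem h3 (sq_mem_Sq v (Units.mk0 p hp))
          simpa [← hP] using this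

lemma even_reduce {v : HeightOneSpectrum (𝓞 F)} {b : Fˣ} (h : Even (ord v b)) :
    ∃ y b' : Fˣ, b' ∈ W v ∧ b = b' * y ^ 2 := by
  obtain ⟨k, hk⟩ := h
  obtain ⟨y, hy⟩ := exists_ord v (F := F) k
  refine ⟨y, b / y ^ 2, ?_, by simp⟩
  rw [mem_W_iff_ord, ord_div, ord_sq, hk, hy]; ring

lemma Nx_mul_sq (b : F) (y : Fˣ) : Nx (b * (y : F) ^ 2) = Nx b := by
  ext u
  have := y.ne_zero
  constructor
  · rintro ⟨p, q, h⟩; exact ⟨p, y * q, by rw [h]; ring⟩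
  · rintro ⟨p, q, h⟩; exact ⟨p, q / y, by rw [h]; field_simp⟩

lemma even_mem_Nv {v : HeightOneSpectrum (𝓞 F)} (h2 : vl v 2 = 1) {b c : Fˣ}
    (hb : Even (ord v b)) (hc : Even (ord v c)) : c ∈ Nv (b : F) v := by
  classical
  have := Fintype.ofFinite (𝓞 F ⧸ v.asIdeal)
  obtain ⟨y, b, hbW, rfl⟩ := even_reduce hb
  obtain ⟨z, c, hcW, rfl⟩ := even_reduce hc
  rw [Nv, Units.val_mul, Units.val_pow_eq_pow_val, Nx_mul_sq]
  refine mul_mem ?_ (Subgroup.mem_sup_right (sq_mem_Sq v z))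
  obtain ⟨r, hr⟩ := exists_res v (mem_W.mp hbW).le
  obtain ⟨s, hs⟩ := exists_res v (mem_W.mp hcW).le
  have hr0 : Ideal.Quotient.mk v.asIdeal r ≠ 0 := by
    rw [Ne, Ideal.Quotient.eq_zero_iff_mem, ← vl_lt_one_iff]
    intro h
    have := Valuation.map_add_lt _ hr h
    rw [sub_add_cancel, mem_W.mp hbW] at this
    exact lt_irrefl _ this
  obtain ⟨a, d, had⟩ := FiniteField.exists_root_sum_quadratic (R := 𝓞 F ⧸ v.asIdeal)
    (f := Polynomial.X ^ 2 - Polynomial.C (Ideal.Quotient.mk v.asIdeal s))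
    (g := Polynomial.C (-Ideal.Quotient.mk v.asIdeal r) * Polynomial.X ^ 2)
    (Polynomial.degree_X_pow_sub_C (by norm_num) _)
    (Polynomial.degree_C_mul_X_pow 2 (by simpa using hr0))
    (by
      exact FiniteField.odd_card_of_char_ne_two (res_char h2) )
  obtain ⟨a, rfl⟩ := Ideal.Quotient.mk_surjective a
  obtain ⟨d, rfl⟩ := Ideal.Quotient.mk_surjective d
  simp only [Polynomial.eval_sub, Polynomial.eval_pow, Polynomial.eval_X, Polynomial.eval_C,
    Polynomial.eval_mul] at had
  have h4 : a ^ 2 - s - r * d ^ 2 ∈ v.asIdeal := by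
    rw [← Ideal.Quotient.eq_zero_iff_mem]
    simp only [map_sub, map_mul, map_pow]
    linear_combination had
  rw [← vl_lt_one_iff] at h4
  set A := algebraMap (𝓞 F) F a
  set D := algebraMap (𝓞 F) F d with hD
  have h5 : vl v ((A ^ 2 - b * D ^ 2) - c) < 1 := by
    have : (A ^ 2 - b * D ^ 2) - c = algebraMap (𝓞 F) F (a ^ 2 - s - r * d ^ 2) - (c - algebraMap (𝓞 F) F s) - (b - algebraMap (𝓞 F) F r) * D ^ 2 := by
      simp only [map_sub, map_mul, map_pow]; ring
    rw [this]
    refine Valuation.map_sub_lt _ (Valuation.map_sub_lt _ h4 hs) ?_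
    rw [map_mul, map_pow]
    exact mul_lt_one_of_lt_of_le hr (pow_le_one' (vl_int_le v d) 2)
  have h6 : A ^ 2 - b * D ^ 2 ≠ 0 := by
    intro h
    rw [h, zero_sub, Valuation.map_neg, mem_W.mp hcW] at h5
    exact lt_irrefl _ h5
  have h7 : Units.mk0 _ h6 / c ∈ Sq v := div_mem_Sq (by
    rw [map_mul, vl_four_odd h2, mem_W.mp hcW, mul_one]; exact h5)
  have h8 : Units.mk0 _ h6 ∈ Nx (b : F) := ⟨A, D, rfl⟩
  have := (Nv (b : F) v).div_mem (Nx_le_Nv _ _ h8) (Sq_le_Nv _ _ h7)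
  simpa [Nv] using this

end nf
end HM

open NumberField IsDedekindDomain
open scoped WithZero
namespace HM

lemma index_pow_two_eq {G : Type*} [CommGroup G] [Finite G] :
    (powMonoidHom 2 : G →* G).range.index = Nat.card (powMonoidHom 2 : G →* G).ker := by
  have h1 := Subgroup.card_mul_index (powMonoidHom 2 : G →* G).range
  have h2 := Subgroup.card_mul_index (powMonoidHom 2 : G →* G).ker
  rw [Subgroup.index_ker] at h2
  have h3 : 0 < Nat.card (powMonoidHom 2 : G →* G).range := Nat.card_pos
  rw [← h2, mul_comm] at h1
  exact Nat.eq_of_mul_eq_mul_right h3 h1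

section nf
variable {F : Type*} [Field F] [NumberField F]

lemma approx_int (S : Finset (HeightOneSpectrum (𝓞 F))) (a : HeightOneSpectrum (𝓞 F) → F)
    (ha : ∀ v ∈ S, vl v (a v) ≤ 1)
    (γ : HeightOneSpectrum (𝓞 F) → ℤᵐ⁰) (hγ : ∀ v, γ v ≠ 0) :
    ∃ f : 𝓞 F, ∀ v ∈ S, vl v (algebraMap (𝓞 F) F f - a v) < γ v := by
  classical
  have h1 : ∀ v ∈ S, ∃ r : 𝓞 F, vl v (algebraMap (𝓞 F) F r - a v) < γ v := by
    intro v hv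
    obtain ⟨r, hr⟩ := v.exists_valuation_sub_lt_of_integer (γ := Units.mk0 (γ v) (hγ v)) (ha v hv)
    exact ⟨r, hr⟩
  choose! r hr using h1
  have h2 : ∀ v : HeightOneSpectrum (𝓞 F), ∃ n : ℕ, WithZero.exp (-(n : ℤ)) < γ v := by
    intro v
    obtain ⟨k, hk⟩ : ∃ k : ℤ, γ v = WithZero.exp k := ⟨_, (WithZero.exp_log (hγ v)).symm⟩
    refine ⟨(-k).toNat + 1, ?_⟩
    rw [hk, WithZero.exp_lt_exp]
    have := Int.self_le_toNat (-k)
    push_cast; omega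
  choose n hn using h2
  obtain ⟨y, hy⟩ := IsDedekindDomain.exists_forall_sub_mem_ideal (s := S)
    (fun v => v.asIdeal) n (fun v _ => v.prime) (fun v _ w _ h => fun h' => h (HeightOneSpectrum.ext h'))
    (fun v => r v)
  refine ⟨y, fun v hv => ?_⟩
  have h3 := hy v hv
  have h4 : vl v (algebraMap (𝓞 F) F (y - r v)) ≤ WithZero.exp (-(n v : ℤ)) := by
    rw [vl, HeightOneSpectrum.valuation_of_algebraMap]
    exact (v.intValuation_le_pow_iff_mem _ _).mpr h3
  have : algebraMap (𝓞 F) F y - a v = algebraMap (𝓞 F) F (y - r v) + (algebraMap (𝓞 F) F (r v) - a v) := by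
    rw [map_sub]; ring
  rw [this]
  exact Valuation.map_add_lt _ (h4.trans_lt (hn v)) (hr v hv)

lemma exists_ords (S : Finset (HeightOneSpectrum (𝓞 F))) (k : HeightOneSpectrum (𝓞 F) → ℤ) :
    ∃ f : Fˣ, ∀ v ∈ S, ord v f = k v := by
  classical
  have h1 : ∀ v : HeightOneSpectrum (𝓞 F), ∃ u : Fˣ, ord v u = k v := fun v => exists_ord v (k v)
  choose u hu using h1
  rcases S.eq_empty_or_nonempty with rfl | ⟨v0, hv0⟩
  · exact ⟨1, by simp⟩
  obtain ⟨f, hf⟩ := weak_approx S (fun v => (u v : F)) (fun v => vl v (u v : F)) (fun v => by simp)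
  have key : ∀ v ∈ S, vl v f = vl v (u v : F) := by
    intro v hv
    have := Valuation.map_add_eq_of_lt_right (vl v) (hf v hv)
    rw [sub_add_cancel] at this; exact this
  have h0 : f ≠ 0 := by
    rintro rfl
    have := key v0 hv0
    simp at this
    exact (u v0).ne_zero ((map_eq_zero _).mp this.symm)
  refine ⟨Units.mk0 f h0, fun v hv => ?_⟩
  rw [ord, Units.val_mk0, key v hv, ← hu v, ord]

/-- the modulus -/
noncomputable def prodS (S : Finset (HeightOneSpectrum (𝓞 F))) : Ideal (𝓞 F) := ∏ v ∈ S, v.asIdeal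

lemma prodS_ne_bot (S : Finset (HeightOneSpectrum (𝓞 F))) : prodS S ≠ ⊥ := by
  rw [← Ideal.zero_eq_bot, prodS, Finset.prod_ne_zero_iff]
  exact fun v _ => v.ne_bot

lemma mem_prodS {S : Finset (HeightOneSpectrum (𝓞 F))} {x : 𝓞 F} :
    x ∈ prodS S ↔ ∀ v ∈ S, x ∈ v.asIdeal := by
  classical
  rw [prodS, ← Ideal.dvd_span_singleton]
  constructor
  · intro h v hv
    rw [← Ideal.dvd_span_singleton]
    exact (Finset.dvd_prod_of_mem _ hv).trans h
  · intro h
    have h' := Finset.prod_primes_dvd (s := S.image (fun v => v.asIdeal)) (Ideal.span {x}) (by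
      intro I hI
      obtain ⟨v, _, rfl⟩ := Finset.mem_image.mp hI
      exact v.prime) (by
      intro I hI
      obtain ⟨v, hv, rfl⟩ := Finset.mem_image.mp hI
      rw [Ideal.dvd_span_singleton]; exact h v hv)
    rwa [Finset.prod_image] at h'
    intro v _ w _ h; exact HeightOneSpectrum.ext h

lemma int_of_vl {x : F} (h : ∀ v : HeightOneSpectrum (𝓞 F), vl v x ≤ 1) :
    ∃ r : 𝓞 F, algebraMap (𝓞 F) F r = x :=
  HeightOneSpectrum.mem_integers_of_valuation_le_one F x h

noncomputable def modS (S : Finset (HeightOneSpectrum (𝓞 F))) : Ideal (𝓞 F) := Ideal.span {4} * prodS S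

lemma mem_modS {S : Finset (HeightOneSpectrum (𝓞 F))} {x : 𝓞 F} :
    x ∈ modS S ↔ ∃ y ∈ prodS S, 4 * y = x := by
  rw [modS, Ideal.mem_span_singleton_mul]

lemma modS_ne_bot (S : Finset (HeightOneSpectrum (𝓞 F))) : modS S ≠ ⊥ := by
  rw [modS, Ne, Ideal.mul_eq_bot]
  push Not
  exact ⟨by simp, prodS_ne_bot S⟩

instance (S : Finset (HeightOneSpectrum (𝓞 F))) : Finite (𝓞 F ⧸ modS S) :=
  Ideal.finiteQuotientOfFreeOfNeBot _ (modS_ne_bot S)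

lemma vl_four_alg (v : HeightOneSpectrum (𝓞 F)) : vl v (algebraMap (𝓞 F) F 4) = vl v 4 := by
  rw [map_ofNat]

lemma vl_lt_of_mem_modS {S : Finset (HeightOneSpectrum (𝓞 F))} {x : 𝓞 F} (hx : x ∈ modS S)
    {v : HeightOneSpectrum (𝓞 F)} (hv : v ∈ S) : vl v (algebraMap (𝓞 F) F x) < vl v 4 := by
  obtain ⟨y, hy, rfl⟩ := mem_modS.mp hx
  rw [map_mul, map_mul, vl_four_alg]
  have := (vl_lt_one_iff v y).mpr (mem_prodS.mp hy v hv)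
  exact mul_lt_of_lt_one_right (by simp [zero_lt_iff]) this

lemma relIndex_two_mul (I : Ideal (𝓞 F)) (hI : I ≠ ⊥) :
    ((Ideal.span {2} * I).toAddSubgroup).relIndex (I.toAddSubgroup) = 2 ^ Module.finrank ℚ F := by
  have hle : (Ideal.span {2} * I).toAddSubgroup ≤ I.toAddSubgroup :=
    fun x hx => Ideal.mul_le_left (I := I) (J := Ideal.span {2}) (by rw [mul_comm]; exact hx)
  have h1 := AddSubgroup.relIndex_mul_index hle
  have e : ∀ J : Ideal (𝓞 F), J.toAddSubgroup.index = Ideal.absNorm J := by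
    intro J; rw [Ideal.absNorm_apply, Submodule.cardQuot_apply]; rfl
  rw [e, e, map_mul] at h1
  have h2 : Ideal.absNorm (Ideal.span {(2 : 𝓞 F)}) = 2 ^ Module.finrank ℚ F := by
    rw [Ideal.absNorm_span_singleton]
    have : (2 : 𝓞 F) = algebraMap ℤ (𝓞 F) 2 := by simp
    rw [this, Algebra.norm_algebraMap, ← RingOfIntegers.rank F]
    simp [Int.natAbs_pow]
  rw [h2] at h1
  have h3 : 0 < Ideal.absNorm I := Nat.pos_of_ne_zero (by rwa [Ne, Ideal.absNorm_eq_zero_iff])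
  exact Nat.eq_of_mul_eq_mul_right h3 h1

lemma exists_half {S : Finset (HeightOneSpectrum (𝓞 F))} {a : 𝓞 F} (h : a ^ 2 - 1 ∈ modS S) :
    ∃ z : 𝓞 F, a = 1 + 2 * z ∧ z * (z + 1) ∈ prodS S := by
  obtain ⟨y, hy, hya⟩ := mem_modS.mp h
  have h1 : ∀ v : HeightOneSpectrum (𝓞 F), vl v ((algebraMap (𝓞 F) F a - 1) / 2) ≤ 1 := by
    intro v
    rw [map_div₀, div_le_one₀ (by simp [zero_lt_iff])]
    by_contra! hc
    have e : vl v (algebraMap (𝓞 F) F a + 1) = vl v (algebraMap (𝓞 F) F a - 1) := by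
      have := Valuation.map_add_eq_of_lt_left (vl v) hc
      rw [← this]; congr 1; ring
    have h2 : vl v (algebraMap (𝓞 F) F (a ^ 2 - 1)) ≤ vl v 4 := by
      rw [← hya, map_mul, map_mul, vl_four_alg]
      exact mul_le_of_le_one_right' (vl_int_le v y)
    have h3 : algebraMap (𝓞 F) F (a ^ 2 - 1) = (algebraMap (𝓞 F) F a - 1) * (algebraMap (𝓞 F) F a + 1) := by
      rw [map_sub, map_pow, map_one]; ring
    rw [h3, map_mul, e, vl_four_eq] at h2
    exact absurd h2 (not_le.mpr (mul_lt_mul'' hc hc zero_le zero_le))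
  obtain ⟨z, hz⟩ := int_of_vl h1
  have hz' : a = 1 + 2 * z := by
    apply RingOfIntegers.ext
    have : algebraMap (𝓞 F) F a = 1 + 2 * algebraMap (𝓞 F) F z := by rw [hz]; ring
    have h5 : algebraMap (𝓞 F) F a = algebraMap (𝓞 F) F (1 + 2 * z) := by
      rw [this, map_add, map_mul, map_one, map_ofNat]
    exact h5
  refine ⟨z, hz', ?_⟩
  have : (4 : 𝓞 F) * y = 4 * (z * (z + 1)) := by rw [hya, hz']; ring
  have := mul_left_cancel₀ (by norm_num : (4 : 𝓞 F) ≠ 0) this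
  rwa [← this]

lemma card_two_torsion (S : Finset (HeightOneSpectrum (𝓞 F))) :
    Nat.card (powMonoidHom 2 : (𝓞 F ⧸ modS S)ˣ →* (𝓞 F ⧸ modS S)ˣ).ker ≤
      2 ^ (S.card + Module.finrank ℚ F) := by
  classical
  set R := 𝓞 F ⧸ modS S
  have h1 : ∀ x : (powMonoidHom 2 : Rˣ →* Rˣ).ker, ∃ z : 𝓞 F,
      ((x : Rˣ) : R) = Ideal.Quotient.mk _ (1 + 2 * z) ∧ z * (z + 1) ∈ prodS S := by
    intro x
    obtain ⟨a, ha⟩ := Ideal.Quotient.mk_surjective (((x : Rˣ)) : R)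
    have hx : ((x : Rˣ) : R) ^ 2 = 1 := by
      have := x.2
      rw [MonoidHom.mem_ker, powMonoidHom_apply] at this
      rw [← Units.val_pow_eq_pow_val, this]; simp
    have : a ^ 2 - 1 ∈ modS S := by
      rw [← Ideal.Quotient.eq, map_pow, ha, hx, map_one]
    obtain ⟨z, hz, hz'⟩ := exists_half this
    exact ⟨z, by rw [← ha, hz], hz'⟩
  choose z hz hz' using h1
  let A : (powMonoidHom 2 : Rˣ →* Rˣ).ker → S.powerset := fun x =>
    ⟨S.filter (fun v => z x ∈ v.asIdeal), by simp⟩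
  have hA : ∀ x y, A x = A y → z y - z x ∈ prodS S := by
    intro x y h
    rw [mem_prodS]
    intro v hv
    have h2 : v ∈ S.filter (fun v => z x ∈ v.asIdeal) ↔ v ∈ S.filter (fun v => z y ∈ v.asIdeal) := by
      have := congrArg Subtype.val h
      simp only [A] at this
      rw [this]
    simp only [Finset.mem_filter, hv, true_and] at h2
    by_cases hx : z x ∈ v.asIdeal
    · exact sub_mem (h2.mp hx) hx
    · have hy : z y ∉ v.asIdeal := fun h => hx (h2.mpr h)
      have e1 := (v.isPrime.mem_or_mem (mem_prodS.mp (hz' x) v hv)).resolve_left hx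
      have e2 := (v.isPrime.mem_or_mem (mem_prodS.mp (hz' y) v hv)).resolve_left hy
      have := sub_mem e2 e1
      simpa using this
  -- representatives
  let rep : S.powerset → 𝓞 F := fun B => if h : ∃ x, A x = B then z h.choose else 0
  have hrep : ∀ x, z x - rep (A x) ∈ prodS S := by
    intro x
    have h : ∃ y, A y = A x := ⟨x, rfl⟩
    simp only [rep, dif_pos h]
    exact hA _ _ h.choose_spec
  let f : (powMonoidHom 2 : Rˣ →* Rˣ).ker → S.powerset ×
      ((prodS S).toAddSubgroup ⧸ ((Ideal.span {2} * prodS S).toAddSubgroup.addSubgroupOf (prodS S).toAddSubgroup)) :=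
    fun x => (A x, QuotientAddGroup.mk ⟨z x - rep (A x), hrep x⟩)
  have hf : Function.Injective f := by
    intro x y hxy
    simp only [f, Prod.mk.injEq] at hxy
    obtain ⟨h4, h5⟩ := hxy
    rw [QuotientAddGroup.eq, AddSubgroup.mem_addSubgroupOf] at h5
    have h6 : z y - z x ∈ Ideal.span {2} * prodS S := by
      have : z y - z x = -(z x - rep (A x)) + (z y - rep (A y)) := by rw [h4]; ring
      rw [this]; exact h5
    obtain ⟨w, hw, hw'⟩ := Ideal.mem_span_singleton_mul.mp h6
    ext
    rw [hz, hz, Ideal.Quotient.eq, mem_modS]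
    refine ⟨-w, neg_mem hw, ?_⟩
    linear_combination (-2) * hw'
  have hcard : Nat.card ((prodS S).toAddSubgroup ⧸ ((Ideal.span {2} * prodS S).toAddSubgroup.addSubgroupOf (prodS S).toAddSubgroup)) = 2 ^ Module.finrank ℚ F :=
    relIndex_two_mul _ (prodS_ne_bot S)
  have : Finite ((prodS S).toAddSubgroup ⧸ ((Ideal.span {2} * prodS S).toAddSubgroup.addSubgroupOf (prodS S).toAddSubgroup)) := by
    apply Nat.finite_of_card_ne_zero; rw [hcard]; positivity
  have := Nat.card_le_card_of_injective f hf
  rw [Nat.card_prod, hcard, Nat.card_eq_fintype_card (α := S.powerset), Fintype.card_coe, Finset.card_powerset, ← pow_add] at this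
  exact this

lemma isUnit_mk_modS {S : Finset (HeightOneSpectrum (𝓞 F))}
    (hdy : ∀ v : HeightOneSpectrum (𝓞 F), vl v 2 < 1 → v ∈ S) {r : 𝓞 F}
    (hr : ∀ v ∈ S, r ∉ v.asIdeal) : IsUnit (Ideal.Quotient.mk (modS S) r) := by
  have h1 : Ideal.span {r} ⊔ modS S = ⊤ := by
    by_contra h
    obtain ⟨m, hm, hle⟩ := Ideal.exists_le_maximal _ h
    have hm0 : m ≠ ⊥ := by
      rintro rfl
      exact modS_ne_bot S (le_bot_iff.mp (le_sup_right.trans hle))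
    let v : HeightOneSpectrum (𝓞 F) := ⟨m, hm.isPrime, hm0⟩
    have hrv : r ∈ v.asIdeal := hle (Ideal.mem_sup_left (Ideal.mem_span_singleton_self r))
    have hmod : Ideal.span {4} * prodS S ≤ v.asIdeal := le_sup_right.trans hle
    rcases (v.isPrime.mul_le).mp hmod with h4 | hp
    · have : (4 : 𝓞 F) ∈ v.asIdeal := h4 (Ideal.mem_span_singleton_self _)
      have h2 : (2 : 𝓞 F) ∈ v.asIdeal := by
        rw [show (4 : 𝓞 F) = 2 * 2 by norm_num] at this
        rcases v.isPrime.mem_or_mem this with h | h <;> exact h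
      have : vl v 2 < 1 := by
        have := (vl_lt_one_iff v 2).mpr h2
        rwa [map_ofNat] at this
      exact hr v (hdy v this) hrv
    · obtain ⟨w, hw, hwv⟩ := (v.isPrime.prod_le).mp hp
      have : w = v := by
        apply HeightOneSpectrum.ext
        exact w.isMaximal.eq_of_le v.isPrime.ne_top hwv
      exact hr v (this ▸ hw) hrv
  rw [Ideal.eq_top_iff_one, Submodule.mem_sup] at h1
  obtain ⟨a, ha, m, hm, ham⟩ := h1
  obtain ⟨c, rfl⟩ := Ideal.mem_span_singleton'.mp ha
  refine IsUnit.of_mul_eq_one_right (Ideal.Quotient.mk _ c) ?_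
  rw [← map_mul, ← map_one (Ideal.Quotient.mk (modS S)), Ideal.Quotient.eq, ← ham]
  simpa using hm

noncomputable def D0 (S : Finset (HeightOneSpectrum (𝓞 F))) : Subgroup Fˣ := ⨅ v ∈ S, Sq v
noncomputable def WS (S : Finset (HeightOneSpectrum (𝓞 F))) : Subgroup Fˣ := ⨅ v ∈ S, W v

lemma mem_D0 {S : Finset (HeightOneSpectrum (𝓞 F))} {u : Fˣ} : u ∈ D0 S ↔ ∀ v ∈ S, u ∈ Sq v := by
  simp [D0, Subgroup.mem_iInf]
lemma mem_WS {S : Finset (HeightOneSpectrum (𝓞 F))} {u : Fˣ} : u ∈ WS S ↔ ∀ v ∈ S, u ∈ W v := by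
  simp [WS, Subgroup.mem_iInf]
lemma Q_le_D0 (S : Finset (HeightOneSpectrum (𝓞 F))) : Q F ≤ D0 S := by
  intro u hu; rw [mem_D0]; exact fun v _ => Q_le_Sq v hu

lemma relIndex_D0_WS (S : Finset (HeightOneSpectrum (𝓞 F)))
    (hdy : ∀ v : HeightOneSpectrum (𝓞 F), vl v 2 < 1 → v ∈ S) :
    (D0 S).relIndex (WS S) ≤ 2 ^ (S.card + Module.finrank ℚ F) ∧ (D0 S).relIndex (WS S) ≠ 0 := by
  classical
  set R := 𝓞 F ⧸ modS S
  have h1 : ∀ w : WS S, ∃ r : 𝓞 F, ∀ v ∈ S, vl v (algebraMap (𝓞 F) F r - ((w : Fˣ) : F)) < vl v 4 := by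
    intro w
    exact approx_int S (fun _ => ((w : Fˣ) : F)) (fun v hv => (mem_WS.mp w.2 v hv).le) (fun v => vl v 4)
      (fun v => vl_four_ne v)
  choose r hr using h1
  have hrW : ∀ w, ∀ v ∈ S, vl v (algebraMap (𝓞 F) F (r w)) = 1 := by
    intro w v hv
    have hw := mem_WS.mp w.2 v hv
    rw [mem_W] at hw
    have := Valuation.map_add_eq_of_lt_right (vl v) (x := algebraMap (𝓞 F) F (r w) - ((w : Fˣ) : F)) (y := ((w : Fˣ) : F))
      (by rw [hw]; exact (hr w v hv).trans_le (vl_four_le v))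
    rw [sub_add_cancel, hw] at this; exact this
  have hu : ∀ w, IsUnit (Ideal.Quotient.mk (modS S) (r w)) := fun w =>
    isUnit_mk_modS hdy (fun v hv h => by
      rw [← vl_lt_one_iff, hrW w v hv] at h; exact lt_irrefl _ h)
  let g : WS S → Rˣ ⧸ (powMonoidHom 2 : Rˣ →* Rˣ).range := fun w => QuotientGroup.mk (hu w).unit
  have hg : ∀ w w', g w = g w' → w⁻¹ * w' ∈ (D0 S).subgroupOf (WS S) := by
    intro w w' h
    obtain ⟨y, hy⟩ := QuotientGroup.eq.mp h
    rw [powMonoidHom_apply] at hy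
    have hy2 : (hu w').unit = (hu w).unit * y ^ 2 := by rw [hy]; group
    obtain ⟨t, ht⟩ := Ideal.Quotient.mk_surjective (y : R)
    have h2 : r w' - r w * t ^ 2 ∈ modS S := by
      rw [← Ideal.Quotient.eq]
      have := congrArg Units.val hy2
      simp only [IsUnit.unit_spec, Units.val_mul, Units.val_pow_eq_pow_val] at this
      rw [this, map_mul, map_pow, ht]
    rw [Subgroup.mem_subgroupOf, mem_D0]
    intro v hv
    have h3 := vl_lt_of_mem_modS h2 hv
    have ht0 : algebraMap (𝓞 F) F t ≠ 0 := by
      intro h0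
      rw [map_sub, map_mul, map_pow, h0, zero_pow two_ne_zero, mul_zero, sub_zero, hrW w' v hv] at h3
      exact absurd h3 (not_lt.mpr (vl_four_le v))
    have ew : ∀ w, algebraMap (𝓞 F) F (r w) ≠ 0 := by
      intro w h0
      have := hrW w v hv
      rw [h0] at this; simp at this
    have e1 : ∀ w, (Units.mk0 _ (ew w)) / (w : Fˣ) ∈ Sq v := by
      intro w
      apply div_mem_Sq
      rw [map_mul, mem_W.mp (mem_WS.mp w.2 v hv), mul_one]
      exact hr w v hv
    have hvt : vl v (algebraMap (𝓞 F) F t) = 1 := by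
      have h4 : vl v (algebraMap (𝓞 F) F (r w * t ^ 2)) = 1 := by
        have := Valuation.map_sub_eq_of_lt_left (vl v) (x := algebraMap (𝓞 F) F (r w')) (y := algebraMap (𝓞 F) F (r w' - r w * t ^ 2))
          (by rw [hrW w' v hv]; exact h3.trans_le (vl_four_le v))
        rw [hrW w' v hv, ← map_sub, sub_sub_cancel] at this
        exact this
      rw [map_mul, map_mul, hrW w v hv, one_mul, map_pow, map_pow] at h4
      exact (pow_eq_one_iff.mp h4).resolve_right (by norm_num)
    have e2 : Units.mk0 _ (ew w') / (Units.mk0 _ (ew w) * Units.mk0 _ ht0 ^ 2) ∈ Sq v := by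
      apply div_mem_Sq
      push_cast [Units.val_mk0]
      rw [map_mul, map_mul, map_pow, hrW w v hv, hvt]
      simpa using h3
    have e3 := (Sq v).div_mem (mul_mem e2 (e1 w)) (e1 w')
    have e4 := mul_mem e3 (sq_mem_Sq v (Units.mk0 _ ht0))
    have : ((w⁻¹ * w' : WS S) : Fˣ) = Units.mk0 _ (ew w') / (Units.mk0 _ (ew w) * Units.mk0 _ ht0 ^ 2) * (Units.mk0 _ (ew w) / (w : Fˣ)) / (Units.mk0 _ (ew w') / (w' : Fˣ)) * (Units.mk0 _ ht0) ^ 2 := by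
      ext
      have h1 := ew w; have h2 := ew w'; have := (w : Fˣ).ne_zero; have := (w' : Fˣ).ne_zero
      push_cast [Units.val_mk0]
      field_simp
    rw [this]; exact e4
  let f : (WS S) ⧸ (D0 S).subgroupOf (WS S) → Rˣ ⧸ (powMonoidHom 2 : Rˣ →* Rˣ).range := fun q => g q.out
  have hf : Function.Injective f := by
    intro q q' h
    have := hg _ _ h
    rw [← QuotientGroup.out_eq' q, ← QuotientGroup.out_eq' q']
    exact QuotientGroup.eq.mpr this
  have hle := Nat.card_le_card_of_injective f hf
  have hfin : Finite ((WS S) ⧸ (D0 S).subgroupOf (WS S)) := Finite.of_injective f hf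
  refine ⟨?_, ?_⟩
  · refine (hle.trans_eq ?_).trans (card_two_torsion S)
    exact index_pow_two_eq
  · rw [Subgroup.relIndex, Subgroup.index_eq_card]
    exact Nat.card_pos.ne'

/-- even orders -/
noncomputable def evHom (S : Finset (HeightOneSpectrum (𝓞 F))) : Fˣ →* Multiplicative (S → ZMod 2) where
  toFun u := Multiplicative.ofAdd (fun v => ((ord v.1 u : ℤ) : ZMod 2))
  map_one' := by
    rw [ofAdd_eq_one]; ext v; simp [ord_one]
  map_mul' a b := by
    rw [← ofAdd_add]; congr 1; ext v; simp [ord_mul]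

lemma mem_ker_evHom {S : Finset (HeightOneSpectrum (𝓞 F))} {u : Fˣ} :
    u ∈ (evHom S).ker ↔ ∀ v ∈ S, Even (ord v u) := by
  rw [MonoidHom.mem_ker]
  change Multiplicative.ofAdd _ = 1 ↔ _
  rw [ofAdd_eq_one, funext_iff]
  simp only [Pi.zero_apply, ZMod.intCast_zmod_eq_zero_iff_dvd, Subtype.forall, even_iff_two_dvd, Nat.cast_ofNat]

lemma index_D0 (S : Finset (HeightOneSpectrum (𝓞 F)))
    (hdy : ∀ v : HeightOneSpectrum (𝓞 F), vl v 2 < 1 → v ∈ S) :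
    (D0 S).index ≤ 2 ^ (2 * S.card + Module.finrank ℚ F) ∧ (D0 S).index ≠ 0 := by
  classical
  set E := (evHom S).ker with hE
  have hDE : D0 S ≤ E := by
    intro u hu
    rw [hE, mem_ker_evHom]
    exact fun v hv => ord_even_of_mem_Sq (mem_D0.mp hu v hv)
  have hEW : E ≤ WS S ⊔ D0 S := by
    intro u hu
    rw [hE, mem_ker_evHom] at hu
    choose! k hk using hu
    obtain ⟨y, hy⟩ := exists_ords S k
    have h1 : u / y ^ 2 ∈ WS S := by
      rw [mem_WS]; intro v hv
      rw [mem_W_iff_ord, ord_div, ord_sq, hy v hv, hk v hv]; ring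
    have := Subgroup.mul_mem_sup h1 (Q_le_D0 S (sq_mem_Q y))
    simpa using this
  obtain ⟨hle, hne⟩ := relIndex_D0_WS S hdy
  have h3 : (D0 S).relIndex (WS S ⊔ D0 S) = (D0 S).relIndex (WS S) := Subgroup.relIndex_sup_right _ _
  have h4 : (D0 S).relIndex E ≤ (D0 S).relIndex (WS S) := by
    rw [← h3]
    refine Subgroup.relIndex_le_of_le_right hEW (by rw [h3]; exact hne)
  have h5 : E.index ≤ 2 ^ S.card := by
    rw [hE, Subgroup.index_ker]
    have := Subgroup.card_le_card_group (evHom S).range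
    refine this.trans_eq ?_
    rw [Nat.card_congr (Multiplicative.toAdd), Nat.card_fun]
    simp
  have h6 := Subgroup.relIndex_mul_index hDE
  constructor
  · rw [← h6, two_mul, add_right_comm, pow_add]
    exact Nat.mul_le_mul (h4.trans hle) h5
  · rw [← h6]
    refine mul_ne_zero ?_ ?_
    · exact fun h0 => hne (by rw [← h3]; exact Subgroup.relIndex_eq_zero_of_le_right hEW h0)
    · rw [hE, Subgroup.index_ker]
      exact Nat.card_pos.ne'

end nf
end HM

open NumberField IsDedekindDomain
open scoped WithZero
namespace HM
section nf
variable {F : Type*} [Field F] [NumberField F]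

lemma card_realEmb (F : Type*) [Field F] [NumberField F] :
    Finite (F →+* ℝ) ∧ Nat.card (F →+* ℝ) = InfinitePlace.nrRealPlaces F := by
  classical
  let e : (F →+* ℝ) ≃ {φ : F →+* ℂ // ComplexEmbedding.IsReal φ} :=
    { toFun := fun σ => ⟨Complex.ofRealHom.comp σ, by
        rw [ComplexEmbedding.isReal_iff]
        ext x; simp⟩
      invFun := fun φ => φ.2.embedding
      left_inv := by
        intro σ; ext x
        apply Complex.ofReal_injective
        rw [ComplexEmbedding.IsReal.coe_embedding_apply]; simp
      right_inv := by
        intro φ; ext x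
        simp }
  refine ⟨Finite.of_equiv _ e.symm, ?_⟩
  rw [Nat.card_congr e, Nat.card_eq_fintype_card, InfinitePlace.card_real_embeddings]
  

def Pos1 (σ : F →+* ℝ) : Subgroup Fˣ where
  carrier := {u | 0 < σ u}
  one_mem' := by simp
  mul_mem' := by
    intro a b ha hb
    simp only [Set.mem_ofPred_eq, Units.val_mul, map_mul] at *
    exact mul_pos ha hb
  inv_mem' := by
    intro a ha
    simp only [Set.mem_ofPred_eq, Units.val_inv_eq_inv_val, map_inv₀] at *
    exact inv_pos.mpr ha

lemma mem_Pos1 {σ : F →+* ℝ} {u : Fˣ} : u ∈ Pos1 σ ↔ 0 < σ u := Iff.rfl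

def Pos (F : Type*) [Field F] [NumberField F] : Subgroup Fˣ := ⨅ σ : F →+* ℝ, Pos1 σ

lemma mem_Pos {u : Fˣ} : u ∈ Pos F ↔ ∀ σ : F →+* ℝ, 0 < σ u := by
  simp [Pos, Subgroup.mem_iInf, mem_Pos1]

lemma Q_le_Pos : Q F ≤ Pos F := by
  rintro _ ⟨y, rfl⟩
  rw [mem_Pos]
  intro σ
  have : σ (y : F) ≠ 0 := by simp
  simp only [powMonoidHom_apply, Units.val_pow_eq_pow_val, map_pow]
  positivity

lemma index_Pos1 (σ : F →+* ℝ) : (Pos1 σ).index ≤ 2 ∧ (Pos1 σ).index ≠ 0 := by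
  have : (Pos1 σ).index ∣ 2 := by
    rw [Subgroup.index_dvd_two_iff]
    refine ⟨-1, fun b => ?_⟩
    simp only [mem_Pos1, mul_neg, mul_one, Units.val_neg, map_neg]
    have : σ (b : F) ≠ 0 := by simp
    rcases lt_or_gt_of_ne this with h | h
    · left; linarith
    · right; exact h
  exact ⟨Nat.le_of_dvd (by norm_num) this, fun h => by rw [h] at this; simp at this⟩

lemma index_Pos : (Pos F).index ≤ 2 ^ InfinitePlace.nrRealPlaces F ∧ (Pos F).index ≠ 0 := by
  obtain ⟨hfin, hcard⟩ := card_realEmb F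
  have := Fintype.ofFinite (F →+* ℝ)
  constructor
  · refine (Subgroup.index_iInf_le _).trans ?_
    refine (Finset.prod_le_pow_card _ _ 2 (fun σ _ => (index_Pos1 σ).1)).trans_eq ?_
    rw [← hcard, Nat.card_eq_fintype_card, Finset.card_univ]
  · exact Subgroup.index_iInf_ne_zero (fun σ => (index_Pos1 σ).2)

noncomputable def DD (S : Finset (HeightOneSpectrum (𝓞 F))) : Subgroup Fˣ := D0 S ⊓ Pos F

lemma card_inf (F : Type*) [Field F] [NumberField F] :
   2 * Fintype.card (InfinitePlace F) = Module.finrank ℚ F + InfinitePlace.nrRealPlaces F := by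
  have := InfinitePlace.card_add_two_mul_card_eq_rank F
  have h2 := InfinitePlace.card_eq_nrRealPlaces_add_nrComplexPlaces F
  omega

lemma index_DD (S : Finset (HeightOneSpectrum (𝓞 F)))
    (hdy : ∀ v : HeightOneSpectrum (𝓞 F), vl v 2 < 1 → v ∈ S) :
    (DD S).index ≤ 2 ^ (2 * (S.card + Fintype.card (InfinitePlace F))) ∧ (DD S).index ≠ 0 := by
  obtain ⟨h1, h2⟩ := index_D0 S hdy
  obtain ⟨h3, h4⟩ := index_Pos (F := F)
  constructor
  · refine Subgroup.index_inf_le.trans ?_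
    rw [mul_add, card_inf, ← add_assoc, pow_add]
    exact Nat.mul_le_mul h1 h3
  · exact Subgroup.index_inf_ne_zero h2 h4

end nf
end HM

open NumberField IsDedekindDomain
open scoped WithZero
namespace HM

/-- If `μ` is a finite subgroup containing all 2-power-torsion stuff, squares index -/
lemma index_units_sq (F : Type*) [Field F] [NumberField F] :
    (powMonoidHom 2 : (𝓞 F)ˣ →* (𝓞 F)ˣ).range.index = 2 ^ (Fintype.card (InfinitePlace F)) := by
  classical
  set R := (powMonoidHom 2 : (𝓞 F)ˣ →* (𝓞 F)ˣ).range with hR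
  set μ := Units.torsion F with hμ
  have h1 : R.relIndex (R ⊔ μ) * (R ⊔ μ).index = R.index := Subgroup.relIndex_mul_index le_sup_left
  have h2 : R.relIndex (R ⊔ μ) = 2 := by
    rw [sup_comm, Subgroup.relIndex_sup_right]
    have h3 : R.subgroupOf μ = (powMonoidHom 2 : μ →* μ).range := by
      ext ⟨z, hz⟩
      rw [Subgroup.mem_subgroupOf]
      constructor
      · rintro ⟨y, hy⟩
        change y ^ 2 = z at hy
        refine ⟨⟨y, ?_⟩, Subtype.ext hy⟩
        rw [hμ, Units.torsion, CommGroup.mem_torsion] at hz ⊢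
        rw [← hy] at hz
        exact (isOfFinOrder_pow.mp hz).resolve_right (by norm_num)
      · rintro ⟨y, hy⟩
        exact ⟨y, congrArg Subtype.val hy⟩
    rw [Subgroup.relIndex, h3, index_pow_two_eq]
    rw [Nat.card_eq_two_iff]
    have hm : (-1 : (𝓞 F)ˣ) ∈ μ := by
      rw [hμ, Units.torsion, CommGroup.mem_torsion]
      exact isOfFinOrder_iff_pow_eq_one.mpr ⟨2, by norm_num, by norm_num⟩
    refine ⟨1, ⟨⟨-1, hm⟩, ?_⟩, ?_, ?_⟩
    · rw [MonoidHom.mem_ker]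
      ext; simp
    · intro h
      have := congrArg (fun z : (powMonoidHom 2 : μ →* μ).ker => (((z : μ) : (𝓞 F)ˣ) : 𝓞 F)) h
      simp at this
      have h2 : (2 : 𝓞 F) = 0 := by linear_combination this
      norm_num at h2
    · ext ⟨⟨z, hz⟩, hz2⟩
      simp only [Set.mem_insert_iff, Set.mem_singleton_iff, Set.mem_univ, iff_true]
      rw [MonoidHom.mem_ker] at hz2
      have h5 : z ^ 2 = 1 := congrArg Subtype.val hz2
      have h6 : (z : 𝓞 F) ^ 2 = 1 := by rw [← Units.val_pow_eq_pow_val, h5]; rfl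
      have h7 : ((z : 𝓞 F) - 1) * ((z : 𝓞 F) + 1) = 0 := by linear_combination h6
      rcases (mul_eq_zero.mp h7).imp sub_eq_zero.mp eq_neg_of_add_eq_zero_left with h | h
      · left; ext; simp [h]
      · right; ext; simp [h]
  have h3 : (R ⊔ μ).index = 2 ^ (Units.rank F) := by
    have h4 : R ⊔ μ = (powMonoidHom (α := (𝓞 F)ˣ ⧸ μ) 2).range.comap (QuotientGroup.mk' μ) := by
      apply le_antisymm
      · rw [sup_le_iff]
        constructor
        · rintro _ ⟨y, rfl⟩
          exact ⟨QuotientGroup.mk y, rfl⟩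
        · intro z hz
          rw [Subgroup.mem_comap]
          have : QuotientGroup.mk' μ z = 1 := (QuotientGroup.eq_one_iff z).mpr hz
          rw [this]; exact one_mem _
      · rintro z ⟨y, hy⟩
        obtain ⟨y, rfl⟩ := QuotientGroup.mk_surjective y
        change (QuotientGroup.mk (y ^ 2) : (𝓞 F)ˣ ⧸ μ) = QuotientGroup.mk z at hy
        rw [QuotientGroup.eq] at hy
        have := Subgroup.mul_mem_sup (S := R) ⟨y, rfl⟩ hy
        simpa using this
    rw [h4, Subgroup.index_comap_of_surjective _ (QuotientGroup.mk'_surjective μ)]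
    have h5 := AddSubgroup.index_range_nsmul (Additive ((𝓞 F)ˣ ⧸ μ)) 2
    rw [Units.finrank_modTorsion] at h5
    rw [← h5, ← Subgroup.index_toAddSubgroup]
    congr 1
  rw [← h1, h2, h3, Units.rank, ← pow_succ']
  congr 1
  have : 0 < Fintype.card (InfinitePlace F) := Fintype.card_pos
  omega

lemma relIndex_chain {A : Type*} [CommGroup A] (Q : Subgroup A) {H G : Subgroup A} (hle : H ≤ G) :
    Q.relIndex G = Q.relIndex H * (Q ⊔ H).relIndex G := by
  have e1 : Q.relIndex H = (Q ⊓ G).relIndex ((Q ⊓ G) ⊔ H) := by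
    rw [sup_comm, Subgroup.relIndex_sup_right, ← Subgroup.inf_relIndex_right, ← Subgroup.inf_relIndex_right (Q ⊓ G),
       inf_assoc, inf_eq_right.mpr hle]
  have e2 : (Q ⊔ H).relIndex G = ((Q ⊓ G) ⊔ H).relIndex G := by
    rw [← Subgroup.inf_relIndex_right]
    congr 1
    apply le_antisymm
    · rintro x ⟨h1, h2⟩
      obtain ⟨y, hy, z, hz, rfl⟩ := Subgroup.mem_sup.mp h1
      refine Subgroup.mul_mem_sup ⟨hy, ?_⟩ hz
      have := G.div_mem h2 (hle hz)
      rwa [mul_div_cancel_right] at this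
    · exact le_inf (sup_le_sup_right inf_le_left _) (sup_le inf_le_right hle)
  rw [e1, e2, Subgroup.relIndex_mul_relIndex _ _ _ le_sup_left (sup_le inf_le_right hle),
      Subgroup.inf_relIndex_right]

section nf
variable {F : Type*} [Field F] [NumberField F]

noncomputable def U (S : Finset (HeightOneSpectrum (𝓞 F))) : Subgroup Fˣ := ⨅ v ∈ {v | v ∉ S}, W v

lemma mem_U {S : Finset (HeightOneSpectrum (𝓞 F))} {u : Fˣ} :
    u ∈ U S ↔ ∀ v ∉ S, vl v (u : F) = 1 := by
  simp [U, Subgroup.mem_iInf, mem_W]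

lemma mem_U_ord {S : Finset (HeightOneSpectrum (𝓞 F))} {u : Fˣ} :
    u ∈ U S ↔ ∀ v ∉ S, ord v u = 0 := by
  simp [U, Subgroup.mem_iInf, mem_W_iff_ord]

lemma U_mono {S T : Finset (HeightOneSpectrum (𝓞 F))} (h : S ⊆ T) : U S ≤ U T := by
  intro u hu
  rw [mem_U] at *
  exact fun v hv => hu v (fun h' => hv (h h'))

lemma sq_mem_U {S : Finset (HeightOneSpectrum (𝓞 F))} {u : Fˣ} (h : u ^ 2 ∈ U S) : u ∈ U S := by
  rw [mem_U_ord] at *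
  intro v hv
  have := h v hv
  rw [ord_sq] at this; omega

lemma exists_prime_power_gen (v : HeightOneSpectrum (𝓞 F)) :
    ∃ u : Fˣ, ord v u ≠ 0 ∧ ∀ w ≠ v, ord w u = 0 := by
  classical
  have hp : (v.asIdeal ^ classNumber F).IsPrincipal := by
    have hv : v.asIdeal ∈ nonZeroDivisors (Ideal (𝓞 F)) := mem_nonZeroDivisors_of_ne_zero v.ne_bot
    have := pow_card_eq_one' (G := ClassGroup (𝓞 F)) (x := ClassGroup.mk0 ⟨v.asIdeal, hv⟩)
    rw [← map_pow] at this
    rw [ClassGroup.mk0_eq_one_iff] at this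
    rw [Nat.card_eq_fintype_card] at this
    exact this
  obtain ⟨g, hg⟩ := hp
  have hh : classNumber F ≠ 0 := by
    unfold classNumber; exact Fintype.card_ne_zero
  have hg0 : g ≠ 0 := by
    rintro rfl
    have : v.asIdeal ^ classNumber F = 0 := by rw [hg]; simp
    exact v.ne_bot (pow_eq_zero_iff hh |>.mp this)
  have hgF : algebraMap (𝓞 F) F g ≠ 0 := by simpa using hg0
  refine ⟨Units.mk0 _ hgF, ?_, ?_⟩
  · rw [Ne, ← mem_W_iff_ord, mem_W]
    have : g ∈ v.asIdeal := by
      apply Ideal.pow_le_self hh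
      rw [hg]; exact Ideal.mem_span_singleton_self g
    exact ((vl_lt_one_iff v g).mpr this).ne
  · intro w hw
    rw [← mem_W_iff_ord, mem_W]
    refine le_antisymm (vl_int_le w g) ?_
    by_contra hlt
    have hgw : g ∈ w.asIdeal := (vl_lt_one_iff w g).mp (not_le.mp hlt)
    have : v.asIdeal ^ classNumber F ≤ w.asIdeal := by
      rw [hg]
      exact (Ideal.span_singleton_le_iff_mem _).mpr hgw
    have h1 : v.asIdeal ≤ w.asIdeal := w.isPrime.le_of_pow_le this
    exact hw (HeightOneSpectrum.ext (v.isMaximal.eq_of_le w.isPrime.ne_top h1).symm)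

lemma relIndex_U_insert (S : Finset (HeightOneSpectrum (𝓞 F))) [DecidableEq (HeightOneSpectrum (𝓞 F))]
    (v : HeightOneSpectrum (𝓞 F)) (hv : v ∉ S) :
    (Q F).relIndex (U (insert v S)) = 2 * (Q F).relIndex (U S) := by
  set G := U (insert v S) with hG
  have hle : U S ≤ G := U_mono (Finset.subset_insert v S)
  -- image of ord v on G
  let φ : Additive G →+ ℤ := 
    { toFun := fun g => ord v g.toMul.1
      map_zero' := ord_one v
      map_add' := fun a b => ord_mul v _ _ }
  obtain ⟨n, hn⟩ := Int.subgroup_cyclic φ.range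
  have hn0 : n ≠ 0 := by
    rintro rfl
    obtain ⟨u, h1, h2⟩ := exists_prime_power_gen v
    have hu : u ∈ G := by
      rw [hG, mem_U_ord]; intro w hw; apply h2; rintro rfl; exact hw (Finset.mem_insert_self _ _)
    have : φ (Additive.ofMul ⟨u, hu⟩) ∈ φ.range := ⟨_, rfl⟩
    rw [hn] at this
    rw [← AddSubgroup.zmultiples_eq_closure, Int.mem_zmultiples_iff] at this
    exact h1 (zero_dvd_iff.mp this)
  have hdiv : ∀ u ∈ G, n ∣ ord v u := by
    intro u hu
    have : φ (Additive.ofMul ⟨u, hu⟩) ∈ φ.range := ⟨_, rfl⟩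
    rw [hn, ← AddSubgroup.zmultiples_eq_closure, Int.mem_zmultiples_iff] at this
    exact this
  obtain ⟨g, hgG, hg⟩ : ∃ g ∈ G, ord v g = n := by
    have : n ∈ φ.range := by rw [hn]; exact AddSubgroup.subset_closure rfl
    obtain ⟨x, hx⟩ := this
    exact ⟨x.toMul.1, x.toMul.2, hx⟩
  have hUS : ∀ u ∈ G, ord v u = 0 → u ∈ U S := by
    intro u hu h0
    rw [mem_U_ord]; intro w hw
    by_cases hwv : w = v
    · rw [hwv, h0]
    · exact (mem_U_ord.mp hu) w (by simp [hwv, hw])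
  have h1 : (Q F ⊔ U S).relIndex G = 2 := by
    rw [Subgroup.relIndex, Subgroup.index_eq_two_iff]
    have key : ∀ u ∈ G, u ∈ Q F ⊔ U S ↔ Even (ord v u / n) := by
      intro u hu
      obtain ⟨k, hk⟩ := hdiv u hu
      rw [hk, Int.mul_ediv_cancel_left _ hn0]
      constructor
      · intro h
        rw [Subgroup.mem_sup] at h
        obtain ⟨x, hx, z, hz, hxz⟩ := h
        obtain ⟨y, hy⟩ : ∃ y : Fˣ, y ^ 2 = x := by
          obtain ⟨y, hy⟩ := hx; exact ⟨y, hy⟩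
        rw [← hxz, ← hy] at hk hu
        have hyG : y ∈ G := by
          apply sq_mem_U
          have := div_mem hu (hle hz)
          simpa using this
        obtain ⟨m, hm⟩ := hdiv y hyG
        have hz0 := (mem_U_ord.mp hz) v hv
        rw [ord_mul, hz0] at hk
        rw [ord_sq, hm] at hk
        have : 2 * m = k := by
          apply mul_left_cancel₀ hn0; linarith
        exact ⟨m, by omega⟩
      · rintro ⟨m, rfl⟩
        have h3 : u / (g ^ m) ^ 2 ∈ U S := by
          apply hUS _ (div_mem hu (pow_mem (zpow_mem hgG m) 2))
          rw [ord_div, ord_sq, ord_zpow, hg, hk]; ring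
        have := Subgroup.mul_mem_sup (sq_mem_Q (g ^ m)) h3
        simpa using this
    refine ⟨⟨g, hgG⟩, ?_⟩
    rintro ⟨b, hb⟩
    rw [Subgroup.mem_subgroupOf, Subgroup.mem_subgroupOf]
    change Xor' (b * g ∈ _) (b ∈ _)
    rw [key _ (mul_mem hb hgG), key _ hb, ord_mul, hg]
    obtain ⟨k, hk⟩ := hdiv b hb
    rw [hk, show n * k + n = n * (k + 1) by ring, Int.mul_ediv_cancel_left _ hn0,
      Int.mul_ediv_cancel_left _ hn0, Int.even_add_one]
    unfold Xor'; tauto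
  have h2 := relIndex_chain (Q F) hle
  rw [h2, h1, mul_comm]

theorem relIndex_U (S : Finset (HeightOneSpectrum (𝓞 F))) :
    (Q F).relIndex (U S) = 2 ^ (S.card + Fintype.card (InfinitePlace F)) := by
  classical
  induction S using Finset.induction_on with
  | empty =>
    rw [Finset.card_empty, zero_add, ← index_units_sq F]
    have h1 : U (∅ : Finset (HeightOneSpectrum (𝓞 F))) = (Units.map (algebraMap (𝓞 F) F).toMonoidHom).range := by
      ext u
      rw [mem_U]
      constructor
      · intro h
        obtain ⟨a, ha⟩ := int_of_vl (x := (u : F)) (fun v => (h v (by simp)).le)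
        obtain ⟨b, hb⟩ := int_of_vl (x := ((u⁻¹ : Fˣ) : F)) (fun v => by
          have := h v (by simp)
          rw [Units.val_inv_eq_inv_val, map_inv₀, this]; simp)
        have hab : a * b = 1 := by
          apply IsFractionRing.injective (𝓞 F) F
          rw [map_mul, map_one, ha, hb]; simp
        exact ⟨⟨a, b, hab, by rw [mul_comm, hab]⟩, Units.ext ha⟩
      · rintro ⟨a, rfl⟩ v -
        have e1 := vl_int_le v (a : 𝓞 F)
        have e2 := vl_int_le v ((a⁻¹ : (𝓞 F)ˣ) : 𝓞 F)
        have e3 : vl v (algebraMap (𝓞 F) F a) * vl v (algebraMap (𝓞 F) F ((a⁻¹ : (𝓞 F)ˣ) : 𝓞 F)) = 1 := by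
          rw [← map_mul, ← map_mul]; simp
        exact le_antisymm e1 (by
          rw [← e3]; exact mul_le_of_le_one_right' e2)
    rw [h1, Subgroup.relIndex, ← Subgroup.index_comap_of_surjective _ (MonoidHom.rangeRestrict_surjective _)]
    congr 1
    ext z
    rw [Subgroup.mem_comap, Subgroup.mem_subgroupOf]
    constructor
    · rintro ⟨y, hy⟩
      have hz : ((Units.map (algebraMap (𝓞 F) F).toMonoidHom) z) ∈ U (∅ : Finset (HeightOneSpectrum (𝓞 F))) := by
        rw [h1]; exact ⟨z, rfl⟩
      have hy2 : y ^ 2 = (Units.map (algebraMap (𝓞 F) F).toMonoidHom) z := hy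
      rw [← hy2] at hz
      have hy3 := sq_mem_U hz
      rw [h1] at hy3
      obtain ⟨y, rfl⟩ := hy3
      refine ⟨y, ?_⟩
      rw [← map_pow] at hy2
      exact Units.map_injective (IsFractionRing.injective (𝓞 F) F) hy2
    · rintro ⟨y, rfl⟩
      exact ⟨Units.map (algebraMap (𝓞 F) F).toMonoidHom y, by rw [MonoidHom.coe_rangeRestrict]; simp⟩
  | insert v S hv ih =>
    rw [relIndex_U_insert S v hv, ih, Finset.card_insert_of_notMem hv]
    ring

end nf
end HM

open NumberField IsDedekindDomain
open scoped WithZero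
namespace HM
section nf
variable {F : Type*} [Field F] [NumberField F]

lemma finite_dvd {I : Ideal (𝓞 F)} (hI : I ≠ ⊥) :
    {v : HeightOneSpectrum (𝓞 F) | I ≤ v.asIdeal}.Finite := by
  have := Ideal.finite_factors hI
  refine this.subset ?_
  intro v hv
  exact Ideal.dvd_iff_le.mpr hv

lemma finite_bad_int {a : 𝓞 F} (ha : a ≠ 0) :
    {v : HeightOneSpectrum (𝓞 F) | vl v (algebraMap (𝓞 F) F a) ≠ 1}.Finite := by
  refine (finite_dvd (I := Ideal.span {a}) (by simpa using ha)).subset ?_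
  intro v hv
  change Ideal.span {a} ≤ v.asIdeal
  rw [Ideal.span_singleton_le_iff_mem, ← vl_lt_one_iff]
  exact lt_of_le_of_ne (vl_int_le v a) hv

lemma finite_bad {u : F} (hu : u ≠ 0) : {v : HeightOneSpectrum (𝓞 F) | vl v u ≠ 1}.Finite := by
  obtain ⟨a, b, hb, hab⟩ := IsFractionRing.div_surjective (A := 𝓞 F) u
  have hb0 : b ≠ 0 := nonZeroDivisors.ne_zero hb
  have ha0 : a ≠ 0 := by rintro rfl; simp at hab; exact hu hab.symm
  refine ((finite_bad_int ha0).union (finite_bad_int hb0)).subset ?_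
  intro v hv
  by_contra hcon
  simp only [Set.mem_union, Set.mem_ofPred_eq, not_or, not_not] at hcon
  apply hv
  rw [← hab, map_div₀, hcon.1, hcon.2, div_one]

lemma finite_dyadic (F : Type*) [Field F] [NumberField F] :
    {v : HeightOneSpectrum (𝓞 F) | vl v (2 : F) < 1}.Finite :=
  (finite_bad (u := (2 : F)) two_ne_zero).subset (fun _ hv => ne_of_lt hv)

def ClS (S : Finset (HeightOneSpectrum (𝓞 F))) : Prop :=
  ∀ I : Ideal (𝓞 F), I ≠ ⊥ → ∃ f : Fˣ, ∀ v ∉ S,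
    (∀ i ∈ I, vl v (algebraMap (𝓞 F) F i) ≤ vl v (f : F)) ∧
      ∃ i ∈ I, vl v (algebraMap (𝓞 F) F i) = vl v (f : F)

lemma ClS_mono {S T : Finset (HeightOneSpectrum (𝓞 F))} (h : S ⊆ T) (hS : ClS S) : ClS T := by
  intro I hI
  obtain ⟨f, hf⟩ := hS I hI
  exact ⟨f, fun v hv => hf v (fun h' => hv (h h'))⟩

lemma exists_ClS (F : Type*) [Field F] [NumberField F] :
    ∃ S : Finset (HeightOneSpectrum (𝓞 F)), ClS S := by
  classical
  choose J hJ using fun c : ClassGroup (𝓞 F) => ClassGroup.mk0_surjective c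
  have hJ0 : ∀ c, (J c : Ideal (𝓞 F)) ≠ ⊥ := fun c => nonZeroDivisors.ne_zero (J c).2
  refine ⟨Finset.univ.biUnion fun c => (finite_dvd (hJ0 c)).toFinset, ?_⟩
  intro I hI
  set c := ClassGroup.mk0 ⟨I, mem_nonZeroDivisors_of_ne_zero hI⟩ with hc
  have h1 := hJ c
  rw [hc, ClassGroup.mk0_eq_mk0_iff, ← hc] at h1
  obtain ⟨y, x, hy, hx, hxy⟩ := h1
  have hxF : algebraMap (𝓞 F) F x ≠ 0 := by simpa using hx
  have hyF : algebraMap (𝓞 F) F y ≠ 0 := by simpa using hy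
  refine ⟨Units.mk0 _ (div_ne_zero hyF hxF), ?_⟩
  intro v hv
  simp only [Units.val_mk0]
  have hvJ : ¬ (J c : Ideal (𝓞 F)) ≤ v.asIdeal := by
    intro hle
    apply hv
    simp only [Finset.mem_biUnion, Finset.mem_univ, true_and, Set.Finite.mem_toFinset]
    exact ⟨c, hle⟩
  have hx0 : vl v (algebraMap (𝓞 F) F x) ≠ 0 := by simpa using hx
  constructor
  · intro i hi
    have : x * i ∈ Ideal.span {y} * (J c : Ideal (𝓞 F)) := by
      rw [hxy]; exact Ideal.mul_mem_mul (Ideal.mem_span_singleton_self x) hi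
    obtain ⟨j, hj, hji⟩ := Ideal.mem_span_singleton_mul.mp this
    have h2 : vl v (algebraMap (𝓞 F) F x) * vl v (algebraMap (𝓞 F) F i) ≤ vl v (algebraMap (𝓞 F) F y) := by
      rw [← map_mul, ← map_mul, ← hji, map_mul, map_mul]
      exact mul_le_of_le_one_right' (vl_int_le v j)
    rw [map_div₀, le_div_iff₀ (by simpa [zero_lt_iff] using hx), mul_comm]
    exact h2
  · obtain ⟨j, hj, hjv⟩ := Set.not_subset.mp hvJ
    have : y * j ∈ Ideal.span {x} * I := by
      rw [← hxy]; exact Ideal.mul_mem_mul (Ideal.mem_span_singleton_self y) hj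
    obtain ⟨i, hi, hij⟩ := Ideal.mem_span_singleton_mul.mp this
    refine ⟨i, hi, ?_⟩
    have hj1 : vl v (algebraMap (𝓞 F) F j) = 1 := by
      refine le_antisymm (vl_int_le v j) ?_
      by_contra hlt
      exact hjv ((vl_lt_one_iff v j).mp (not_le.mp hlt))
    have h2 : vl v (algebraMap (𝓞 F) F x) * vl v (algebraMap (𝓞 F) F i) = vl v (algebraMap (𝓞 F) F y) := by
      rw [← map_mul, ← map_mul, hij, map_mul, map_mul, hj1, mul_one]
    rw [map_div₀, eq_div_iff hx0, mul_comm]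
    exact h2

end nf
end HM

open NumberField IsDedekindDomain
open scoped WithZero
namespace HM

section ext
variable {F : Type*} [Field F] [NumberField F] {M : Type*} [Field M] [NumberField M] [Algebra F M]

variable (F) in
noncomputable def dn (P : HeightOneSpectrum (𝓞 M)) : HeightOneSpectrum (𝓞 F) := P.under (𝓞 F)

lemma exists_e (P : HeightOneSpectrum (𝓞 M)) : ∃ e : ℕ, e ≠ 0 ∧ ∀ a : F,
    vl P (algebraMap F M a) = vl (dn F P) a ^ e := by
  haveI : P.asIdeal.LiesOver (dn F P).asIdeal := ⟨rfl⟩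
  refine ⟨(dn F P).asIdeal.ramificationIdx' P.asIdeal, ?_, ?_⟩
  · exact Ideal.IsDedekindDomain.ramificationIdx'_ne_zero_of_liesOver P.asIdeal (dn F P).ne_bot
  · intro a
    exact (HeightOneSpectrum.valuation_liesOver M (dn F P) P a).symm

lemma vl_up_lt (P : HeightOneSpectrum (𝓞 M)) {a b : F} :
    vl P (algebraMap F M a) < vl P (algebraMap F M b) ↔ vl (dn F P) a < vl (dn F P) b := by
  obtain ⟨e, he, h⟩ := exists_e (F := F) P
  rw [h, h]
  exact pow_lt_pow_iff_left₀ (zero_le) (zero_le) he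

lemma vl_up_le (P : HeightOneSpectrum (𝓞 M)) {a b : F} :
    vl P (algebraMap F M a) ≤ vl P (algebraMap F M b) ↔ vl (dn F P) a ≤ vl (dn F P) b := by
  rw [← not_lt, vl_up_lt, not_lt]

lemma vl_up_eq (P : HeightOneSpectrum (𝓞 M)) {a b : F} :
    vl P (algebraMap F M a) = vl P (algebraMap F M b) ↔ vl (dn F P) a = vl (dn F P) b := by
  rw [le_antisymm_iff, vl_up_le, vl_up_le, ← le_antisymm_iff]

lemma vl_up_one (P : HeightOneSpectrum (𝓞 M)) {a : F} :
    vl P (algebraMap F M a) = 1 ↔ vl (dn F P) a = 1 := by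
  have := vl_up_eq P (a := a) (b := 1)
  simpa using this

lemma vl_up_lt_one (P : HeightOneSpectrum (𝓞 M)) {a : F} :
    vl P (algebraMap F M a) < 1 ↔ vl (dn F P) a < 1 := by
  have := vl_up_lt P (a := a) (b := 1)
  simpa using this

lemma vl_up_two_lt (P : HeightOneSpectrum (𝓞 M)) : vl P 2 < 1 ↔ vl (dn F P) 2 < 1 := by
  rw [← vl_up_lt_one, map_ofNat (algebraMap F M)]

lemma vl_up_two (P : HeightOneSpectrum (𝓞 M)) : vl P 2 = 1 ↔ vl (dn F P) 2 = 1 := by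
  rw [← vl_up_one, map_ofNat (algebraMap F M)]

variable (F M) in
noncomputable def up : Fˣ →* Mˣ := Units.map (algebraMap F M).toMonoidHom

@[simp] lemma up_val (u : Fˣ) : ((up F M u : Mˣ) : M) = algebraMap F M u := rfl

lemma up_inj : Function.Injective (up F M) := Units.map_injective (algebraMap F M).injective

lemma up_mem_Sq (P : HeightOneSpectrum (𝓞 M)) {u : Fˣ} (h : u ∈ Sq (dn F P)) : up F M u ∈ Sq P := by
  rw [mem_Sq] at *
  obtain ⟨y, hy, h⟩ := h
  refine ⟨algebraMap F M y, by simpa using hy, ?_⟩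
  rw [← vl_up_lt, map_mul, map_sub, map_pow, map_ofNat (algebraMap F M)] at h
  exact h

lemma exists_up (M : Type*) [Field M] [NumberField M] [Algebra F M] (v : HeightOneSpectrum (𝓞 F)) :
    ∃ P : HeightOneSpectrum (𝓞 M), dn F P = v := by
  obtain ⟨Q, hQ, h⟩ := Ideal.exists_maximal_ideal_liesOver_of_isIntegral (S := 𝓞 M) v.asIdeal
  have hQ0 : Q ≠ ⊥ := Ideal.ne_bot_of_liesOver_of_ne_bot v.ne_bot Q
  exact ⟨⟨Q, hQ.isPrime, hQ0⟩, HeightOneSpectrum.ext h.over.symm⟩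

lemma finite_up (M : Type*) [Field M] [NumberField M] [Algebra F M] (v : HeightOneSpectrum (𝓞 F)) :
    {P : HeightOneSpectrum (𝓞 M) | dn F P = v}.Finite := by
  obtain ⟨a, ha, ha0⟩ := Submodule.exists_mem_ne_zero_of_ne_bot v.ne_bot
  have haF : algebraMap F M (algebraMap (𝓞 F) F a) ≠ 0 := by simpa using ha0
  refine (finite_bad haF).subset ?_
  intro P hP
  have hP : dn F P = v := hP
  apply ne_of_lt
  rw [vl_up_lt_one, hP, vl_lt_one_iff]
  exact ha
end ext

structure QE (F M : Type*) [Field F] [Field M] [Algebra F M] (x : F) where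
  r : M
  hr : r ^ 2 = algebraMap F M x
  ns : ∀ y : F, x ≠ y ^ 2
  span : ∀ z : M, ∃ p q : F, z = algebraMap F M p + algebraMap F M q * r
  σ : M →ₐ[F] M
  hσ : σ r = - r
  fr : Module.finrank F M = 2

universe u in
theorem exists_QE {F : Type u} [Field F] [NumberField F] (x : F) (hx : ∀ y : F, x ≠ y ^ 2) :
    ∃ (M : Type u) (_ : Field M) (_ : NumberField M) (_ : Algebra F M), Nonempty (QE F M x) := by
  haveI : Fact (∀ r : F, r ^ 2 ≠ x + 0 * r) := ⟨fun r h => hx r (by rw [h]; ring)⟩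
  have hnf : NumberField (QuadraticAlgebra F x 0) := by
    haveI : CharZero (QuadraticAlgebra F x 0) := inferInstance
    haveI : Module.Finite ℚ (QuadraticAlgebra F x 0) := Module.Finite.trans F (QuadraticAlgebra F x 0)
    exact { }
  refine ⟨QuadraticAlgebra F x 0, inferInstance, hnf, inferInstance, ⟨?_⟩⟩
  refine ⟨⟨0, 1⟩, ?_, hx, ?_, ?_, ?_, QuadraticAlgebra.finrank_eq_two _ _⟩
  · rw [sq]; ext <;> simp
  · intro z; exact ⟨z.re, z.im, by ext <;> simp⟩
  · exact QuadraticAlgebra.lift ⟨⟨0, -1⟩, by ext <;> simp [QuadraticAlgebra.re_one, QuadraticAlgebra.im_one]⟩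
  · simp [QuadraticAlgebra.lift]

end HM

open NumberField IsDedekindDomain
open scoped WithZero
namespace HM
namespace QE
variable {F : Type*} [Field F] [NumberField F] {M : Type*} [Field M] [NumberField M] [Algebra F M] {x : F} (e : QE F M x)

lemma x_ne {F : Type*} [Field F] {M : Type*} [Field M] [Algebra F M] {x : F} (e : QE F M x) : x ≠ 0 := fun h => e.ns 0 (by rw [h]; ring)

lemma r_ne : e.r ≠ 0 := by
  intro h
  have := e.hr
  rw [h] at this
  have h2 : algebraMap F M x = 0 := by rw [← this]; ring
  exact e.x_ne (by simpa using h2)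

lemma coord_zero {p q : F} (h : algebraMap F M p + algebraMap F M q * e.r = 0) : p = 0 ∧ q = 0 := by
  by_cases hq : q = 0
  · subst hq; simpa using h
  · exfalso
    have hqM : algebraMap F M q ≠ 0 := by simpa using hq
    have h1 : e.r = algebraMap F M (-p / q) := by
      rw [map_div₀, map_neg, eq_div_iff hqM]; linear_combination h
    have h2 := e.hr
    rw [h1, ← map_pow] at h2
    exact e.ns _ ((algebraMap F M).injective h2).symm

lemma coord_eq {p q p' q' : F} (h : algebraMap F M p + algebraMap F M q * e.r =
    algebraMap F M p' + algebraMap F M q' * e.r) : p = p' ∧ q = q' := by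
  have := e.coord_zero (p := p - p') (q := q - q') (by rw [map_sub, map_sub]; linear_combination h)
  exact ⟨sub_eq_zero.mp this.1, sub_eq_zero.mp this.2⟩

lemma σ_coord (p q : F) : e.σ (algebraMap F M p + algebraMap F M q * e.r) =
    algebraMap F M p - algebraMap F M q * e.r := by
  rw [map_add, map_mul, e.hσ, AlgHom.commutes, AlgHom.commutes]; ring

lemma σσ (z : M) : e.σ (e.σ z) = z := by
  obtain ⟨p, q, rfl⟩ := e.span z
  rw [σ_coord, map_sub, map_mul, e.hσ, AlgHom.commutes, AlgHom.commutes]; ring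

lemma exists_norm (z : M) : ∃ n : F, algebraMap F M n = z * e.σ z ∧ ∃ p q : F, n = p ^ 2 - x * q ^ 2 := by
  obtain ⟨p, q, rfl⟩ := e.span z
  refine ⟨p ^ 2 - x * q ^ 2, ?_, p, q, rfl⟩
  rw [σ_coord, map_sub, map_mul, map_pow, map_pow, ← e.hr]; ring

noncomputable def N0 (z : M) : F := (e.exists_norm z).choose
lemma N0_spec (z : M) : algebraMap F M (e.N0 z) = z * e.σ z := (e.exists_norm z).choose_spec.1
lemma N0_form (z : M) : ∃ p q : F, e.N0 z = p ^ 2 - x * q ^ 2 := (e.exists_norm z).choose_spec.2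

noncomputable def N : Mˣ →* Fˣ := Units.map
  { toFun := e.N0
    map_one' := by
      apply (algebraMap F M).injective; rw [e.N0_spec]; simp
    map_mul' := by
      intro a b
      apply (algebraMap F M).injective; rw [e.N0_spec, map_mul, map_mul, e.N0_spec, e.N0_spec]; ring }

lemma N_spec (z : Mˣ) : algebraMap F M (e.N z) = z * e.σ z := e.N0_spec z

lemma N_mem_Nx (z : Mˣ) : e.N z ∈ Nx x := by
  rw [mem_Nx]; exact e.N0_form z

lemma square_of_square {F : Type*} [Field F] [NumberField F] {M : Type*} [Field M] [NumberField M] [Algebra F M] {x : F} (e : QE F M x) {a : F} {z : M} (h : algebraMap F M a = z ^ 2) :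
    ∃ y : F, a = y ^ 2 ∨ a = x * y ^ 2 := by
  obtain ⟨p, q, rfl⟩ := e.span z
  have h1 := e.coord_eq (p := a) (q := 0) (p' := p ^ 2 + x * q ^ 2) (q' := 2 * p * q) (by
    rw [h]
    simp only [map_add, map_mul, map_pow, map_zero, map_ofNat, ← e.hr]; ring)
  obtain ⟨h1, h2⟩ := h1
  by_cases hq : q = 0
  · exact ⟨p, Or.inl (by rw [h1, hq]; ring)⟩
  · by_cases hp : p = 0
    · exact ⟨q, Or.inr (by rw [h1, hp]; ring)⟩
    · exfalso
      rcases mul_eq_zero.mp h2.symm with h | h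
      · exact hp ((mul_eq_zero.mp h).resolve_left two_ne_zero)
      · exact hq h

lemma vl_ext {v w : HeightOneSpectrum (𝓞 F)} (h : ∀ a : F, vl v a < 1 ↔ vl w a < 1) : v = w := by
  apply HeightOneSpectrum.ext
  ext a
  rw [← vl_lt_one_iff, ← vl_lt_one_iff, h]

lemma hom_prime {F : Type*} [Field F] [NumberField F] {M : Type*} [Field M] [NumberField M] (f : F →+* M) (P : HeightOneSpectrum (𝓞 M)) :
    ∃ P' : HeightOneSpectrum (𝓞 F), ∃ k : ℕ, k ≠ 0 ∧ ∀ z : F, vl P (f z) = vl P' z ^ k := by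
  letI := f.toAlgebra
  obtain ⟨k, hk, h⟩ := exists_e (F := F) P
  exact ⟨_, k, hk, h⟩

lemma conj_prime (P : HeightOneSpectrum (𝓞 M)) : ∃ P' : HeightOneSpectrum (𝓞 M),
    dn F P' = dn F P ∧ ∃ k : ℕ, k ≠ 0 ∧ ∀ z : M, vl P (e.σ z) = vl P' z ^ k := by
  obtain ⟨P', k, hk, h⟩ := hom_prime (e.σ : M →+* M) P
  refine ⟨P', ?_, k, hk, h⟩
  apply vl_ext
  intro a
  rw [← vl_up_lt_one, ← vl_up_lt_one]
  have h2 := h (algebraMap F M a)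
  have h3 : e.σ (algebraMap F M a) = algebraMap F M a := e.σ.commutes a
  change vl P (e.σ (algebraMap F M a)) = _ at h2
  rw [h3] at h2
  rw [h2, pow_lt_one_iff_of_nonneg zero_le hk]

/-- the number of primes over split ones -/
lemma two_primes {F : Type*} [Field F] [NumberField F] {M : Type*} [Field M] [NumberField M] [Algebra F M]
    {x : F} (e : QE F M x) {v : HeightOneSpectrum (𝓞 F)} {X : Fˣ} (hX : (X : F) = x) (hv : X ∈ Sq v) :
    ∃ P P' : HeightOneSpectrum (𝓞 M), dn F P = v ∧ dn F P' = v ∧ P ≠ P' := by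
  obtain ⟨P, hP⟩ := exists_up M v
  obtain ⟨P', hP', k, hk, hc⟩ := e.conj_prime P
  refine ⟨P, P', hP, by rw [hP', hP], ?_⟩
  obtain ⟨y, hy0, hy⟩ := mem_Sq.mp hv
  rw [hX] at hy
  have hyM : algebraMap F M y ≠ 0 := by simpa using hy0
  set θ : M := (1 + e.r / algebraMap F M y) / 2 with hθ
  have hσθ : e.σ θ = (1 - e.r / algebraMap F M y) / 2 := by
    rw [hθ, map_div₀, map_add, map_div₀, e.hσ, AlgHom.commutes, map_one, map_ofNat]; ring
  have h1 : e.σ θ = 1 - θ := by rw [hσθ, hθ]; ring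
  have h2 : θ * e.σ θ = algebraMap F M ((y ^ 2 - x) / (4 * y ^ 2)) := by
    rw [hσθ, hθ, map_div₀, map_mul, map_sub, map_pow, map_ofNat, ← e.hr]
    field_simp; ring
  have h3 : vl P (θ * e.σ θ) < 1 := by
    rw [h2, vl_up_lt_one, hP, map_div₀]
    have hxy : vl v x = vl v (y ^ 2) := by
      have h5 : vl v (x - y ^ 2) < vl v x := by
        refine hy.trans_le ?_
        rw [map_mul]; exact mul_le_of_le_one_left' (vl_four_le v)
      have := Valuation.map_sub_eq_of_lt_left (vl v) h5
      rw [← this]; congr 1; ring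
    rw [map_mul, ← hxy, ← map_mul, Valuation.map_sub_swap, div_lt_one₀]
    · exact hy
    · have := e.x_ne
      simp [zero_lt_iff, this]
  intro hPP
  rw [← hPP] at hc
  have h4 := hc θ
  rw [map_mul] at h3
  rcases lt_or_ge (vl P θ) 1 with h | h
  · have : vl P (e.σ θ) = 1 := by
      rw [h1]
      have := Valuation.map_sub_eq_of_lt_left (vl P) (x := (1 : M)) (y := θ) (by simpa using h)
      simpa using this
    rw [this] at h4
    exact absurd ((pow_lt_one_iff_of_nonneg zero_le hk).mpr h) (by rw [← h4]; simp)
  · have h5 : 1 ≤ vl P (e.σ θ) := by rw [h4]; exact one_le_pow₀ h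
    exact absurd h3 (not_lt.mpr (one_le_mul h h5))

noncomputable def re (z : M) : F := (e.span z).choose
noncomputable def im (z : M) : F := (e.span z).choose_spec.choose
lemma re_im (z : M) : z = algebraMap F M (e.re z) + algebraMap F M (e.im z) * e.r :=
  (e.span z).choose_spec.choose_spec
lemma re_im_eq (p q : F) {z : M} (h : z = algebraMap F M p + algebraMap F M q * e.r) :
    e.re z = p ∧ e.im z = q := e.coord_eq (by rw [← e.re_im, h])

noncomputable def ext (τ : F →+* ℝ) (s : ℝ) (hs : s ^ 2 = τ x) : M →+* ℝ where
  toFun z := τ (e.re z) + τ (e.im z) * s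
  map_one' := by
    have := e.re_im_eq 1 0 (z := 1) (by simp)
    rw [this.1, this.2]; simp
  map_zero' := by
    have := e.re_im_eq 0 0 (z := 0) (by simp)
    rw [this.1, this.2]; simp
  map_add' a b := by
    have := e.re_im_eq (e.re a + e.re b) (e.im a + e.im b) (z := a + b) (by
      rw [map_add, map_add]; linear_combination e.re_im a + e.re_im b)
    rw [this.1, this.2, map_add, map_add]; ring
  map_mul' a b := by
    have := e.re_im_eq (e.re a * e.re b + x * (e.im a * e.im b)) (e.re a * e.im b + e.im a * e.re b)
      (z := a * b) (by
      simp only [map_add, map_mul, ← e.hr]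
      nth_rewrite 1 [e.re_im a, e.re_im b]; ring)
    rw [this.1, this.2]; simp only [map_add, map_mul, ← hs]; ring

lemma ext_alg (τ : F →+* ℝ) (s : ℝ) (hs : s ^ 2 = τ x) (a : F) : e.ext τ s hs (algebraMap F M a) = τ a := by
  have := e.re_im_eq a 0 (z := algebraMap F M a) (by simp)
  change τ _ + τ _ * s = _
  rw [this.1, this.2]; simp

lemma ext_r (τ : F →+* ℝ) (s : ℝ) (hs : s ^ 2 = τ x) : e.ext τ s hs e.r = s := by
  have := e.re_im_eq 0 1 (z := e.r) (by simp)
  change τ _ + τ _ * s = _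
  rw [this.1, this.2]; simp

lemma card_inf_M (e : QE F M x) (hpos : ∀ σ : F →+* ℝ, 0 < σ x) :
    2 * Fintype.card (InfinitePlace F) ≤ Fintype.card (InfinitePlace M) := by
  have h1 := card_inf F
  have h2 := card_inf M
  have h3 : Module.finrank ℚ M = 2 * Module.finrank ℚ F := by
    rw [← Module.finrank_mul_finrank ℚ F M, e.fr, mul_comm]
  obtain ⟨f1, c1⟩ := card_realEmb F
  obtain ⟨f2, c2⟩ := card_realEmb M
  let g : (F →+* ℝ) × Bool → (M →+* ℝ) := fun a =>
    e.ext a.1 (bif a.2 then Real.sqrt (a.1 x) else - Real.sqrt (a.1 x)) (by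
      cases a.2 <;> simp [Real.sq_sqrt (hpos a.1).le])
  have hg : Function.Injective g := by
    rintro ⟨τ, a⟩ ⟨τ', a'⟩ h
    have hτ : τ = τ' := by
      ext z
      have := congrArg (fun t : M →+* ℝ => t (algebraMap F M z)) h
      simpa [g, ext_alg] using this
    subst hτ
    have h5 := congrArg (fun t : M →+* ℝ => t e.r) h
    simp only [g, ext_r] at h5
    have h6 := Real.sqrt_pos.mpr (hpos τ)
    cases a <;> cases a' <;> simp at h5 ⊢ <;> linarith
  have h4 := Nat.card_le_card_of_injective g hg
  rw [Nat.card_prod, c1, c2] at h4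
  simp at h4
  omega

end QE
end HM

open NumberField IsDedekindDomain
open scoped WithZero
namespace HM
namespace QE
variable {F : Type*} [Field F] [NumberField F] {M : Type*} [Field M] [NumberField M] [Algebra F M] {x : F} (e : QE F M x)

lemma ClS_pair {F : Type*} [Field F] [NumberField F] {S : Finset (HeightOneSpectrum (𝓞 F))} (hcl : ClS S)
    {p q : F} (h : p ≠ 0 ∨ q ≠ 0) : ∃ f : Fˣ, ∀ v ∉ S, max (vl v p) (vl v q) = vl v (f : F) := by
  obtain ⟨a1, d1, hd1, rfl⟩ := IsFractionRing.div_surjective (A := 𝓞 F) p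
  obtain ⟨b1, d2, hd2, rfl⟩ := IsFractionRing.div_surjective (A := 𝓞 F) q
  have e1 : d1 ≠ 0 := nonZeroDivisors.ne_zero hd1
  have e2 : d2 ≠ 0 := nonZeroDivisors.ne_zero hd2
  have e1' : algebraMap (𝓞 F) F d1 ≠ 0 := by simpa using e1
  have e2' : algebraMap (𝓞 F) F d2 ≠ 0 := by simpa using e2
  have hI : Ideal.span {a1 * d2, b1 * d1} ≠ ⊥ := by
    intro hI
    rw [Ideal.span_eq_bot] at hI
    have h1 := hI (a1 * d2) (by simp)
    have h2 := hI (b1 * d1) (by simp)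
    rcases h with h | h
    · apply h; rw [(mul_eq_zero.mp h1).resolve_right e2]; simp
    · apply h; rw [(mul_eq_zero.mp h2).resolve_right e1]; simp
  obtain ⟨f, hf⟩ := hcl _ hI
  refine ⟨f / (Units.mk0 _ e1' * Units.mk0 _ e2'), fun v hv => ?_⟩
  obtain ⟨h1, i, hi, h2⟩ := hf v hv
  have key : max (vl v (algebraMap (𝓞 F) F (a1 * d2))) (vl v (algebraMap (𝓞 F) F (b1 * d1))) = vl v (f : F) := by
    apply le_antisymm
    · exact max_le (h1 _ (Ideal.subset_span (by simp))) (h1 _ (Ideal.subset_span (by simp)))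
    · obtain ⟨m, n, rfl⟩ := Ideal.mem_span_pair.mp hi
      rw [← h2, map_add]
      refine (Valuation.map_add _ _ _).trans ?_
      rw [map_mul (algebraMap (𝓞 F) F) m, map_mul (algebraMap (𝓞 F) F) n, map_mul (vl v), map_mul (vl v)]
      exact max_le_max (mul_le_of_le_one_left' (vl_int_le v m)) (mul_le_of_le_one_left' (vl_int_le v n))
  have hd : 0 < vl v (algebraMap (𝓞 F) F d1 * algebraMap (𝓞 F) F d2) := by
    rw [zero_lt_iff]; simp [e1', e2', e1, e2]
  have q1 : algebraMap (𝓞 F) F a1 / algebraMap (𝓞 F) F d1 = algebraMap (𝓞 F) F (a1 * d2) / (algebraMap (𝓞 F) F d1 * algebraMap (𝓞 F) F d2) := by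
    rw [map_mul]; field_simp
  have q2 : algebraMap (𝓞 F) F b1 / algebraMap (𝓞 F) F d2 = algebraMap (𝓞 F) F (b1 * d1) / (algebraMap (𝓞 F) F d1 * algebraMap (𝓞 F) F d2) := by
    rw [map_mul]; field_simp
  rw [q1, q2, map_div₀, map_div₀]
  simp only [Units.val_div_eq_div_val, Units.val_mul, Units.val_mk0]
  rw [map_div₀, ← key]
  exact (Monotone.map_max (f := fun t => t / vl v (algebraMap (𝓞 F) F d1 * algebraMap (𝓞 F) F d2)) 
    (fun a b hab => div_le_div_of_nonneg_right hab hd.le)).symm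

lemma ker_le {S : Finset (HeightOneSpectrum (𝓞 F))} {SM : Finset (HeightOneSpectrum (𝓞 M))}
    (hSM : ∀ P, P ∈ SM ↔ dn F P ∈ S) (hdy : ∀ v : HeightOneSpectrum (𝓞 F), vl v 2 < 1 → v ∈ S)
    (hcl : ClS S) {X : Fˣ} (hX : (X : F) = x) (hXU : X ∈ U S) {u : Mˣ} (hu : u ∈ U SM)
    (hN : e.N u = 1) : u ∈ (U S).map (up F M) ⊔ Q M := by

  by_cases hz : (1 : M) + u = 0
  · apply Subgroup.mem_sup_left
    refine ⟨-1, ?_, ?_⟩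
    · change (-1 : Fˣ) ∈ U S
      rw [mem_U]; intro v _; simp
    · ext; rw [up_val]; simp; linear_combination -hz
  set z : M := 1 + u with hzdef
  have hNu : (u : M) * e.σ u = 1 := by
    rw [← e.N_spec, hN]; simp
  have hσz : (u : M) * e.σ z = z := by
    rw [hzdef, map_add, map_one, mul_add, hNu]; ring
  obtain ⟨p, q, hpq⟩ := e.span z
  have hσpq : e.σ z = algebraMap F M p - algebraMap F M q * e.r := by rw [hpq, e.σ_coord]
  have hne : p ≠ 0 ∨ q ≠ 0 := by
    by_contra! h
    apply hz; rw [hpq, h.1, h.2]; simp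
  obtain ⟨f, hf⟩ := ClS_pair hcl hne
  have hfM : algebraMap F M f ≠ 0 := by simp
  have hσz0 : e.σ z ≠ 0 := by
    intro h; rw [h, mul_zero] at hσz; exact hz hσz.symm
  have hPσ : ∀ P ∉ SM, vl P (e.σ z) = vl P z := by
    intro P hP
    conv_rhs => rw [← hσz, map_mul, mem_U.mp hu P hP, one_mul]
  have hP : ∀ P ∉ SM, vl P z = vl P (algebraMap F M f) := by
    intro P hP
    have hv : dn F P ∉ S := fun h => hP ((hSM P).mpr h)
    have h2 : vl P 2 = 1 := by
      rw [vl_up_two (F := F)]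
      exact le_antisymm (vl_two_le _) (not_lt.mp fun h => hv (hdy _ h))
    have hr : vl P e.r = 1 := by
      have : vl P (e.r ^ 2) = 1 := by
        rw [e.hr, vl_up_one, ← hX]; exact mem_U.mp hXU _ hv
      rw [map_pow] at this
      exact (pow_eq_one_iff_of_nonneg zero_le two_ne_zero).mp this
    have hp : vl P (algebraMap F M p) ≤ vl P z := by
      have : vl P (2 * algebraMap F M p) ≤ vl P z := by
        rw [show 2 * algebraMap F M p = z + e.σ z by rw [hσpq, hpq]; ring]
        exact Valuation.map_add_le _ le_rfl (hPσ P hP).le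
      rwa [map_mul, h2, one_mul] at this
    have hq : vl P (algebraMap F M q) ≤ vl P z := by
      have : vl P (2 * algebraMap F M q * e.r) ≤ vl P z := by
        rw [show 2 * algebraMap F M q * e.r = z - e.σ z by rw [hσpq, hpq]; ring]
        exact Valuation.map_sub_le _ le_rfl (hPσ P hP).le
      rwa [map_mul, map_mul, h2, one_mul, hr, mul_one] at this
    have hf' := hf _ hv
    apply le_antisymm
    · rw [hpq]
      refine Valuation.map_add_le _ ?_ ?_
      · rw [vl_up_le, ← hf']; exact le_max_left _ _
      · rw [map_mul, hr, mul_one, vl_up_le, ← hf']; exact le_max_right _ _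
    · rcases max_choice (vl (dn F P) p) (vl (dn F P) q) with h | h
      · rw [h] at hf'
        rw [← (vl_up_eq P).mpr hf']; exact hp
      · rw [h] at hf'
        rw [← (vl_up_eq P).mpr hf']; exact hq
  set u' : Mˣ := Units.mk0 z hz / up F M f with hu'
  have hu'v : (u' : M) = z / algebraMap F M f := by
    rw [hu', Units.val_div_eq_div_val, up_val, Units.val_mk0]
  have hσu' : e.σ u' = e.σ z / algebraMap F M f := by
    rw [hu'v, map_div₀, AlgHom.commutes]
  have hNU : e.N u' ∈ U S := by
    rw [mem_U]
    intro v hv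
    obtain ⟨P, rfl⟩ := exists_up M v
    have hPS : P ∉ SM := fun h => hv ((hSM P).mp h)
    rw [← vl_up_one, e.N_spec, hσu', hu'v, map_mul, map_div₀, map_div₀, hPσ P hPS, hP P hPS, div_self, one_mul]
    simp
  have : u = up F M (e.N u')⁻¹ * u' ^ 2 := by
    rw [map_inv, eq_inv_mul_iff_mul_eq]
    ext
    rw [Units.val_mul, up_val, e.N_spec, hσu', hu'v, Units.val_pow_eq_pow_val, hu'v]
    field_simp
    linear_combination hσz
  rw [this]
  exact Subgroup.mul_mem_sup ⟨_, inv_mem hNU, rfl⟩ (sq_mem_Q _)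

lemma N_up {F : Type*} [Field F] [NumberField F] {M : Type*} [Field M] [NumberField M] [Algebra F M]
    {x : F} (e : QE F M x) (u : Fˣ) : e.N (up F M u) = u ^ 2 := by
  ext
  apply (algebraMap F M).injective
  rw [e.N_spec, up_val, AlgHom.commutes, Units.val_pow_eq_pow_val, map_pow]; ring

lemma exists_SM {F : Type*} [Field F] [NumberField F] (M : Type*) [Field M] [NumberField M] [Algebra F M]
    (S : Finset (HeightOneSpectrum (𝓞 F))) :
    ∃ SM : Finset (HeightOneSpectrum (𝓞 M)), ∀ P, P ∈ SM ↔ dn F P ∈ S := by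
  have : {P : HeightOneSpectrum (𝓞 M) | dn F P ∈ S}.Finite := by
    refine (Set.Finite.biUnion S.finite_toSet (fun v _ => finite_up M v)).subset ?_
    intro P hP
    simp only [Set.mem_iUnion]
    exact ⟨dn F P, hP, rfl⟩
  exact ⟨this.toFinset, fun P => by rw [Set.Finite.mem_toFinset]; rfl⟩

lemma card_SM {F : Type*} [Field F] [NumberField F] {M : Type*} [Field M] [NumberField M] [Algebra F M]
    {x : F} (e : QE F M x) {S : Finset (HeightOneSpectrum (𝓞 F))} {SM : Finset (HeightOneSpectrum (𝓞 M))}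
    (hSM : ∀ P, P ∈ SM ↔ dn F P ∈ S) {X : Fˣ} (hX : (X : F) = x) [DecidablePred (fun v => X ∉ Sq v)] :
    2 * S.card ≤ SM.card + (S.filter (fun v => X ∉ Sq v)).card := by
  classical
  rw [Finset.card_eq_sum_card_fiberwise (f := fun P => dn F P) (t := S) (fun P hP => (hSM P).mp hP),
    Finset.card_filter, ← Finset.sum_add_distrib, mul_comm, ← smul_eq_mul, ← Finset.sum_const]
  refine Finset.sum_le_sum fun v hv => ?_
  by_cases h : X ∈ Sq v
  · obtain ⟨P, P', h1, h2, h3⟩ := e.two_primes hX h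
    have : 1 < (SM.filter (fun P => dn F P = v)).card := by
      rw [Finset.one_lt_card]
      exact ⟨P, by simp [hSM, h1, hv], P', by simp [hSM, h2, hv], h3⟩
    omega
  · obtain ⟨P, h1⟩ := exists_up M v
    have : 0 < (SM.filter (fun P => dn F P = v)).card := by
      rw [Finset.card_pos]
      exact ⟨P, by simp [hSM, h1, hv]⟩
    simp only [h, not_false_eq_true, if_true]
    omega

theorem lemmaH {F : Type*} [Field F] [NumberField F] {M : Type*} [Field M] [NumberField M] [Algebra F M]
    {x : F} (e : QE F M x) {S : Finset (HeightOneSpectrum (𝓞 F))} 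
    (hdy : ∀ v : HeightOneSpectrum (𝓞 F), vl v 2 < 1 → v ∈ S)
    (hcl : ClS S) {X : Fˣ} (hX : (X : F) = x) (hXU : X ∈ U S) (hpos : X ∈ Pos F) [DecidablePred (fun v => X ∉ Sq v)] :
    2 * (Nx x).relIndex (U S) ≤ 2 ^ (S.filter (fun v => X ∉ Sq v)).card := by
  obtain ⟨SM, hSM⟩ := exists_SM M S
  have hcard := card_SM e hSM hX
  have hinf := e.card_inf_M (fun σ => by rw [← hX]; exact mem_Pos.mp hpos σ)
  set t := (S.filter (fun v => X ∉ Sq v)).card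
  set s := S.card + Fintype.card (InfinitePlace F) with hs
  set sM := SM.card + Fintype.card (InfinitePlace M) with hsM
  have hst : 2 * s ≤ sM + t := by omega
  set A := U SM with hA
  set B := (U S).map (up F M) with hB
  have hBA : B ≤ A := by
    rintro _ ⟨u, hu, rfl⟩
    rw [hA, mem_U]
    intro P hP
    rw [up_val, vl_up_one]
    exact mem_U.mp hu _ (fun h => hP ((hSM P).mpr h))
  have h1 := relIndex_chain (Q M) hBA
  rw [relIndex_U SM] at h1
  have hX1 : (Q F).relIndex (Subgroup.zpowers X) ≠ 1 := by
    intro h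
    rw [Subgroup.relIndex_eq_one, Subgroup.zpowers_le, mem_Q] at h
    obtain ⟨y, hy⟩ := h
    exact e.ns y (by rw [← hX, hy])
  have h2 : 2 * (Q M).relIndex B ≤ 2 ^ s := by
    have hz : Subgroup.zpowers X ≤ U S := by rwa [Subgroup.zpowers_le]
    have h3 := relIndex_chain (Q F) hz
    rw [relIndex_U S, ← hs] at h3
    have hne : (Q F).relIndex (Subgroup.zpowers X) * (Q F ⊔ Subgroup.zpowers X).relIndex (U S) ≠ 0 := by
      rw [← h3]; positivity
    have h4 : (Q M).relIndex B ≤ (Q F ⊔ Subgroup.zpowers X).relIndex (U S) := by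
      rw [hB, ← Subgroup.relIndex_comap]
      refine Subgroup.relIndex_le_of_le_left (sup_le ?_ ?_) (right_ne_zero_of_mul hne)
      · intro u hu
        obtain ⟨y, hy⟩ := mem_Q.mp hu
        rw [Subgroup.mem_comap, mem_Q]
        exact ⟨algebraMap F M y, by rw [up_val, hy, map_pow]⟩
      · rw [Subgroup.zpowers_le, Subgroup.mem_comap, mem_Q]
        exact ⟨e.r, by rw [up_val, hX, e.hr]⟩
    rw [h3]
    refine Nat.mul_le_mul ?_ h4
    have := left_ne_zero_of_mul hne
    omega
  have hNA : A.map e.N ≤ U S := by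
    rintro _ ⟨u, hu, rfl⟩
    rw [mem_U]
    intro v hv
    obtain ⟨P, rfl⟩ := exists_up M v
    have hPS : P ∉ SM := fun h => hv ((hSM P).mp h)
    obtain ⟨P', hP', k, hk, hc⟩ := e.conj_prime P
    have hPS' : P' ∉ SM := fun h => hv (hP' ▸ (hSM P').mp h)
    rw [← vl_up_one, e.N_spec, map_mul, hc, mem_U.mp hu P hPS, mem_U.mp hu P' hPS']
    simp
  have hNB : B.map e.N ⊓ U S = Q F ⊓ U S := by
    ext u
    simp only [Subgroup.mem_inf]
    constructor
    · rintro ⟨⟨_, ⟨w, hw, rfl⟩, rfl⟩, h⟩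
      rw [N_up] at h ⊢
      exact ⟨sq_mem_Q _, h⟩
    · rintro ⟨hx, h⟩
      obtain ⟨y, hy⟩ := hx
      refine ⟨⟨up F M y, ⟨y, ?_, rfl⟩, ?_⟩, h⟩
      · have hy' : y ^ 2 = u := hy
        rw [← hy'] at h
        exact sq_mem_U h
      · rw [N_up]; exact hy
  have h5 : 2 ^ s = (B.map e.N).relIndex (A.map e.N) * (A.map e.N).relIndex (U S) := by
    rw [Subgroup.relIndex_mul_relIndex _ _ _ (Subgroup.map_mono hBA) hNA, ← Subgroup.inf_relIndex_right, hNB,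
      Subgroup.inf_relIndex_right, relIndex_U S]
  have hne5 : (B.map e.N).relIndex (A.map e.N) * (A.map e.N).relIndex (U S) ≠ 0 := by
    rw [← h5]; positivity
  have h6 : (Q M ⊔ B).relIndex A ≤ (B.map e.N).relIndex (A.map e.N) := by
    have h7 : (B.map e.N).relIndex (A.map e.N) = (((B.map e.N).comap e.N) ⊓ A).relIndex A := by
      rw [Subgroup.inf_relIndex_right, Subgroup.relIndex_comap]
    rw [h7]
    refine Subgroup.relIndex_le_of_le_left ?_ (by rw [← h7]; exact left_ne_zero_of_mul hne5)
    rintro u ⟨⟨b, hb, hbu⟩, huA⟩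
    have hk : e.N (u / b) = 1 := by rw [map_div, hbu, div_self']
    have := e.ker_le hSM hdy hcl hX hXU (u := u / b) (div_mem huA (hBA hb)) hk
    rw [← div_mul_cancel u b, sup_comm]
    exact mul_mem this (Subgroup.mem_sup_left hb)
  have h8 : (Nx x).relIndex (U S) ≤ (A.map e.N).relIndex (U S) := by
    refine Subgroup.relIndex_le_of_le_left ?_ (right_ne_zero_of_mul hne5)
    rintro _ ⟨u, hu, rfl⟩
    exact e.N_mem_Nx u
  set n' := (B.map e.N).relIndex (A.map e.N)
  set j := (A.map e.N).relIndex (U S)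
  set m := (Q M ⊔ B).relIndex A
  set a := (Q M).relIndex B
  have h9 : 2 * j * 2 ^ sM ≤ 2 ^ t * 2 ^ sM := by
    calc 2 * j * 2 ^ sM = (2 * a) * (m * j) := by rw [hsM, h1]; ring
      _ ≤ 2 ^ s * (n' * j) := Nat.mul_le_mul h2 (Nat.mul_le_mul h6 le_rfl)
      _ = 2 ^ (2 * s) := by rw [← h5]; ring
      _ ≤ 2 ^ (sM + t) := Nat.pow_le_pow_right (by norm_num) hst
      _ = _ := by ring
  have := Nat.le_of_mul_le_mul_right h9 (by positivity)
  omega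

end QE
end HM

open NumberField IsDedekindDomain
open scoped WithZero
namespace HM

section mz
open scoped ENNReal
noncomputable def MZ {ι : Type*} (w : ι → ℝ≥0∞) : ℝ≥0∞ := ∑' m : Multiset ι, (m.map w).prod

lemma MZ_le {ι κ : Type*} {w : ι → ℝ≥0∞} {w' : κ → ℝ≥0∞} (f : ι → κ) (hf : Function.Injective f)
    (h : ∀ i, w i ≤ w' (f i)) : MZ w ≤ MZ w' := by
  calc MZ w ≤ ∑' m : Multiset ι, ((m.map f).map w').prod := by
        refine ENNReal.tsum_le_tsum fun m => ?_
        rw [Multiset.map_map]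
        exact Multiset.prod_map_le_prod_map _ _ (fun i _ => h i)
    _ ≤ MZ w' := ENNReal.tsum_comp_le_tsum_of_injective (Multiset.map_injective hf) _

lemma MZ_sum {ι : Type*} (w : ι → ℝ≥0∞) : MZ w * MZ w ≤ MZ (Sum.elim w w) := by
  have hinj : Function.Injective (fun p : Multiset ι × Multiset ι =>
      p.1.map (Sum.inl : ι → ι ⊕ ι) + p.2.map (Sum.inr : ι → ι ⊕ ι)) := by
    rintro ⟨a, b⟩ ⟨a', b'⟩ h
    classical
    simp only at h
    have h1 := congrArg (Multiset.filterMap Sum.getLeft?) h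
    have h2 := congrArg (Multiset.filterMap Sum.getRight?) h
    simp only [Multiset.filterMap_add, Multiset.filterMap_map] at h1 h2
    have e1 : (Sum.getLeft? ∘ (Sum.inl : ι → ι ⊕ ι)) = some := rfl
    have e2 : (Sum.getLeft? ∘ (Sum.inr : ι → ι ⊕ ι)) = fun _ => none := rfl
    have e3 : (Sum.getRight? ∘ (Sum.inl : ι → ι ⊕ ι)) = fun _ => none := rfl
    have e4 : (Sum.getRight? ∘ (Sum.inr : ι → ι ⊕ ι)) = some := rfl
    have e5 : ∀ s : Multiset ι, Multiset.filterMap (fun _ => (none : Option ι)) s = 0 := by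
      intro s; induction s using Multiset.induction_on <;> simp_all
    rw [e1, e2] at h1
    rw [e3, e4] at h2
    simp only [Multiset.filterMap_some, e5, add_zero, zero_add] at h1 h2
    rw [h1, h2]
  unfold MZ
  rw [← ENNReal.tsum_mul_right]
  simp_rw [← ENNReal.tsum_mul_left]
  rw [← ENNReal.tsum_prod]
  refine le_trans (le_of_eq ?_) (ENNReal.tsum_comp_le_tsum_of_injective hinj _)
  refine tsum_congr fun p => ?_
  simp

lemma MZ_remove {ι : Type*} (w : ι → ℝ≥0∞) (A : Set ι) (i : ι) (hw : w i ≤ 2⁻¹) :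
    MZ (fun j : A => w j) ≤ 2 * MZ (fun j : (A \ {i} : Set ι) => w j) := by
  by_cases hi : i ∈ A
  · let g : ℕ × Multiset (A \ {i} : Set ι) → Multiset A := fun p =>
      Multiset.replicate p.1 ⟨i, hi⟩ + p.2.map (fun j => ⟨j.1, j.2.1⟩)
    have hg : Function.Surjective g := by
      intro m
      induction m using Multiset.induction_on with
      | empty => exact ⟨(0, 0), by simp [g]⟩
      | cons j m ih =>
        obtain ⟨⟨k, m'⟩, rfl⟩ := ih
        by_cases hj : (j : ι) = i
        · refine ⟨(k + 1, m'), ?_⟩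
          have : j = ⟨i, hi⟩ := Subtype.ext hj
          simp [g, this, Multiset.replicate_succ]
        · refine ⟨(k, ⟨j.1, j.2, hj⟩ ::ₘ m'), ?_⟩
          simp [g]
    refine (ENNReal.tsum_le_tsum_comp_of_surjective hg _).trans ?_
    have hgeo : ∑' k : ℕ, w i ^ k ≤ 2 := by
      rw [ENNReal.tsum_geometric]
      rw [ENNReal.inv_le_iff_inv_le]
      refine ENNReal.le_sub_of_add_le_left (ne_top_of_le_ne_top (by simp) hw) ?_
      refine (add_le_add_left hw _).trans ?_
      rw [ENNReal.inv_two_add_inv_two]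
    calc _ = ∑' p : ℕ × Multiset (A \ {i} : Set ι), w i ^ p.1 * (p.2.map (fun j : (A \ {i} : Set ι) => w (j : ι))).prod := by
          refine tsum_congr fun p => ?_
          simp [g, Multiset.map_replicate, Function.comp_def]
      _ = (∑' k : ℕ, w i ^ k) * MZ (fun j : (A \ {i} : Set ι) => w j) := by
          rw [ENNReal.tsum_prod (f := fun k (m : Multiset (A \ {i} : Set ι)) => w i ^ k * (m.map (fun j : (A \ {i} : Set ι) => w (j : ι))).prod), ← ENNReal.tsum_mul_right]
          simp_rw [ENNReal.tsum_mul_left]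
          rfl
      _ ≤ _ := by gcongr
  · refine le_trans (MZ_le (w' := fun j : (A \ {i} : Set ι) => w j) (fun j => ⟨j.1, j.2, fun h => hi (h ▸ j.2)⟩) ?_ (fun j => le_rfl)) ?_
    · intro a b h
      simpa [Subtype.ext_iff] using h
    · rw [two_mul]; exact le_self_add

lemma MZ_removes {ι : Type*} (w : ι → ℝ≥0∞) (S : Finset ι) (hw : ∀ i, w i ≤ 2⁻¹) :
    MZ w ≤ 2 ^ S.card * MZ (fun j : {j // j ∉ S} => w j) := by
  classical
  induction S using Finset.induction_on with
  | empty =>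
    simp only [Finset.card_empty, pow_zero, one_mul]
    exact MZ_le (fun i => ⟨i, by simp⟩) (fun a b h => by simpa using h) (fun i => le_rfl)
  | insert i S hi ih =>
    refine ih.trans ?_
    rw [Finset.card_insert_of_notMem hi, pow_succ, mul_assoc]
    gcongr
    refine (MZ_remove w {j | j ∉ S} i (hw i)).trans ?_
    gcongr
    refine MZ_le (fun j => ⟨j.1, fun h => ?_⟩) (fun a b h => by simpa [Subtype.ext_iff] using h) (fun i => le_rfl)
    rcases Finset.mem_insert.mp h with h | h
    · exact j.2.2 h
    · exact j.2.1 h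
end mz

section zeta
open scoped ENNReal
variable (F : Type*) [Field F] [NumberField F]

noncomputable def wt (s : ℝ) (v : HeightOneSpectrum (𝓞 F)) : ℝ≥0∞ :=
  ENNReal.ofReal ((Ideal.absNorm v.asIdeal : ℝ) ^ (-s))

lemma wt_le {s : ℝ} (hs : 1 < s) (v : HeightOneSpectrum (𝓞 F)) : wt F s v ≤ 2⁻¹ := by
  have h0 : Ideal.absNorm v.asIdeal ≠ 0 := by
    rw [Ne, Ideal.absNorm_eq_zero_iff]; exact v.ne_bot
  have h1 : Ideal.absNorm v.asIdeal ≠ 1 := by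
    rw [Ne, Ideal.absNorm_eq_one_iff]; exact v.isPrime.ne_top
  have h2 : (2 : ℝ) ≤ Ideal.absNorm v.asIdeal := by
    exact_mod_cast (by omega : 2 ≤ Ideal.absNorm v.asIdeal)
  rw [wt, show (2⁻¹ : ℝ≥0∞) = ENNReal.ofReal (2⁻¹) by
    rw [ENNReal.ofReal_inv_of_pos (by norm_num)]; simp]
  apply ENNReal.ofReal_le_ofReal
  rw [Real.rpow_neg (by positivity)]
  apply inv_anti₀ (by norm_num)
  calc (2 : ℝ) ≤ Ideal.absNorm v.asIdeal := h2
    _ = (Ideal.absNorm v.asIdeal : ℝ) ^ (1 : ℝ) := by simp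
    _ ≤ _ := Real.rpow_le_rpow_of_exponent_le (by linarith) hs.le

noncomputable def idw (s : ℝ) : Ideal (𝓞 F) →* ℝ≥0∞ where
  toFun I := ENNReal.ofReal ((Ideal.absNorm I : ℝ) ^ (-s))
  map_one' := by simp
  map_mul' I J := by
    rw [map_mul, Nat.cast_mul, Real.mul_rpow (by positivity) (by positivity), ENNReal.ofReal_mul (by positivity)]

lemma MZ_eq (s : ℝ) : MZ (wt F s) = ∑' I : {I : Ideal (𝓞 F) // I ≠ ⊥}, idw F s I := by
  have hne : ∀ m : Multiset (HeightOneSpectrum (𝓞 F)), (m.map (fun v => v.asIdeal)).prod ≠ ⊥ := by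
    intro m
    rw [← Ideal.zero_eq_bot, Ne, Multiset.prod_eq_zero_iff]
    intro h
    obtain ⟨v, hv, h⟩ := Multiset.mem_map.mp h
    exact v.ne_bot h
  let g : Multiset (HeightOneSpectrum (𝓞 F)) → {I : Ideal (𝓞 F) // I ≠ ⊥} := fun m => ⟨_, hne m⟩
  have hg : Function.Bijective g := by
    classical
    constructor
    · intro m m' h
      have h1 : (m.map (fun v => v.asIdeal)).prod = (m'.map (fun v => v.asIdeal)).prod := congrArg Subtype.val h
      have h2 := congrArg UniqueFactorizationMonoid.normalizedFactors h1
      have hp : ∀ m : Multiset (HeightOneSpectrum (𝓞 F)), ∀ p ∈ m.map (fun v => v.asIdeal), Prime p := by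
        intro m p hp
        obtain ⟨v, hv, rfl⟩ := Multiset.mem_map.mp hp
        exact v.prime
      rw [UniqueFactorizationMonoid.normalizedFactors_prod_of_prime (hp m),
        UniqueFactorizationMonoid.normalizedFactors_prod_of_prime (hp m')] at h2
      exact Multiset.map_injective (fun a b h => HeightOneSpectrum.ext h) h2
    · rintro ⟨I, hI⟩
      have : ∀ s : Multiset (Ideal (𝓞 F)), (∀ p ∈ s, Prime p) → ∃ m : Multiset (HeightOneSpectrum (𝓞 F)),
          m.map (fun v => v.asIdeal) = s := by
        intro s
        induction s using Multiset.induction_on with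
        | empty => intro _; exact ⟨0, rfl⟩
        | cons p s ih =>
          intro h
          obtain ⟨m, rfl⟩ := ih (fun p hp => h p (Multiset.mem_cons_of_mem hp))
          have hp := h p (Multiset.mem_cons_self _ _)
          exact ⟨⟨p, Ideal.isPrime_of_prime hp, hp.ne_zero⟩ ::ₘ m, by simp⟩
      obtain ⟨m, hm⟩ := this (UniqueFactorizationMonoid.normalizedFactors I)
        (fun p hp => UniqueFactorizationMonoid.prime_of_normalized_factor p hp)
      refine ⟨m, Subtype.ext ?_⟩
      change (m.map (fun v => v.asIdeal)).prod = I
      rw [hm, Ideal.prod_normalizedFactors_eq_self hI]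
  rw [← (Equiv.ofBijective g hg).tsum_eq]
  refine tsum_congr fun m => ?_
  change _ = idw F s (m.map (fun v => v.asIdeal)).prod
  rw [map_multiset_prod, Multiset.map_map]
  rfl

noncomputable def cf (n : ℕ) : ℕ := Nat.card {I : Ideal (𝓞 F) // Ideal.absNorm I = n}

lemma MZ_eq_sum (s : ℝ) : MZ (wt F s) = ∑' n : ℕ, (if n = 0 then 0 else ENNReal.ofReal ((cf F n : ℝ) * (n : ℝ) ^ (-s))) := by
  rw [MZ_eq, ← ENNReal.tsum_fiberwise _ (fun I : {I : Ideal (𝓞 F) // I ≠ ⊥} => Ideal.absNorm I.1)]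
  refine tsum_congr fun n => ?_
  split_ifs with hn
  · subst hn
    have : IsEmpty ((fun I : {I : Ideal (𝓞 F) // I ≠ ⊥} => Ideal.absNorm I.1) ⁻¹' {0}) := by
      constructor
      rintro ⟨I, hI⟩
      exact I.2 (Ideal.absNorm_eq_zero_iff.mp hI)
    simp
  · have h1 : ∀ b : ((fun I : {I : Ideal (𝓞 F) // I ≠ ⊥} => Ideal.absNorm I.1) ⁻¹' {n}), idw F s b.1.1 =
        ENNReal.ofReal ((n : ℝ) ^ (-s)) := by
      rintro ⟨I, hI⟩
      have : Ideal.absNorm I.1 = n := hI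
      change ENNReal.ofReal ((Ideal.absNorm I.1 : ℝ) ^ (-s)) = _
      rw [this]
    rw [tsum_congr h1, ENNReal.tsum_const]
    have h2 : ENat.card ((fun I : {I : Ideal (𝓞 F) // I ≠ ⊥} => Ideal.absNorm I.1) ⁻¹' {n}) = (cf F n : ℕ∞) := by
      have e : ((fun I : {I : Ideal (𝓞 F) // I ≠ ⊥} => Ideal.absNorm I.1) ⁻¹' {n}) ≃ {I : Ideal (𝓞 F) // Ideal.absNorm I = n} :=
        { toFun := fun I => ⟨I.1.1, I.2⟩
          invFun := fun I => ⟨⟨I.1, fun h => hn (by rw [← I.2, h]; simp)⟩, I.2⟩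
          left_inv := fun I => rfl
          right_inv := fun I => rfl }
      rw [ENat.card_congr e]
      haveI : Finite {I : Ideal (𝓞 F) // Ideal.absNorm I = n} := Ideal.finite_setOf_absNorm_eq n
      rw [ENat.card_eq_coe_natCard]; rfl
    rw [h2, ENNReal.ofReal_mul (by positivity)]
    simp
end zeta
end HM

open NumberField IsDedekindDomain
open scoped WithZero
namespace HM

section zeta
open scoped ENNReal Topology
open Filter
variable (F : Type*) [Field F] [NumberField F]

lemma MZ_zeta {s : ℝ} (h : dedekindZeta F s ≠ 0) :
    ∃ z : ℝ, 0 ≤ z ∧ MZ (wt F s) = ENNReal.ofReal z ∧ dedekindZeta F s = z := by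
  set a : ℕ → ℝ := fun n => if n = 0 then 0 else (cf F n : ℝ) * (n : ℝ) ^ (-s) with ha
  have ha0 : ∀ n, 0 ≤ a n := by
    intro n; simp only [ha]; split_ifs <;> positivity
  have hterm : ∀ n, LSeries.term (fun n => (Nat.card {I : Ideal (𝓞 F) // Ideal.absNorm I = n} : ℂ)) s n = (a n : ℂ) := by
    intro n
    rw [LSeries.term_def]
    simp only [ha]
    split_ifs with hn
    · simp
    · rw [Complex.ofReal_mul, Complex.ofReal_cpow (by positivity)]
      simp only [Complex.ofReal_natCast, Complex.ofReal_neg, Complex.cpow_neg, div_eq_mul_inv]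
      rfl
  have hd : dedekindZeta F s = ∑' n, (a n : ℂ) := tsum_congr hterm
  have hsum : Summable (fun n => (a n : ℂ)) := by
    by_contra hc
    rw [hd, tsum_eq_zero_of_not_summable hc] at h
    exact h rfl
  have hsum' : Summable a := by simpa using hsum
  refine ⟨∑' n, a n, tsum_nonneg ha0, ?_, ?_⟩
  · rw [ENNReal.ofReal_tsum_of_nonneg ha0 hsum', MZ_eq_sum]
    refine tsum_congr fun n => ?_
    simp only [ha]
    split_ifs <;> simp
  · rw [hd, Complex.ofReal_tsum]

lemma zeta_event : ∀ᶠ s : ℝ in 𝓝[>] 1, ∃ z : ℝ, MZ (wt F s) = ENNReal.ofReal z ∧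
    dedekindZeta_residue F / 2 ≤ (s - 1) * z ∧ (s - 1) * z ≤ dedekindZeta_residue F * 2 := by
  have h := tendsto_sub_one_mul_dedekindZeta_nhdsGT F
  have hp := dedekindZeta_residue_pos F
  have h2 := h.norm
  have e : ‖((dedekindZeta_residue F : ℝ) : ℂ)‖ = dedekindZeta_residue F := by
    rw [Complex.norm_real, Real.norm_of_nonneg hp.le]
  rw [e] at h2
  have h3 := h2.eventually (lt_mem_nhds (by linarith : dedekindZeta_residue F / 2 < dedekindZeta_residue F))
  have h4 := h2.eventually (gt_mem_nhds (by linarith : dedekindZeta_residue F < dedekindZeta_residue F * 2))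
  filter_upwards [h3, h4, self_mem_nhdsWithin] with s h3 h4 h5
  have h5' : (1 : ℝ) < s := h5
  have hz : dedekindZeta F s ≠ 0 := by
    intro h0; rw [h0] at h3; simp at h3; linarith
  obtain ⟨z, z0, hz1, hz2⟩ := MZ_zeta F hz
  have e2 : ‖((s : ℂ) - 1) * dedekindZeta F s‖ = (s - 1) * z := by
    rw [hz2, ← Complex.ofReal_one, ← Complex.ofReal_sub, ← Complex.ofReal_mul, Complex.norm_real, Real.norm_of_nonneg]
    exact mul_nonneg (by linarith) z0
  rw [e2] at h3 h4
  exact ⟨z, hz1, h3.le, h4.le⟩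

lemma norm_le {F : Type*} [Field F] [NumberField F] {M : Type*} [Field M] [NumberField M] [Algebra F M]
    {x : F} (e : QE F M x) (P : HeightOneSpectrum (𝓞 M)) {X : Fˣ} (hX : (X : F) = x) (h2 : vl (dn F P) 2 = 1)
    (hx1 : vl (dn F P) x = 1) (hS : X ∈ Sq (dn F P)) :
    Ideal.absNorm P.asIdeal ≤ Ideal.absNorm (dn F P).asIdeal := by
  have h2' : vl P 2 = 1 := (vl_up_two P).mpr h2
  have hr : vl P e.r = 1 := by
    have : vl P (e.r ^ 2) = 1 := by rw [e.hr, vl_up_one]; exact hx1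
    rw [map_pow] at this
    exact (pow_eq_one_iff_of_nonneg zero_le two_ne_zero).mp this
  obtain ⟨y, hy0, hy⟩ := mem_Sq.mp hS
  rw [hX, map_mul, vl_four_eq, h2, hx1] at hy
  have hy' : vl (dn F P) (x - y ^ 2) < 1 := by simpa using hy
  have hyM : vl P ((e.r - algebraMap F M y) * (e.r + algebraMap F M y)) < 1 := by
    rw [show (e.r - algebraMap F M y) * (e.r + algebraMap F M y) = algebraMap F M (x - y ^ 2) by
      rw [map_sub, map_pow, ← e.hr]; ring, vl_up_lt_one]
    exact hy'
  obtain ⟨y, hy⟩ : ∃ y : F, vl P (e.r - algebraMap F M y) < 1 := by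
    rw [map_mul] at hyM
    by_contra! hc
    have h1 := hc y
    have h3 := hc (-y)
    rw [map_neg, sub_neg_eq_add] at h3
    exact absurd hyM (not_lt.mpr (one_le_mul h1 h3))
  have hy1 : vl (dn F P) y ≤ 1 := by
    have : vl P (algebraMap F M y) ≤ 1 := by
      rw [show algebraMap F M y = e.r - (e.r - algebraMap F M y) by ring]
      exact Valuation.map_sub_le _ hr.le hy.le
    have h := vl_up_le P (a := y) (b := 1)
    rw [map_one, map_one, map_one] at h
    exact h.mp this
  obtain ⟨P', hP', k, hk, hc⟩ := e.conj_prime P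
  have hsurj : Function.Surjective ((Ideal.Quotient.mk P.asIdeal).comp (algebraMap (𝓞 F) (𝓞 M))) := by
    intro z
    obtain ⟨z, rfl⟩ := Ideal.Quotient.mk_surjective z
    set Z : M := algebraMap (𝓞 M) M z with hZ
    obtain ⟨p, q, hpq⟩ := e.span Z
    have hσ : e.σ Z = algebraMap F M p - algebraMap F M q * e.r := by rw [hpq, e.σ_coord]
    have hZ1 : vl P Z ≤ 1 := vl_int_le _ _
    have hσZ1 : vl P (e.σ Z) ≤ 1 := by
      rw [hc]; exact pow_le_one₀ zero_le (vl_int_le _ _)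
    have up1 : ∀ a : F, vl P (algebraMap F M a) ≤ 1 → vl (dn F P) a ≤ 1 := by
      intro a ha
      have h := vl_up_le P (a := a) (b := 1)
      rw [map_one, map_one, map_one] at h
      exact h.mp ha
    have hp : vl (dn F P) p ≤ 1 := by
      apply up1
      have : vl P (2 * algebraMap F M p) ≤ 1 := by
        rw [show 2 * algebraMap F M p = Z + e.σ Z by rw [hσ, hpq]; ring]
        exact Valuation.map_add_le _ hZ1 hσZ1
      rwa [map_mul, h2', one_mul] at this
    have hq : vl (dn F P) q ≤ 1 := by
      apply up1
      have : vl P (2 * algebraMap F M q * e.r) ≤ 1 := by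
        rw [show 2 * algebraMap F M q * e.r = Z - e.σ Z by rw [hσ, hpq]; ring]
        exact Valuation.map_sub_le _ hZ1 hσZ1
      rwa [map_mul, map_mul, h2', one_mul, hr, mul_one] at this
    obtain ⟨c, hc⟩ := exists_res (v := dn F P) (x := p + q * y) (Valuation.map_add_le _ hp (by
      rw [map_mul]; exact mul_le_one₀ hq zero_le hy1))
    refine ⟨c, ?_⟩
    rw [RingHom.comp_apply, Ideal.Quotient.eq, ← vl_lt_one_iff, map_sub, ← hZ]
    have e1 : algebraMap (𝓞 M) M (algebraMap (𝓞 F) (𝓞 M) c) = algebraMap F M (algebraMap (𝓞 F) F c) := by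
      rw [← IsScalarTower.algebraMap_apply, ← IsScalarTower.algebraMap_apply]
    rw [e1, Valuation.map_sub_swap, hpq, show algebraMap F M p + algebraMap F M q * e.r - algebraMap F M (algebraMap (𝓞 F) F c)
      = algebraMap F M (p + q * y - algebraMap (𝓞 F) F c) + algebraMap F M q * (e.r - algebraMap F M y) by
        rw [map_sub, map_add, map_mul]; ring]
    refine Valuation.map_add_lt _ ?_ ?_
    · rw [vl_up_lt_one]; exact hc
    · rw [map_mul]
      rw [mul_comm]
      refine mul_lt_one_of_lt_of_le hy ?_
      have h := vl_up_le P (a := q) (b := 1)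
      rw [map_one, map_one, map_one] at h
      exact h.mpr hq
  have hker : ∀ a ∈ (dn F P).asIdeal, ((Ideal.Quotient.mk P.asIdeal).comp (algebraMap (𝓞 F) (𝓞 M))) a = 0 := by
    intro a ha
    rw [RingHom.comp_apply, Ideal.Quotient.eq_zero_iff_mem]
    exact ha
  rw [Ideal.absNorm_apply, Ideal.absNorm_apply, Submodule.cardQuot_apply, Submodule.cardQuot_apply]
  haveI : Finite (𝓞 F ⧸ (dn F P).asIdeal) := inferInstance
  exact Nat.card_le_card_of_surjective (Ideal.Quotient.lift _ _ hker)
    (Ideal.Quotient.lift_surjective_of_surjective _ hker hsurj)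

theorem lemmaN {F : Type*} [Field F] [NumberField F] (X : Fˣ) (hX : X ∉ Q F) (S₀ : Finset (HeightOneSpectrum (𝓞 F))) :
    ∃ v ∉ S₀, X ∉ Sq v := by
  classical
  by_contra! hcon
  obtain ⟨M, _, _, _, ⟨e⟩⟩ := exists_QE (X : F) (fun y hy => hX (mem_Q.mpr ⟨y, hy⟩))
  set S := S₀ ∪ (finite_bad X.ne_zero).toFinset ∪ (finite_dyadic F).toFinset with hS
  have hsplit : ∀ v : {v // v ∉ S}, ∃ P P' : HeightOneSpectrum (𝓞 M), dn F P = v ∧ dn F P' = v ∧ P ≠ P' := by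
    rintro ⟨v, hv⟩
    refine e.two_primes rfl (hcon v ?_)
    intro h; apply hv; simp [hS, h]
  choose φ φ' h1 h2 h3 using hsplit
  have hN : ∀ v : {v // v ∉ S}, ∀ P : HeightOneSpectrum (𝓞 M), dn F P = v →
      Ideal.absNorm P.asIdeal ≤ Ideal.absNorm v.1.asIdeal := by
    rintro ⟨v, hv⟩ P rfl
    simp only [hS, Finset.mem_union, not_or, Set.Finite.mem_toFinset] at hv
    refine norm_le e P rfl ?_ ?_ (hcon _ hv.1.1)
    · exact le_antisymm (vl_two_le _) (not_lt.mp fun h => hv.2 h)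
    · by_contra h; exact hv.1.2 h
  have key : ∀ s : ℝ, 1 < s → MZ (wt F s) * MZ (wt F s) ≤ (2 ^ S.card * 2 ^ S.card) * MZ (wt M s) := by
    intro s hs
    have a1 := MZ_removes (wt F s) S (wt_le F hs)
    have a2 := MZ_sum (fun j : {j // j ∉ S} => wt F s j)
    have wtle : ∀ v : {v // v ∉ S}, ∀ P : HeightOneSpectrum (𝓞 M), dn F P = v → wt F s v ≤ wt M s P := by
      intro v P hP
      apply ENNReal.ofReal_le_ofReal
      apply Real.rpow_le_rpow_of_nonpos
      · have : Ideal.absNorm P.asIdeal ≠ 0 := by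
          rw [Ne, Ideal.absNorm_eq_zero_iff]; exact P.ne_bot
        positivity
      · exact_mod_cast hN v P hP
      · linarith
    have a3 : MZ (Sum.elim (fun j : {j // j ∉ S} => wt F s j) (fun j : {j // j ∉ S} => wt F s j)) ≤ MZ (wt M s) := by
      refine MZ_le (Sum.elim φ φ') ?_ ?_
      · rintro (a | a) (b | b) h
        · simp only [Sum.elim_inl] at h
          have := congrArg (dn F) h
          rw [h1, h1] at this
          rw [Subtype.ext this]
        · exfalso
          simp only [Sum.elim_inl, Sum.elim_inr] at h
          have := congrArg (dn F) h
          rw [h1, h2] at this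
          rw [Subtype.ext this] at h
          exact h3 b h
        · exfalso
          simp only [Sum.elim_inl, Sum.elim_inr] at h
          have := congrArg (dn F) h
          rw [h1, h2] at this
          rw [Subtype.ext this] at h
          exact h3 b h.symm
        · simp only [Sum.elim_inr] at h
          have := congrArg (dn F) h
          rw [h2, h2] at this
          rw [Subtype.ext this]
      · rintro (a | a)
        · exact wtle a _ (h1 a)
        · exact wtle a _ (h2 a)
    calc _ ≤ (2 ^ S.card * MZ (fun j : {j // j ∉ S} => wt F s j)) * (2 ^ S.card * MZ (fun j : {j // j ∉ S} => wt F s j)) :=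
          mul_le_mul' a1 a1
      _ = (2 ^ S.card * 2 ^ S.card) * (MZ (fun j : {j // j ∉ S} => wt F s j) * MZ (fun j : {j // j ∉ S} => wt F s j)) := by ring
      _ ≤ _ := by gcongr; exact a2.trans a3
  set c : ℝ := 2 ^ S.card * 2 ^ S.card with hc
  have hcp : 0 < c := by positivity
  have hF := dedekindZeta_residue_pos F
  have hM := dedekindZeta_residue_pos M
  set ρ := dedekindZeta_residue F
  set ρ' := dedekindZeta_residue M
  have hsmall : ∀ᶠ s : ℝ in 𝓝[>] 1, s < 1 + ρ ^ 2 / (16 * c * ρ') := by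
    apply mem_nhdsWithin_of_mem_nhds
    apply gt_mem_nhds
    have : 0 < ρ ^ 2 / (16 * c * ρ') := by positivity
    linarith
  obtain ⟨s, ⟨z, hz, hz1, -⟩, ⟨z', hz', hz3, hz2⟩, hs1, hs2⟩ :=
    ((zeta_event F).and ((zeta_event M).and ((eventually_mem_nhdsWithin (s := Set.Ioi (1 : ℝ))).and hsmall))).exists
  have hs : 1 < s := hs1
  have k := key s hs
  have hz0 : 0 ≤ z := by
    by_contra! h
    nlinarith
  have hzp : 0 ≤ z' := by
    by_contra! h
    nlinarith
  have k2 : z * z ≤ c * z' := by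
    rw [hz, hz', ← ENNReal.ofReal_mul hz0] at k
    have e2 : ((2 : ℝ≥0∞) ^ S.card * 2 ^ S.card) = ENNReal.ofReal c := by
      rw [hc, ENNReal.ofReal_mul (by positivity), ENNReal.ofReal_pow (by norm_num)]; simp
    rw [e2, ← ENNReal.ofReal_mul hcp.le, ENNReal.ofReal_le_ofReal_iff (by positivity)] at k
    exact k
  have hs0 : 0 < s - 1 := by linarith
  have k3 : ρ ^ 2 / 4 ≤ (s - 1) * (c * (ρ' * 2)) := by
    calc ρ ^ 2 / 4 = (ρ / 2) * (ρ / 2) := by ring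
      _ ≤ ((s - 1) * z) * ((s - 1) * z) := mul_le_mul hz1 hz1 (by positivity) (by positivity)
      _ = (s - 1) * ((s - 1) * (z * z)) := by ring
      _ ≤ (s - 1) * ((s - 1) * (c * z')) := by gcongr
      _ = (s - 1) * (c * ((s - 1) * z')) := by ring
      _ ≤ _ := by gcongr
  have k4 : s - 1 < ρ ^ 2 / (16 * c * ρ') := by linarith
  rw [lt_div_iff₀ (by positivity)] at k4
  nlinarith
end zeta
end HM

open NumberField IsDedekindDomain
open scoped WithZero
namespace HM
section norm
variable {F : Type*} [Field F] [NumberField F]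

lemma relIndex_Sq_W_dvd {v : HeightOneSpectrum (𝓞 F)} (h2 : vl v 2 = 1) {L : Subgroup Fˣ} (hL : L ≤ W v) :
    (Sq v).relIndex L ∣ 2 := by
  rw [Subgroup.relIndex_dvd_two_iff]
  by_cases h : ∃ a ∈ L, a ∉ Sq v
  · obtain ⟨a, ha, haS⟩ := h
    refine ⟨a, ha, fun b hb => ?_⟩
    by_cases hbS : b ∈ Sq v
    · exact Or.inr hbS
    · exact Or.inl (odd_mul_mem h2 (hL hb) (hL ha) hbS haS)
  · push Not at h
    exact ⟨1, one_mem _, fun b hb => Or.inr (h b hb)⟩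

lemma relIndex_D0_le {T T0 : Finset (HeightOneSpectrum (𝓞 F))} (hT : ∀ v ∈ T, vl v 2 = 1) (hTT : T0 ⊆ T) :
    (D0 T0).relIndex (WS T) ≤ 2 ^ T0.card ∧ (D0 T0).relIndex (WS T) ≠ 0 := by
  classical
  induction T0 using Finset.induction_on with
  | empty => simp [D0]
  | insert v T0 hv ih =>
    obtain ⟨i1, i2⟩ := ih (fun w hw => hTT (Finset.mem_insert_of_mem hw))
    have hvT : v ∈ T := hTT (Finset.mem_insert_self _ _)
    have e : D0 (insert v T0) = Sq v ⊓ D0 T0 := by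
      ext u; simp [mem_D0, Subgroup.mem_inf]
    have h := relIndex_Sq_W_dvd (hT v hvT) (L := WS T) (fun u hu => mem_WS.mp hu v hvT)
    rw [e, Finset.card_insert_of_notMem hv]
    constructor
    · calc _ ≤ (Sq v).relIndex (WS T) * (D0 T0).relIndex (WS T) := Subgroup.relIndex_inf_le
        _ ≤ 2 * 2 ^ T0.card := Nat.mul_le_mul (Nat.le_of_dvd (by norm_num) h) i1
        _ = _ := by ring
    · exact Subgroup.relIndex_inf_ne_zero (fun h0 => by rw [h0] at h; simp at h) i2

lemma ClS_gen {S : Finset (HeightOneSpectrum (𝓞 F))} (hcl : ClS S) {v : HeightOneSpectrum (𝓞 F)} (hv : v ∉ S) :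
    ∃ f : Fˣ, ord v f = -1 ∧ ∀ w ∉ S, w ≠ v → ord w f = 0 := by
  obtain ⟨f, hf⟩ := hcl v.asIdeal v.ne_bot
  refine ⟨f, ?_, ?_⟩
  · obtain ⟨h1, i, hi, h2⟩ := hf v hv
    obtain ⟨π, hπ⟩ := v.intValuation_exists_uniformizer
    have hπ' : vl v (algebraMap (𝓞 F) F π) = WithZero.exp (-1 : ℤ) := by
      rw [vl, HeightOneSpectrum.valuation_of_algebraMap]; exact hπ
    have hπm : π ∈ v.asIdeal := by
      rw [← vl_lt_one_iff, hπ', ← WithZero.exp_zero, WithZero.exp_lt_exp]; norm_num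
    have h3 := h1 π hπm
    rw [hπ', vl_eq_exp, WithZero.exp_le_exp] at h3
    have h4 : vl v (f : F) < 1 := by
      rw [← h2, vl_lt_one_iff]; exact hi
    rw [vl_eq_exp, ← WithZero.exp_zero, WithZero.exp_lt_exp] at h4
    omega
  · intro w hw hwv
    obtain ⟨h1, i, hi, h2⟩ := hf w hw
    have : ∃ a ∈ v.asIdeal, a ∉ w.asIdeal := by
      by_contra! h
      exact hwv (HeightOneSpectrum.ext ((v.isMaximal.eq_of_le w.isPrime.ne_top h).symm))
    obtain ⟨a, ha, haw⟩ := this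
    have h3 : vl w (algebraMap (𝓞 F) F a) = 1 :=
      le_antisymm (vl_int_le _ _) (not_lt.mp (fun h => haw ((vl_lt_one_iff w a).mp h)))
    have h4 := h1 a ha
    rw [h3] at h4
    have h5 : vl w (f : F) ≤ 1 := by rw [← h2]; exact vl_int_le _ _
    exact mem_W_iff_ord.mp (mem_W.mpr (le_antisymm h5 h4))

lemma ClS_match {S : Finset (HeightOneSpectrum (𝓞 F))} (hcl : ClS S) (f : Fˣ) [DecidableEq (HeightOneSpectrum (𝓞 F))]
    (T : Finset (HeightOneSpectrum (𝓞 F))) (hT : ∀ v ∈ T, v ∉ S) :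
    ∃ g ∈ U (S ∪ T), ∀ v ∈ T, ord v g = ord v f := by
  induction T using Finset.induction_on with
  | empty => exact ⟨1, one_mem _, by simp⟩
  | insert v T hv ih =>
    obtain ⟨g, hg, h⟩ := ih (fun w hw => hT w (Finset.mem_insert_of_mem hw))
    obtain ⟨p, hp, hp'⟩ := ClS_gen hcl (hT v (Finset.mem_insert_self _ _))
    have hvS := hT v (Finset.mem_insert_self _ _)
    refine ⟨g * p ^ (-(ord v f)), ?_, ?_⟩
    · rw [mem_U_ord] at *
      intro w hw
      simp only [Finset.mem_union, Finset.mem_insert, not_or] at hw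
      rw [ord_mul, ord_zpow, hp' w hw.1 hw.2.1, hg w (by simp [hw])]; ring
    · intro w hw
      rw [ord_mul, ord_zpow]
      rcases Finset.mem_insert.mp hw with rfl | hw2
      · rw [hp, mem_U_ord.mp hg w (by simp [hv, hvS])]; ring
      · rw [h w (by assumption), hp' w (hT w (Finset.mem_insert_of_mem (by assumption))) (by rintro rfl; exact hv (by assumption))]; ring

def Good (S : Finset (HeightOneSpectrum (𝓞 F))) (b : Fˣ) (T : Finset (HeightOneSpectrum (𝓞 F))) : Prop :=
  (∀ v ∈ T, v ∉ S ∧ b ∈ Sq v) ∧ 2 ^ T.card ≤ (D0 T).relIndex (U S)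

lemma relIndex_Q_U_ne (S : Finset (HeightOneSpectrum (𝓞 F))) : (Q F).relIndex (U S) ≠ 0 := by
  rw [relIndex_U]; positivity

lemma Good_ext {S T : Finset (HeightOneSpectrum (𝓞 F))} {b : Fˣ} (hdy : ∀ v : HeightOneSpectrum (𝓞 F), vl v 2 < 1 → v ∈ S)
    (hb : b ∉ Q F) (hbU : b ∈ U S) (hT : Good S b T) (h : ¬ (U S ⊓ D0 T ≤ Q F ⊔ Subgroup.zpowers b)) :
    ∃ T', Good S b T' ∧ T'.card = T.card + 1 := by
  classical
  obtain ⟨x, ⟨hxU, hxT⟩, hx⟩ := Set.not_subset.mp h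
  have hxU' : x ∈ U S := hxU
  have hxT' : x ∈ D0 T := hxT
  obtain ⟨L, _, _, _, ⟨e⟩⟩ := exists_QE (b : F) (fun y hy => hb (mem_Q.mpr ⟨y, hy⟩))
  have hxL : up F L x ∉ Q L := by
    intro hxL
    obtain ⟨z, hz⟩ := mem_Q.mp hxL
    rw [up_val] at hz
    obtain ⟨y, hy⟩ := e.square_of_square hz
    apply hx
    have hy0 : y ≠ 0 := by
      rintro rfl
      rcases hy with hy | hy <;> simp at hy
    rcases hy with hy | hy
    · exact Subgroup.mem_sup_left (mem_Q.mpr ⟨y, hy⟩)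
    · have : x = (Units.mk0 y hy0) ^ 2 * b := by ext; simp [hy, mul_comm]
      rw [this]
      exact Subgroup.mul_mem_sup (sq_mem_Q _) (Subgroup.mem_zpowers b)
  obtain ⟨SL, hSL⟩ := QE.exists_SM L (S ∪ T)
  obtain ⟨P, hP, hPx⟩ := lemmaN (up F L x) hxL SL
  set v := dn F P with hv
  have hvS : v ∉ S := fun h => hP ((hSL P).mpr (Finset.mem_union_left _ h))
  have hvT : v ∉ T := fun h => hP ((hSL P).mpr (Finset.mem_union_right _ h))
  have hxv : x ∉ Sq v := fun h => hPx (up_mem_Sq P h)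
  have h2 : vl v 2 = 1 := le_antisymm (vl_two_le _) (not_lt.mp fun h => hvS (hdy _ h))
  have hbv : b ∈ Sq v := by
    by_contra hbv
    have h3 := odd_mul_mem h2 (mem_W.mpr (mem_U.mp hxU' v hvS)) (mem_W.mpr (mem_U.mp hbU v hvS)) hxv hbv
    have h4 := up_mem_Sq P h3
    rw [map_mul] at h4
    have h5 : up F L b ∈ Sq P := Q_le_Sq P (mem_Q.mpr ⟨e.r, by rw [up_val, e.hr]⟩)
    exact hPx ((Subgroup.mul_mem_cancel_right _ h5).mp h4)
  refine ⟨insert v T, ⟨?_, ?_⟩, Finset.card_insert_of_notMem hvT⟩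
  · intro w hw
    rcases Finset.mem_insert.mp hw with rfl | hw2
    · exact ⟨hvS, hbv⟩
    · exact hT.1 w hw2
  · have hd : D0 (insert v T) = Sq v ⊓ D0 T := by
      ext u; simp [mem_D0, Subgroup.mem_inf]
    have hne : (D0 (insert v T)).relIndex (U S) ≠ 0 := fun h0 =>
      relIndex_Q_U_ne S (Subgroup.relIndex_eq_zero_of_le_left (Q_le_D0 _) h0)
    have e1 : (D0 (insert v T)).relIndex (U S) = (Sq v).relIndex (D0 T ⊓ U S) * (D0 T).relIndex (U S) := by
      rw [← Subgroup.inf_relIndex_right, ← Subgroup.inf_relIndex_right (D0 T),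
        ← Subgroup.relIndex_mul_relIndex (D0 (insert v T) ⊓ U S) (D0 T ⊓ U S) (U S) _ inf_le_right, hd, inf_assoc,
        Subgroup.inf_relIndex_right]
      rw [hd, inf_assoc]; exact inf_le_right
    rw [e1] at hne ⊢
    have hne1 : (Sq v).relIndex (D0 T ⊓ U S) ≠ 1 := by
      intro h1
      rw [Subgroup.relIndex_eq_one] at h1
      exact hxv (h1 ⟨hxT', hxU'⟩)
    have hne0 := left_ne_zero_of_mul hne
    rw [Finset.card_insert_of_notMem hvT, pow_succ, mul_comm]
    exact Nat.mul_le_mul (by omega) hT.2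

lemma exists_Good {S : Finset (HeightOneSpectrum (𝓞 F))} {b : Fˣ} (hdy : ∀ v : HeightOneSpectrum (𝓞 F), vl v 2 < 1 → v ∈ S)
    (hb : b ∉ Q F) (hbU : b ∈ U S) : ∃ T, Good S b T ∧ U S ⊓ D0 T ≤ Q F ⊔ Subgroup.zpowers b := by
  by_contra! hcon
  have : ∀ n : ℕ, ∃ T, Good S b T ∧ T.card = n := by
    intro n
    induction n with
    | zero => exact ⟨∅, ⟨by simp, by simp [D0]⟩, rfl⟩
    | succ n ih =>
      obtain ⟨T, hT, rfl⟩ := ih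
      exact Good_ext hdy hb hbU hT (hcon T hT)
  obtain ⟨T, hT, hc⟩ := this (S.card + Fintype.card (InfinitePlace F) + 1)
  have h1 := hT.2
  have h2 : (D0 T).relIndex (U S) ≤ (Q F).relIndex (U S) :=
    Subgroup.relIndex_le_of_le_left (Q_le_D0 _) (relIndex_Q_U_ne S)
  rw [relIndex_U] at h2
  rw [hc] at h1
  have := (Nat.pow_le_pow_iff_right (by norm_num : 1 < 2)).mp (h1.trans h2)
  omega

lemma Good_sup {S T : Finset (HeightOneSpectrum (𝓞 F))} {b : Fˣ} [DecidableEq (HeightOneSpectrum (𝓞 F))]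
    (hdy : ∀ v : HeightOneSpectrum (𝓞 F), vl v 2 < 1 → v ∈ S)
    (hcl : ClS S) (hT : Good S b T) : D0 T ⊔ U (S ∪ T) = ⊤ := by
  have h2 : ∀ v ∈ T, vl v 2 = 1 := fun v hv => le_antisymm (vl_two_le _) (not_lt.mp fun h => (hT.1 v hv).1 (hdy _ h))
  obtain ⟨h3, h4⟩ := relIndex_D0_le h2 (Finset.Subset.refl T)
  have hUW : U S ≤ WS T := by
    intro u hu
    rw [mem_WS]
    exact fun v hv => mem_U.mp hu v (hT.1 v hv).1
  have h5 := relIndex_chain (D0 T) hUW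
  have h6 : (D0 T ⊔ U S).relIndex (WS T) = 1 := by
    have hne : (D0 T ⊔ U S).relIndex (WS T) ≠ 0 := by
      intro h0; rw [h0] at h5; simp at h5; exact h4 h5
    by_contra h1
    have h7 : 2 ≤ (D0 T ⊔ U S).relIndex (WS T) := by omega
    have h8 := Nat.mul_le_mul hT.2 h7
    rw [← h5] at h8
    have : 0 < 2 ^ T.card := by positivity
    omega
  rw [Subgroup.relIndex_eq_one] at h6
  rw [eq_top_iff]
  intro f _
  obtain ⟨g, hg, h⟩ := ClS_match hcl f T (fun v hv => (hT.1 v hv).1)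
  have h7 : f / g ∈ WS T := by
    rw [mem_WS]
    intro v hv
    rw [mem_W_iff_ord, ord_div, h v hv]; ring
  have h8 := (sup_le_sup_left (U_mono (Finset.subset_union_left : S ⊆ S ∪ T)) (D0 T)) (h6 h7)
  rw [← div_mul_cancel f g]
  exact mul_mem h8 (Subgroup.mem_sup_right hg)
end norm
end HM

open NumberField IsDedekindDomain
open scoped WithZero
namespace HM
section nt
variable {F : Type*} [Field F] [NumberField F]

lemma mem_iInf_fin {S : Finset (HeightOneSpectrum (𝓞 F))} {N : HeightOneSpectrum (𝓞 F) → Subgroup Fˣ} {u : Fˣ} :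
    u ∈ (⨅ v ∈ S, N v) ↔ ∀ v ∈ S, u ∈ N v := by
  simp [Subgroup.mem_iInf]

lemma inj_step {S T : Finset (HeightOneSpectrum (𝓞 F))} {b : Fˣ} [DecidableEq (HeightOneSpectrum (𝓞 F))]
    (hdy : ∀ v : HeightOneSpectrum (𝓞 F), vl v 2 < 1 → v ∈ S)
    (hcl : ClS S) (hT : Good S b T) : U (S ∪ T) ⊓ DD S ≤ Q F := by
  classical
  rintro X ⟨hXU, hXD⟩
  have hXU : X ∈ U (S ∪ T) := hXU
  have hXD : X ∈ D0 S ⊓ Pos F := hXD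
  obtain ⟨hX0, hXP⟩ := Subgroup.mem_inf.mp hXD
  by_contra hXQ
  obtain ⟨M, _, _, _, ⟨e⟩⟩ := exists_QE (X : F) (fun y h => hXQ (mem_Q.mpr ⟨y, h⟩))
  have hdy' : ∀ v : HeightOneSpectrum (𝓞 F), vl v 2 < 1 → v ∈ S ∪ T := fun v hv => Finset.mem_union_left _ (hdy v hv)
  have hH := e.lemmaH hdy' (ClS_mono Finset.subset_union_left hcl) rfl hXU hXP
  set R := (S ∪ T).filter (fun v => X ∉ Sq v) with hR
  have hRT : ∀ v ∈ R, v ∈ T := by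
    intro v hv
    obtain ⟨h1, h2⟩ := Finset.mem_filter.mp hv
    rcases Finset.mem_union.mp h1 with h | h
    · exact absurd (mem_D0.mp hX0 v h) h2
    · exact h
  set N : Subgroup Fˣ := ⨅ v ∈ R, Nv (X : F) v with hN
  have hDN : D0 T ≤ N := by
    intro u hu
    rw [hN, mem_iInf_fin]
    exact fun v hv => Sq_le_Nv _ v (mem_D0.mp hu v (hRT v hv))
  have hDN' : D0 (S ∪ T) ≤ N := by
    intro u hu
    apply hDN
    exact mem_D0.mpr fun v hv => mem_D0.mp hu v (Finset.mem_union_right _ hv)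
  have hN0 : N.index ≠ 0 := by
    intro h
    have := Subgroup.relIndex_mul_index hDN'
    rw [h, mul_zero] at this
    exact (index_D0 (S ∪ T) hdy').2 this.symm
  have hge := index_inf_ge R (fun v => Nv (X : F) v) (fun v _ => Sq_le_Nv _ v)
    (fun v hv => Nv_ne_top (le_antisymm (vl_two_le _) (not_lt.mp fun h => (hT.1 v (hRT v hv)).1 (hdy _ h)))
      (Finset.mem_filter.mp hv).2) hN0
  have hsup : N ⊔ U (S ∪ T) = ⊤ := by
    rw [eq_top_iff, ← Good_sup hdy hcl hT]
    exact sup_le_sup_right hDN _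
  have hrel : N.relIndex (U (S ∪ T)) = N.index := by
    rw [← Subgroup.relIndex_top_right, ← hsup, sup_comm, Subgroup.relIndex_sup_right]
  have hNxN : Nx (X : F) ≤ N := by
    intro u hu
    rw [hN, mem_iInf_fin]
    exact fun v hv => Nx_le_Nv _ v hu
  have hne : (Nx (X : F)).relIndex (U (S ∪ T)) ≠ 0 := by
    intro h
    exact relIndex_Q_U_ne (S ∪ T) (Subgroup.relIndex_eq_zero_of_le_left (Q_le_Nx _) h)
  have hle := Subgroup.relIndex_le_of_le_left hNxN hne
  have : 0 < (Nx (X : F)).relIndex (U (S ∪ T)) := Nat.pos_of_ne_zero hne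
  have h1 : 2 ^ R.card ≤ (Nx (X : F)).relIndex (U (S ∪ T)) := hge.trans (hrel ▸ hle)
  omega

lemma card_T {S T : Finset (HeightOneSpectrum (𝓞 F))} {b : Fˣ}
    (hdy : ∀ v : HeightOneSpectrum (𝓞 F), vl v 2 < 1 → v ∈ S) (hT : Good S b T) (hbU : b ∈ U S)
    (h : U S ⊓ D0 T ≤ Q F ⊔ Subgroup.zpowers b) :
    S.card + Fintype.card (InfinitePlace F) ≤ T.card + 1 := by
  have h2 : ∀ v ∈ T, vl v 2 = 1 := fun v hv => le_antisymm (vl_two_le _) (not_lt.mp fun h => (hT.1 v hv).1 (hdy _ h))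
  obtain ⟨h3, h4⟩ := relIndex_D0_le h2 (Finset.Subset.refl T)
  have hUW : U S ≤ WS T := by
    intro u hu
    rw [mem_WS]
    intro v hv
    rw [mem_W_iff_ord]
    exact mem_U_ord.mp hu v (hT.1 v hv).1
  have hz : Subgroup.zpowers b ≤ U S := by rwa [Subgroup.zpowers_le]
  have c1 := relIndex_chain (Q F) hz
  rw [relIndex_U] at c1
  have c2 : (Q F).relIndex (Subgroup.zpowers b) ∣ 2 := by
    rw [Subgroup.relIndex_dvd_two_iff]
    refine ⟨b, Subgroup.mem_zpowers b, ?_⟩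
    intro d hd
    obtain ⟨k, rfl⟩ := Subgroup.mem_zpowers_iff.mp hd
    rcases Int.even_or_odd k with ⟨m, rfl⟩ | ⟨m, rfl⟩
    · right
      rw [zpow_add, ← sq]; exact sq_mem_Q _
    · left
      have : b ^ (2 * m + 1) * b = (b ^ (m + 1)) ^ 2 := by
        rw [← zpow_natCast (b ^ (m+1)), ← zpow_mul, ← zpow_add_one]; congr 1; push_cast; ring
      rw [this]; exact sq_mem_Q _
  have c3 := Nat.le_of_dvd two_pos c2
  have c4 := relIndex_chain (D0 T) hUW
  have c5 : (D0 T).relIndex (U S) ≤ 2 ^ T.card := by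
    refine le_trans ?_ h3
    rw [c4]
    refine Nat.le_mul_of_pos_right _ (Nat.pos_of_ne_zero ?_)
    intro h0; rw [h0, mul_zero] at c4; exact h4 c4
  have c5' : (D0 T).relIndex (U S) ≠ 0 := by
    intro h0; rw [h0, zero_mul] at c4; exact h4 c4
  have c6 : (Q F ⊔ Subgroup.zpowers b).relIndex (U S) ≤ (D0 T).relIndex (U S) := by
    rw [← Subgroup.inf_relIndex_right (D0 T)]
    refine Subgroup.relIndex_le_of_le_left (by rw [inf_comm]; exact h) ?_
    rwa [Subgroup.inf_relIndex_right]
  have : 2 ^ (S.card + Fintype.card (InfinitePlace F)) ≤ 2 ^ (T.card + 1) := by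
    rw [c1, pow_succ, mul_comm (2 ^ T.card)]
    exact Nat.mul_le_mul c3 (c6.trans c5)
  exact (Nat.pow_le_pow_iff_right (by norm_num)).mp this

lemma relIndex_sup_idx {A : Type*} [CommGroup A] (H L : Subgroup A) : H.index = H.relIndex L * (H ⊔ L).index := by
  rw [← Subgroup.relIndex_mul_index (le_sup_left : H ≤ H ⊔ L), sup_comm, Subgroup.relIndex_sup_right]

theorem normThm {b c : Fˣ} (hbpos : b ∈ Pos F) (hbdy : ∀ v : HeightOneSpectrum (𝓞 F), vl v 2 < 1 → b ∈ Sq v)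
    (hloc : ∀ v : HeightOneSpectrum (𝓞 F), b ∉ Sq v → c ∈ Nv (b : F) v) : c ∈ Nx (b : F) := by
  classical
  by_cases hb : b ∈ Q F
  · obtain ⟨y, hy⟩ := mem_Q.mp hb
    have hy0 : y ≠ 0 := by rintro rfl; exact b.ne_zero (by simpa using hy)
    rw [mem_Nx]
    refine ⟨((c : F) + 1) / 2, ((c : F) - 1) / (2 * y), ?_⟩
    rw [hy]; field_simp; ring
  obtain ⟨S1, hS1⟩ := exists_ClS F
  set S : Finset (HeightOneSpectrum (𝓞 F)) := S1 ∪ (finite_dyadic F).toFinset ∪ (finite_bad b.ne_zero).toFinset ∪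
    (finite_bad c.ne_zero).toFinset with hS
  have hcl : ClS S := ClS_mono (fun v hv => by simp [hS, hv]) hS1
  have hdy : ∀ v : HeightOneSpectrum (𝓞 F), vl v 2 < 1 → v ∈ S := fun v hv => by simp [hS, hv]
  have hbU : b ∈ U S := by
    rw [mem_U]; intro v hv; by_contra h; exact hv (by simp [hS, h])
  have hcU : c ∈ U S := by
    rw [mem_U]; intro v hv; by_contra h; exact hv (by simp [hS, h])
  obtain ⟨T, hT, hTU⟩ := exists_Good hdy hb hbU
  have hcT := card_T hdy hT hbU hTU
  have hinj := inj_step hdy hcl hT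
  have hUU : U S ≤ U (S ∪ T) := U_mono Finset.subset_union_left
  obtain ⟨hD1, hD2⟩ := index_DD S hdy
  set s := S.card + Fintype.card (InfinitePlace F) with hs
  have hcard : (S ∪ T).card = S.card + T.card := Finset.card_union_of_disjoint
    (Finset.disjoint_right.mpr fun v hv => (hT.1 v hv).1)
  have q1 := relIndex_U (S ∪ T)
  have q2 := relIndex_sup_idx (DD S) (U (S ∪ T))
  have q3 : (Q F).relIndex (U (S ∪ T)) ≤ (DD S).relIndex (U (S ∪ T)) := by
    rw [← Subgroup.inf_relIndex_right (DD S)]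
    refine Subgroup.relIndex_le_of_le_left (by rw [inf_comm]; exact hinj) ?_
    rw [Subgroup.inf_relIndex_right]
    intro h0; rw [h0, zero_mul] at q2; exact hD2 q2
  have q4 : (DD S ⊔ U (S ∪ T)).index ≤ 2 := by
    have e1 : 2 ^ (s + T.card) * (DD S ⊔ U (S ∪ T)).index ≤ 2 ^ (s + T.card) * 2 := by
      calc 2 ^ (s + T.card) * (DD S ⊔ U (S ∪ T)).index ≤ (DD S).relIndex (U (S ∪ T)) * (DD S ⊔ U (S ∪ T)).index := by
            refine Nat.mul_le_mul_right _ (le_trans (le_of_eq ?_) q3)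
            rw [q1, hcard, hs]; congr 1; ring
        _ = (DD S).index := q2.symm
        _ ≤ 2 ^ (2 * s) := hD1
        _ ≤ 2 ^ (s + T.card + 1) := Nat.pow_le_pow_right (by norm_num) (by omega)
        _ = _ := pow_succ _ _
    exact Nat.le_of_mul_le_mul_left e1 (by positivity)
  have q4' : (DD S ⊔ U (S ∪ T)).index ≠ 0 := by
    intro h0; rw [h0, mul_zero] at q2; exact hD2 q2
  obtain ⟨M, _, _, _, ⟨e⟩⟩ := exists_QE (b : F) (fun y h => hb (mem_Q.mpr ⟨y, h⟩))
  have hdy' : ∀ v : HeightOneSpectrum (𝓞 F), vl v 2 < 1 → v ∈ S ∪ T := fun v hv => Finset.mem_union_left _ (hdy v hv)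
  have hH := e.lemmaH hdy' (ClS_mono Finset.subset_union_left hcl) rfl (hUU hbU) hbpos
  set R := (S ∪ T).filter (fun v => b ∉ Sq v) with hR
  have hRS : ∀ v ∈ R, v ∈ S := by
    intro v hv
    obtain ⟨h1, h2⟩ := Finset.mem_filter.mp hv
    rcases Finset.mem_union.mp h1 with h | h
    · exact h
    · exact absurd (hT.1 v h).2 h2
  set N : Subgroup Fˣ := ⨅ v ∈ R, Nv (b : F) v with hN
  have hDN : DD S ≤ N := by
    intro u hu
    have hu0 : u ∈ D0 S := (Subgroup.mem_inf.mp (show u ∈ D0 S ⊓ Pos F from hu)).1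
    rw [hN, mem_iInf_fin]
    exact fun v hv => Sq_le_Nv _ v (mem_D0.mp hu0 v (hRS v hv))
  have hN0 : N.index ≠ 0 := by
    intro h
    have := Subgroup.relIndex_mul_index hDN
    rw [h, mul_zero] at this
    exact hD2 this.symm
  have hge := index_inf_ge R (fun v => Nv (b : F) v) (fun v _ => Sq_le_Nv _ v)
    (fun v hv => Nv_ne_top (le_antisymm (vl_two_le _) (not_lt.mp fun h => (Finset.mem_filter.mp hv).2 (hbdy _ h)))
      (Finset.mem_filter.mp hv).2) hN0
  have r1 := relIndex_sup_idx N (U (S ∪ T))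
  have r2 : (N ⊔ U (S ∪ T)).index ≤ 2 := by
    have := Subgroup.relIndex_mul_index (sup_le_sup_right hDN (U (S ∪ T)))
    refine le_trans ?_ q4
    rw [← this]
    refine Nat.le_mul_of_pos_left _ (Nat.pos_of_ne_zero fun h0 => ?_)
    rw [h0, zero_mul] at this; exact q4' this.symm
  have hNxN : Nx (b : F) ≤ N := by
    intro u hu
    rw [hN, mem_iInf_fin]
    exact fun v hv => Nx_le_Nv _ v hu
  have hne : (Nx (b : F)).relIndex (U (S ∪ T)) ≠ 0 := by
    intro h
    exact relIndex_Q_U_ne (S ∪ T) (Subgroup.relIndex_eq_zero_of_le_left (Q_le_Nx _) h)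
  have r3 : 2 ^ R.card ≤ N.relIndex (U (S ∪ T)) * 2 := by
    refine hge.trans ?_
    change N.index ≤ _
    rw [r1]; exact Nat.mul_le_mul_left _ r2
  have r4 : (Nx (b : F)).relIndex (U (S ∪ T)) ≤ N.relIndex (U (S ∪ T)) := by omega
  have r5 := relIndex_chain (Nx (b : F)) (inf_le_right : N ⊓ U (S ∪ T) ≤ U (S ∪ T))
  have r6 : (Nx (b : F) ⊔ N ⊓ U (S ∪ T)).relIndex (U (S ∪ T)) = N.relIndex (U (S ∪ T)) := by
    rw [← Subgroup.inf_relIndex_right, ← Subgroup.inf_relIndex_right N]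
    congr 1
    apply le_antisymm
    · exact inf_le_inf_right _ (sup_le hNxN inf_le_left)
    · exact le_inf le_sup_right inf_le_right
  rw [r6] at r5
  have r7 : (Nx (b : F)).relIndex (N ⊓ U (S ∪ T)) = 1 := by
    have hNpos : 0 < N.relIndex (U (S ∪ T)) := Nat.pos_of_ne_zero (fun h0 => by rw [h0, mul_zero] at r5; exact hne r5)
    have h0 : (Nx (b : F)).relIndex (N ⊓ U (S ∪ T)) ≠ 0 := fun h0 => by rw [h0, zero_mul] at r5; exact hne r5
    rw [r5] at r4
    have : (Nx (b : F)).relIndex (N ⊓ U (S ∪ T)) ≤ 1 := by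
      by_contra hh
      nlinarith
    omega
  rw [Subgroup.relIndex_eq_one] at r7
  apply r7
  refine Subgroup.mem_inf.mpr ⟨?_, hUU hcU⟩
  rw [hN, mem_iInf_fin]
  exact fun v hv => hloc v (Finset.mem_filter.mp hv).2
end nt
end HM

open NumberField IsDedekindDomain
open scoped WithZero
namespace HM
section core
variable {F : Type*} [Field F] [NumberField F]

lemma even_mul_mem {v : HeightOneSpectrum (𝓞 F)} (h2 : vl v 2 = 1) {u u' : Fˣ} (hu : Even (ord v u))
    (hu' : Even (ord v u')) (h : u ∉ Sq v) (h' : u' ∉ Sq v) : u * u' ∈ Sq v := by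
  obtain ⟨y, a, ha, rfl⟩ := even_reduce hu
  obtain ⟨y', a', ha', rfl⟩ := even_reduce hu'
  have h3 : a ∉ Sq v := fun hh => h (mul_mem hh (sq_mem_Sq v y))
  have h4 : a' ∉ Sq v := fun hh => h' (mul_mem hh (sq_mem_Sq v y'))
  have := mul_mem (mul_mem (odd_mul_mem h2 ha ha' h3 h4) (sq_mem_Sq v y)) (sq_mem_Sq v y')
  convert this using 1
  simp only [mul_assoc, mul_left_comm, mul_comm]

lemma ord_neg_one (v : HeightOneSpectrum (𝓞 F)) : ord v (-1 : Fˣ) = 0 := by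
  rw [← mem_W_iff_ord, mem_W]; simp

lemma ord_neg (v : HeightOneSpectrum (𝓞 F)) (u : Fˣ) : ord v (-u) = ord v u := by
  rw [← neg_one_mul, ord_mul, ord_neg_one, zero_add]

section
variable {M : Type*} [Field M] [NumberField M] [Algebra F M]

lemma ord_up (P : HeightOneSpectrum (𝓞 M)) : ∃ e : ℕ, ∀ a : Fˣ, ord P (up F M a) = e * ord (dn F P) a := by
  obtain ⟨e, _, h⟩ := exists_e (F := F) P
  refine ⟨e, fun a => ?_⟩
  rw [ord, up_val, h, ord, WithZero.log_pow]
  simp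

lemma up_mul_mem {P : HeightOneSpectrum (𝓞 M)} (h2 : vl (dn F P) 2 = 1) {d : Fˣ} (hd : d ∉ Sq (dn F P))
    (hdP : up F M d ∈ Sq P) {a a' : Fˣ} (ha : up F M a ∉ Sq P) (ha' : up F M a' ∉ Sq P) :
    up F M (a * a') ∈ Sq P := by
  -- membership principle
  have key : ∀ u : Fˣ, (u ∈ Sq (dn F P) ∨ u * d ∈ Sq (dn F P)) → up F M u ∈ Sq P := by
    rintro u (h | h)
    · exact up_mem_Sq P h
    · have := up_mem_Sq P h
      rw [map_mul] at this
      exact (Subgroup.mul_mem_cancel_right _ hdP).mp this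
  rcases Int.even_or_odd (ord (dn F P) d) with he | ho
  · have hev : ∀ u : Fˣ, Even (ord (dn F P) u) → up F M u ∈ Sq P := by
      intro u hu
      apply key
      by_cases h : u ∈ Sq (dn F P)
      · exact Or.inl h
      · exact Or.inr (even_mul_mem h2 hu he h hd)
    apply hev
    rw [ord_mul]
    have o1 : Odd (ord (dn F P) a) := Int.not_even_iff_odd.mp fun h => ha (hev a h)
    have o2 : Odd (ord (dn F P) a') := Int.not_even_iff_odd.mp fun h => ha' (hev a' h)
    exact o1.add_odd o2
  · have red : ∀ u : Fˣ, up F M u ∉ Sq P → ∃ u' : Fˣ, Even (ord (dn F P) u') ∧ (u' ∉ Sq (dn F P)) ∧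
        (u' = u ∨ u' = u * d) := by
      intro u hu
      rcases Int.even_or_odd (ord (dn F P) u) with h | h
      · exact ⟨u, h, fun hh => hu (key u (Or.inl hh)), Or.inl rfl⟩
      · exact ⟨u * d, by rw [ord_mul]; exact h.add_odd ho, fun hh => hu (key u (Or.inr hh)), Or.inr rfl⟩
    obtain ⟨w, w1, w2, w3⟩ := red a ha
    obtain ⟨w', w1', w2', w3'⟩ := red a' ha'
    have hw := up_mem_Sq P (even_mul_mem h2 w1 w1' w2 w2')
    rw [map_mul] at hw ⊢
    rcases w3 with rfl | rfl <;> rcases w3' with rfl | rfl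
    · exact hw
    · rw [map_mul, ← mul_assoc] at hw
      exact (Subgroup.mul_mem_cancel_right _ hdP).mp hw
    · rw [map_mul, mul_right_comm] at hw
      exact (Subgroup.mul_mem_cancel_right _ hdP).mp hw
    · rw [map_mul, map_mul, mul_mul_mul_comm, ← mul_assoc] at hw
      exact (Subgroup.mul_mem_cancel_right _ hdP).mp ((Subgroup.mul_mem_cancel_right _ hdP).mp hw)

lemma local_cond {P : HeightOneSpectrum (𝓞 M)} (h2 : vl (dn F P) 2 = 1) {d : Fˣ} (hd : d ∉ Sq (dn F P))
    (hdQ : up F M d ∈ Q M) {b c : Fˣ} (hb : up F M b ∉ Sq P) :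
    up F M c ∈ Nv ((up F M b : Mˣ) : M) P := by
  have hdP := Q_le_Sq P hdQ
  have h2P : vl P 2 = 1 := (vl_up_two P).mpr h2
  by_cases hc : up F M c ∈ Sq P
  · exact Sq_le_Nv _ _ hc
  have hbc := up_mul_mem h2 hd hdP hb hc
  rw [map_mul] at hbc
  set B := up F M b with hB
  have h1 : (-1 : Mˣ) ∈ Nv (B : M) P := by
    by_cases hev : Even (ord P B)
    · exact even_mem_Nv h2P hev (by rw [ord_neg_one]; exact Even.zero)
    · obtain ⟨e, he⟩ := ord_up (F := F) P
      have heo : Odd (e : ℤ) := by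
        rw [Int.not_even_iff_odd, hB, he] at hev
        exact (Int.odd_mul.mp hev).1
      have hde : Even (ord (dn F P) d) := by
        have := ord_even_of_mem_Sq hdP
        rw [he] at this
        rcases Int.even_mul.mp this with h | h
        · exact absurd heo (Int.not_odd_iff_even.mpr h)
        · exact h
      apply Sq_le_Nv
      have hm : up F M (-1) = -1 := by ext; simp
      rw [← hm]
      by_cases h : (-1 : Fˣ) ∈ Sq (dn F P)
      · exact up_mem_Sq P h
      · have := up_mem_Sq P (even_mul_mem h2 (by rw [ord_neg_one]; exact Even.zero) hde h hd)
        rw [map_mul] at this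
        exact (Subgroup.mul_mem_cancel_right _ hdP).mp this
  have h3 : -B ∈ Nv (B : M) P := Nx_le_Nv _ _ (mem_Nx.mpr ⟨0, 1, by simp⟩)
  have h4 : B ∈ Nv (B : M) P := by
    have := mul_mem h1 h3
    simpa using this
  have := mul_mem (Sq_le_Nv (B : M) P hbc) (inv_mem h4)
  simpa [mul_comm] using this
end

lemma approx_sq (v : HeightOneSpectrum (𝓞 F)) (a : F) {ε : ℤᵐ⁰} (hε : ε ≠ 0) :
    ∃ γ : ℤᵐ⁰, γ ≠ 0 ∧ ∀ f : F, vl v (f - a) < γ → vl v (f ^ 2 - a ^ 2) < ε := by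
  set m := max 1 (vl v (2 * a)) with hm
  have hm0 : 0 < m := lt_of_lt_of_le one_pos (le_max_left _ _)
  refine ⟨min 1 (ε / m), ?_, fun f hf => ?_⟩
  · have : 0 < min 1 (ε / m) := lt_min one_pos (div_pos (zero_lt_iff.mpr hε) hm0)
    exact this.ne'
  · have e : f ^ 2 - a ^ 2 = (f - a) * ((f - a) + 2 * a) := by ring
    rw [e, map_mul]
    have h1 : vl v (f - a) < 1 := hf.trans_le (min_le_left _ _)
    have h2 : vl v (f - a) < ε / m := hf.trans_le (min_le_right _ _)
    have h3 : vl v ((f - a) + 2 * a) ≤ m := Valuation.map_add_le _ (h1.le.trans (le_max_left _ _)) (le_max_right _ _)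
    calc _ ≤ vl v (f - a) * m := mul_le_mul_right h3 _
      _ < ε := by rwa [lt_div_iff₀ hm0] at h2

/-- a binary form represents locally some class different from a given one -/
lemma binary_local {v : HeightOneSpectrum (𝓞 F)} (h2 : vl v 2 = 1) (p q m : Fˣ) :
    ∃ X Y : F, ∃ t : Fˣ, (t : F) = p * X ^ 2 + q * Y ^ 2 ∧ t * m ∉ Sq v := by
  by_cases hp : p * m ∈ Sq v
  swap
  · exact ⟨1, 0, p, by simp, hp⟩
  by_cases hq : q * m ∈ Sq v
  swap
  · exact ⟨0, 1, q, by simp, hq⟩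
  have hpq : p * q ∈ Sq v := by
    have := mul_mem hp hq
    have h3 := mul_mem this (sq_mem_Sq v m⁻¹)
    convert h3 using 1
    rw [inv_pow, mul_mul_mul_comm, ← sq, mul_inv_cancel_right]
  obtain ⟨u, hu, hu'⟩ := exists_nonsq_unit h2
  have hN := even_mem_Nv h2 (b := -(p * q)) (c := u) (by rw [ord_neg]; exact ord_even_of_mem_Sq hpq)
    (by rw [mem_W_iff_ord.mp hu]; exact Even.zero)
  obtain ⟨n, hn, s, hs, rfl⟩ := Subgroup.mem_sup.mp hN
  obtain ⟨X, Y, hXY⟩ := mem_Nx.mp hn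
  refine ⟨X, p * Y, p * n, ?_, ?_⟩
  · rw [Units.val_mul, hXY]; push_cast; ring
  · intro h
    rw [mul_right_comm] at h
    have := (Subgroup.mul_mem_cancel_left _ hp).mp h
    exact hu' (mul_mem this hs)

lemma binary_global (S : Finset (HeightOneSpectrum (𝓞 F))) (h2 : ∀ v ∈ S, vl v 2 = 1) (hS : S.Nonempty) (p q m : Fˣ) :
    ∃ X Y : F, ∃ t : Fˣ, (t : F) = p * X ^ 2 + q * Y ^ 2 ∧ ∀ v ∈ S, t * m ∉ Sq v := by
  classical
  have hloc : ∀ v : HeightOneSpectrum (𝓞 F), ∃ X Y : F, ∃ t : Fˣ, v ∈ S →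
      ((t : F) = p * X ^ 2 + q * Y ^ 2 ∧ t * m ∉ Sq v) := by
    intro v
    by_cases hv : v ∈ S
    · obtain ⟨X, Y, t, h, h'⟩ := binary_local (h2 v hv) p q m
      exact ⟨X, Y, t, fun _ => ⟨h, h'⟩⟩
    · exact ⟨0, 0, 1, fun h => absurd h hv⟩
  choose X Y t ht using hloc
  have hγ : ∀ v, ∃ γ : ℤᵐ⁰, γ ≠ 0 ∧ ∀ f : F, vl v (f - X v) < γ → vl v (f ^ 2 - X v ^ 2) < vl v (4 * t v / p) :=
    fun v => approx_sq v (X v) (by simp)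
  have hγ' : ∀ v, ∃ γ : ℤᵐ⁰, γ ≠ 0 ∧ ∀ f : F, vl v (f - Y v) < γ → vl v (f ^ 2 - Y v ^ 2) < vl v (4 * t v / q) :=
    fun v => approx_sq v (Y v) (by simp)
  choose γ hγ0 hγ using hγ
  choose δ hδ0 hδ using hγ'
  obtain ⟨f, hf⟩ := weak_approx S X γ hγ0
  obtain ⟨g, hg⟩ := weak_approx S Y δ hδ0
  have hclose : ∀ v ∈ S, vl v ((p * f ^ 2 + q * g ^ 2) - t v) < vl v (4 * t v) := by
    intro v hv
    rw [(ht v hv).1, show (p * f ^ 2 + q * g ^ 2 : F) - (p * X v ^ 2 + q * Y v ^ 2) =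
      p * (f ^ 2 - X v ^ 2) + q * (g ^ 2 - Y v ^ 2) by ring, ← (ht v hv).1]
    apply Valuation.map_add_lt
    · have := hγ v f (hf v hv)
      rw [map_div₀, lt_div_iff₀ (by simp [zero_lt_iff])] at this
      rw [map_mul, mul_comm]; exact this
    · have := hδ v g (hg v hv)
      rw [map_div₀, lt_div_iff₀ (by simp [zero_lt_iff])] at this
      rw [map_mul, mul_comm]; exact this
  obtain ⟨v0, hv0⟩ := hS
  have hne : (p * f ^ 2 + q * g ^ 2 : F) ≠ 0 := by
    intro h
    have := hclose v0 hv0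
    rw [h, zero_sub, Valuation.map_neg, map_mul] at this
    exact absurd this (not_lt.mpr (mul_le_of_le_one_left' (vl_four_le v0)))
  refine ⟨f, g, Units.mk0 _ hne, rfl, fun v hv h => ?_⟩
  have h3 : Units.mk0 _ hne / t v ∈ Sq v := div_mem_Sq (hclose v hv)
  apply (ht v hv).2
  have := (Sq v).div_mem h h3
  convert this using 1
  rw [div_div_eq_mul_div, mul_right_comm, mul_div_right_comm]
  simp [mul_comm, mul_left_comm]

end core
end HM

open NumberField IsDedekindDomain
open scoped WithZero
namespace HM
section core
variable {F : Type*} [Field F] [NumberField F]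

theorem core5 (g₁ g₂ h₁ h₂ h₃ : Fˣ) (hpos : -(g₁ * g₂) ∈ Pos F)
    (hdy : ∀ v : HeightOneSpectrum (𝓞 F), vl v 2 < 1 → -(g₁ * g₂) ∈ Sq v) :
    ∃ a b c d e : F, (a ≠ 0 ∨ b ≠ 0 ∨ c ≠ 0 ∨ d ≠ 0 ∨ e ≠ 0) ∧
      g₁ * a ^ 2 + g₂ * b ^ 2 + h₁ * c ^ 2 + h₂ * d ^ 2 + h₃ * e ^ 2 = 0 := by
  classical
  set S : Finset (HeightOneSpectrum (𝓞 F)) := ((finite_bad g₁.ne_zero).toFinset ∪ (finite_bad g₂.ne_zero).toFinset ∪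
    (finite_bad h₁.ne_zero).toFinset).filter (fun v => vl v 2 = 1) with hS
  have hSo : ∀ v ∈ S, vl v 2 = 1 := fun v hv => (Finset.mem_filter.mp hv).2
  have hSn : ∀ v, vl v 2 = 1 → v ∉ S → ord v g₁ = 0 ∧ ord v g₂ = 0 ∧ ord v h₁ = 0 := by
    intro v h2 hv
    simp only [hS, Finset.mem_filter, Finset.mem_union, Set.Finite.mem_toFinset, Set.mem_ofPred_eq, not_and,
      h2, not_true_eq_false, imp_false, not_or, not_not] at hv
    simp only [← mem_W_iff_ord, mem_W]
    exact ⟨hv.1.1, hv.1.2, hv.2⟩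
  have hodd : ∀ v : HeightOneSpectrum (𝓞 F), -(g₁ * g₂) ∉ Sq v → vl v 2 = 1 := fun v h =>
    le_antisymm (vl_two_le _) (not_lt.mp fun h' => h (hdy v h'))
  rcases S.eq_empty_or_nonempty with hE | hne
  · have : -(g₁ * h₁) ∈ Nx ((-(g₁ * g₂) : Fˣ) : F) := by
      refine normThm hpos hdy fun v hv => ?_
      obtain ⟨e1, e2, e3⟩ := hSn v (hodd v hv) (by rw [hE]; simp)
      exact even_mem_Nv (hodd v hv) (by rw [ord_neg, ord_mul, e1, e2]; simp) (by rw [ord_neg, ord_mul, e1, e3]; simp)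
    obtain ⟨p, q, h⟩ := mem_Nx.mp this
    refine ⟨p / g₁, q, 1, 0, 0, by simp, ?_⟩
    have hg := g₁.ne_zero
    push_cast at h
    field_simp
    linear_combination -h
  · obtain ⟨X, Y, t, ht, hts⟩ := binary_global S hSo hne h₂ h₃ (g₁ * g₂ * h₁)
    set d := t * (g₁ * g₂ * h₁) with hd
    obtain ⟨v0, hv0⟩ := hne
    have hdQ : d ∉ Q F := fun h => hts v0 hv0 (Q_le_Sq v0 h)
    obtain ⟨M, _, _, _, ⟨e⟩⟩ := exists_QE (d : F) (fun y h => hdQ (mem_Q.mpr ⟨y, h⟩))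
    have hdM : up F M d ∈ Q M := mem_Q.mpr ⟨e.r, by rw [up_val, e.hr]⟩
    have : up F M (-(g₁ * h₁)) ∈ Nx ((up F M (-(g₁ * g₂)) : Mˣ) : M) := by
      refine normThm ?_ ?_ fun P hP => ?_
      · rw [mem_Pos] at hpos ⊢
        intro σ
        exact hpos (σ.comp (algebraMap F M))
      · intro P hP
        exact up_mem_Sq P (hdy _ ((vl_up_two_lt P).mp hP))
      · have h2 := hodd (dn F P) (fun h => hP (up_mem_Sq P h))
        by_cases hPS : dn F P ∈ S
        · exact local_cond h2 (hts _ hPS) hdM hP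
        · obtain ⟨e1, e2, e3⟩ := hSn _ h2 hPS
          obtain ⟨k, hk⟩ := ord_up (F := F) P
          exact even_mem_Nv ((vl_up_two P).mpr h2) (by rw [hk, ord_neg, ord_mul, e1, e2]; simp)
            (by rw [hk, ord_neg, ord_mul, e1, e3]; simp)
    obtain ⟨p, q, h⟩ := mem_Nx.mp this
    have hg := g₁.ne_zero
    have hg2 := g₂.ne_zero
    have hh1 := h₁.ne_zero
    have ht0 := t.ne_zero
    obtain ⟨p1, p2, rfl⟩ := e.span p
    obtain ⟨q1, q2, rfl⟩ := e.span q
    have hr := e.hr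
    simp only [up_val, Units.val_neg, Units.val_mul] at h
    have hz : algebraMap F M (p1 ^ 2 + d * p2 ^ 2 + g₁ * g₂ * (q1 ^ 2 + d * q2 ^ 2) + g₁ * h₁) +
        algebraMap F M (2 * (p1 * p2 + g₁ * g₂ * q1 * q2)) * e.r = 0 := by
      simp only [map_add, map_mul, map_pow, map_neg, map_ofNat (algebraMap F M)] at h ⊢
      linear_combination -h - (algebraMap F M p2 ^ 2 + algebraMap F M g₁ * algebraMap F M g₂ * algebraMap F M q2 ^ 2) * hr
    obtain ⟨z1, z2⟩ := e.coord_zero hz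
    have z2' : p1 * p2 + g₁ * g₂ * q1 * q2 = 0 := by simpa using z2
    -- vectors (p1/g1, q1, 1), (p2/g1, q2, 0)
    by_cases hiso : (g₁ : F) * (p2 / g₁) ^ 2 + g₂ * q2 ^ 2 = 0
    · by_cases hpq : p2 = 0 ∧ q2 = 0
      · refine ⟨p1 / g₁, q1, 1, 0, 0, by simp, ?_⟩
        rw [hpq.1, hpq.2] at z1
        field_simp
        linear_combination z1
      · refine ⟨p2 / g₁, q2, 0, 0, 0, ?_, by linear_combination hiso⟩
        by_contra hcon
        push Not at hcon
        exact hpq ⟨by simpa [hg] using hcon.1, hcon.2.1⟩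
    · have hiso' : p2 ^ 2 + g₁ * g₂ * q2 ^ 2 ≠ 0 := by
        intro h0; apply hiso; field_simp; linear_combination h0
      set s : F := g₂ * h₁ * (p2 ^ 2 + g₁ * g₂ * q2 ^ 2) with hs
      have hs0 : s ≠ 0 := by simp [hs, hiso', hg2, hh1]
      refine ⟨g₂ * h₁ * (-q2), h₁ * p2, g₂ * (p1 * q2 - q1 * p2), s * X, s * Y, ?_, ?_⟩
      · by_contra hcon
        push Not at hcon
        have hX : X = 0 := by simpa [hs0] using hcon.2.2.2.1
        have hY : Y = 0 := by simpa [hs0] using hcon.2.2.2.2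
        rw [hX, hY] at ht
        exact ht0 (by simpa using ht)
      · have hd' : (d : F) = t * (g₁ * g₂ * h₁) := by simp [hd]
        rw [hd'] at z1
        apply mul_left_cancel₀ hg
        rw [hs]
        linear_combination (g₂ * h₁ : F) * (p2 ^ 2 + g₁ * g₂ * q2 ^ 2) * z1 - (g₂ * h₁ : F) * (p1 * p2 + g₁ * g₂ * q1 * q2) * z2' -
          (g₁ : F) * (g₂ * h₁ * (p2 ^ 2 + g₁ * g₂ * q2 ^ 2)) ^ 2 * ht
end core
end HM

open NumberField IsDedekindDomain
open scoped WithZero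
namespace HM
section dy
variable {F : Type*} [Field F] [NumberField F]

lemma exists_sqrt_res {v : HeightOneSpectrum (𝓞 F)} (hv : vl v 2 < 1) {a : F} (ha : vl v a ≤ 1) :
    ∃ s : F, vl v s ≤ 1 ∧ vl v (a - s ^ 2) < 1 := by
  classical
  have := Fintype.ofFinite (𝓞 F ⧸ v.asIdeal)
  obtain ⟨r, hr⟩ := exists_res v ha
  have h2 : ((2 : ℕ) : 𝓞 F ⧸ v.asIdeal) = 0 := by
    have : (Ideal.Quotient.mk v.asIdeal (2 : 𝓞 F)) = 0 := by
      rw [Ideal.Quotient.eq_zero_iff_mem, ← vl_lt_one_iff, map_ofNat (algebraMap (𝓞 F) F)]; exact hv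
    rw [map_ofNat] at this
    exact_mod_cast this
  have hc : ringChar (𝓞 F ⧸ v.asIdeal) = 2 := by
    have h3 : ringChar (𝓞 F ⧸ v.asIdeal) ∣ 2 := ringChar.dvd h2
    rcases (Nat.dvd_prime Nat.prime_two).mp h3 with h | h
    · exact absurd h (by
        intro h
        have : ((1 : ℕ) : 𝓞 F ⧸ v.asIdeal) = 0 := by rw [← h]; exact ringChar.Nat.cast_ringChar
        simp at this)
    · exact h
  obtain ⟨s, hs⟩ := FiniteField.isSquare_of_char_two hc (Ideal.Quotient.mk v.asIdeal r)
  obtain ⟨s, rfl⟩ := Ideal.Quotient.mk_surjective s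
  rw [← map_mul, Ideal.Quotient.eq, ← vl_lt_one_iff, map_sub, map_mul, ← sq] at hs
  refine ⟨algebraMap (𝓞 F) F s, vl_int_le v s, ?_⟩
  have := Valuation.map_add_lt (vl v) hr hs
  simpa using this

/-- scaled version -/
lemma exists_sqrt_scaled {v : HeightOneSpectrum (𝓞 F)} (hv : vl v 2 < 1) {E u : F} (hu : u ≠ 0) {z : F} (hz : z ≠ 0)
    (hE : vl v E ≤ vl v (u * z ^ 2)) :
    ∃ s : F, vl v s ≤ vl v z ∧ vl v (E - u * s ^ 2) < vl v (u * z ^ 2) := by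
  have hpos : 0 < vl v (u * z ^ 2) := by simp [zero_lt_iff, hu, hz]
  obtain ⟨s, hs, h⟩ := exists_sqrt_res hv (a := E / (u * z ^ 2)) (by rw [map_div₀, div_le_one₀ hpos]; exact hE)
  refine ⟨z * s, ?_, ?_⟩
  · rw [map_mul]; exact mul_le_of_le_one_right' hs
  · have e : E - u * (z * s) ^ 2 = (E / (u * z ^ 2) - s ^ 2) * (u * z ^ 2) := by field_simp
    rw [e, map_mul]
    exact mul_lt_of_lt_one_left hpos h

lemma lt_exp_iff {x : ℤᵐ⁰} {k : ℤ} : x < WithZero.exp k ↔ x ≤ WithZero.exp (k - 1) := by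
  by_cases hx : x = 0
  · subst hx; simp
  · obtain ⟨m, rfl⟩ : ∃ m, x = WithZero.exp m := ⟨_, (WithZero.exp_log hx).symm⟩
    rw [WithZero.exp_lt_exp, WithZero.exp_le_exp]; omega

lemma exists_vl (v : HeightOneSpectrum (𝓞 F)) (k : ℤ) : ∃ z : F, z ≠ 0 ∧ vl v z = WithZero.exp k := by
  obtain ⟨u, hu⟩ := exists_ord v (F := F) k
  exact ⟨u, u.ne_zero, by rw [vl_eq_exp, hu]⟩

lemma vl_two_exp (v : HeightOneSpectrum (𝓞 F)) : ∃ e : ℤ, vl v 2 = WithZero.exp (-e) ∧ vl v 4 = WithZero.exp (-(2 * e)) := by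
  refine ⟨- ord v (Units.mk0 (2 : F) two_ne_zero), ?_, ?_⟩
  · rw [neg_neg]; exact vl_eq_exp v (Units.mk0 (2 : F) two_ne_zero)
  · have : vl v 2 = WithZero.exp (ord v (Units.mk0 (2 : F) two_ne_zero)) := vl_eq_exp v (Units.mk0 (2 : F) two_ne_zero)
    rw [vl_four_eq, this, ← WithZero.exp_add]; congr 1; ring

lemma lemL {v : HeightOneSpectrum (𝓞 F)} (hv : vl v 2 < 1) {u c m : F} (hu : vl v u = 1)
    (hc : vl v c = WithZero.exp (-1)) (hm : vl v m < 1) :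
    ∃ X Y : F, vl v (m - u * X ^ 2 - c * Y ^ 2) < vl v 4 := by
  obtain ⟨e, he, he4⟩ := vl_two_exp v (F := F)
  have hu0 : u ≠ 0 := by rintro rfl; simp at hu
  have hc0 : c ≠ 0 := by rintro rfl; rw [map_zero] at hc; exact WithZero.exp_ne_zero hc.symm
  have key : ∀ k : ℕ, (k : ℤ) ≤ 2 * e → ∃ X Y : F, vl v X < 1 ∧ vl v Y ≤ 1 ∧
      vl v (m - u * X ^ 2 - c * Y ^ 2) ≤ WithZero.exp (-(k + 1 : ℤ)) := by
    intro k
    induction k with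
    | zero =>
      intro _
      refine ⟨0, 0, by simp, by simp, ?_⟩
      rw [← WithZero.exp_zero, lt_exp_iff] at hm
      simpa using hm
    | succ k ih =>
      intro hk
      push_cast at hk
      obtain ⟨X, Y, hX, hY, hE⟩ := ih (by omega)
      set E := m - u * X ^ 2 - c * Y ^ 2 with hEdef
      rw [← WithZero.exp_zero, lt_exp_iff] at hX
      rw [← WithZero.exp_zero] at hY
      rcases Nat.even_or_odd' k with ⟨j, hj | hj⟩
      · -- k + 1 odd : change Y
        obtain ⟨z, hz0, hz⟩ := exists_vl v (F := F) (-j)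
        have hcz : vl v (c * z ^ 2) = WithZero.exp (-(k + 1 : ℤ)) := by
          rw [map_mul, map_pow, hc, hz, ← WithZero.exp_nsmul, ← WithZero.exp_add]; congr 1; rw [hj]; simp
        obtain ⟨s, hs, hs'⟩ := exists_sqrt_scaled hv hc0 hz0 (E := E) (by rw [hcz]; exact hE)
        refine ⟨X, Y + s, ?_, ?_, ?_⟩
        · rw [← WithZero.exp_zero, lt_exp_iff]; exact hX
        · rw [← WithZero.exp_zero]
          refine Valuation.map_add_le _ hY (hs.trans ?_)
          rw [hz, WithZero.exp_le_exp]; omega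
        · rw [show m - u * X ^ 2 - c * (Y + s) ^ 2 = (E - c * s ^ 2) - 2 * (c * (Y * s)) by rw [hEdef]; ring]
          apply Valuation.map_sub_le
          · rw [hcz, lt_exp_iff] at hs'
            refine hs'.trans ?_
            rw [WithZero.exp_le_exp]; push_cast; omega
          · rw [map_mul, map_mul, map_mul, he, hc]
            calc _ ≤ WithZero.exp (-e) * (WithZero.exp (-1) * (WithZero.exp 0 * WithZero.exp (-j : ℤ))) := by
                  gcongr; exact hs.trans hz.le
              _ ≤ _ := by
                rw [← WithZero.exp_add, ← WithZero.exp_add, ← WithZero.exp_add, WithZero.exp_le_exp]; push_cast; omega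
      · obtain ⟨z, hz0, hz⟩ := exists_vl v (F := F) (-(j + 1))
        have huz : vl v (u * z ^ 2) = WithZero.exp (-(k + 1 : ℤ)) := by
          rw [map_mul, map_pow, hu, hz, ← WithZero.exp_nsmul, one_mul]; congr 1; rw [hj]; simp; ring
        obtain ⟨s, hs, hs'⟩ := exists_sqrt_scaled hv hu0 hz0 (E := E) (by rw [huz]; exact hE)
        refine ⟨X + s, Y, ?_, ?_, ?_⟩
        · rw [← WithZero.exp_zero, lt_exp_iff]
          refine Valuation.map_add_le _ hX (hs.trans ?_)
          rw [hz, WithZero.exp_le_exp]; omega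
        · rw [← WithZero.exp_zero]; exact hY
        · rw [show m - u * (X + s) ^ 2 - c * Y ^ 2 = (E - u * s ^ 2) - 2 * (u * (X * s)) by rw [hEdef]; ring]
          apply Valuation.map_sub_le
          · rw [huz, lt_exp_iff] at hs'
            refine hs'.trans ?_
            rw [WithZero.exp_le_exp]; push_cast; omega
          · rw [map_mul, map_mul, map_mul, he, hu, one_mul]
            calc _ ≤ WithZero.exp (-e) * (WithZero.exp (0 - 1) * WithZero.exp (-(j + 1) : ℤ)) := by
                  gcongr; exact hs.trans hz.le
              _ ≤ _ := by
                rw [← WithZero.exp_add, ← WithZero.exp_add, WithZero.exp_le_exp]; push_cast; omega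
  have he0 : 0 ≤ e := by
    rw [he, ← WithZero.exp_zero, WithZero.exp_lt_exp] at hv; omega
  obtain ⟨X, Y, _, _, h⟩ := key (2 * e).toNat (by omega)
  refine ⟨X, Y, ?_⟩
  rw [he4, lt_exp_iff]
  refine h.trans ?_
  rw [WithZero.exp_le_exp]; omega

lemma lemA {v : HeightOneSpectrum (𝓞 F)} (hv : vl v 2 < 1) {u₁ u₂ u₃ c : F} (h₁ : vl v u₁ = 1) (h₂ : vl v u₂ = 1)
    (h₃ : vl v u₃ = 1) (hc : vl v c = WithZero.exp (-1)) :
    ∃ a b X Y : F, vl v (u₁ * a ^ 2 + u₂ * b ^ 2 + u₃ * X ^ 2 + c * Y ^ 2) < vl v (4 * (u₁ * a ^ 2)) := by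
  have h0 : u₁ ≠ 0 := by rintro rfl; simp at h₁
  obtain ⟨s, hs, hs'⟩ := exists_sqrt_scaled hv (E := -u₂) h0 one_ne_zero (by simp [h₁, h₂, Valuation.map_neg])
  have hs1 : vl v (u₁ * s ^ 2) = 1 := by
    rw [one_pow, mul_one, h₁, Valuation.map_sub_swap, ← h₂, sub_neg_eq_add] at hs'
    have := Valuation.map_add_eq_of_lt_left (vl v) (x := -u₂) (y := u₁ * s ^ 2 + u₂) (by rw [Valuation.map_neg]; exact hs')
    rw [Valuation.map_neg, h₂] at this
    rw [← this]; congr 1; ring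
  obtain ⟨X, Y, h⟩ := lemL hv h₃ hc (m := -u₂ - u₁ * s ^ 2) (by simpa [h₁] using hs')
  refine ⟨s, 1, X, Y, ?_⟩
  rw [map_mul, hs1, mul_one]
  rw [← Valuation.map_neg] at h
  convert h using 2
  ring

/-- either odd value or close square -/
lemma lemB {v : HeightOneSpectrum (𝓞 F)} (hv : vl v 2 < 1) {u₁ u₂ : F} (h₁ : vl v u₁ = 1) (h₂ : vl v u₂ = 1) :
    ∃ x : F, vl v (u₁ * x ^ 2 + u₂) ≤ vl v 4 ∨ ∃ k : ℤ, vl v (u₁ * x ^ 2 + u₂) = WithZero.exp (2 * k + 1) := by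
  by_contra! hcon
  obtain ⟨e, he, he4⟩ := vl_two_exp v (F := F)
  have hu0 : u₁ ≠ 0 := by rintro rfl; simp at h₁
  have he0 : 0 ≤ e := by
    rw [he, ← WithZero.exp_zero, WithZero.exp_lt_exp] at hv; omega
  have key : ∀ k : ℕ, (k : ℤ) ≤ 2 * e → ∃ x : F, vl v x ≤ 1 ∧ vl v (u₁ * x ^ 2 + u₂) ≤ WithZero.exp (-k : ℤ) := by
    intro k
    induction k with
    | zero => 
      intro _
      exact ⟨0, by simp, by simp [h₂]⟩
    | succ k ih =>
      intro hk
      push_cast at hk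
      obtain ⟨x, hx, hE⟩ := ih (by omega)
      rcases hE.lt_or_eq with hlt | heq
      · refine ⟨x, hx, ?_⟩
        rw [lt_exp_iff] at hlt
        convert hlt using 2; push_cast; ring
      rcases Nat.even_or_odd' k with ⟨j, hj | hj⟩
      swap
      · exact absurd heq (by rw [show (-(k : ℤ)) = 2 * (-j - 1) + 1 by rw [hj]; push_cast; ring]; exact (hcon x).2 _)
      obtain ⟨z, hz0, hz⟩ := exists_vl v (F := F) (-j)
      have huz : vl v (u₁ * z ^ 2) = WithZero.exp (-k : ℤ) := by
        rw [map_mul, map_pow, h₁, hz, ← WithZero.exp_nsmul, one_mul]; congr 1; rw [hj]; simp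
      obtain ⟨s, hs, hs'⟩ := exists_sqrt_scaled hv hu0 hz0 (E := -(u₁ * x ^ 2 + u₂)) (by rw [huz, Valuation.map_neg]; exact hE)
      refine ⟨x + s, ?_, ?_⟩
      · refine Valuation.map_add_le _ hx (hs.trans ?_)
        rw [hz, ← WithZero.exp_zero, WithZero.exp_le_exp]; omega
      · rw [show u₁ * (x + s) ^ 2 + u₂ = 2 * (u₁ * (x * s)) - (-(u₁ * x ^ 2 + u₂) - u₁ * s ^ 2) by ring]
        apply Valuation.map_sub_le
        · rw [map_mul, map_mul, map_mul, he, h₁, one_mul]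
          calc _ ≤ WithZero.exp (-e) * (1 * WithZero.exp (-j : ℤ)) := by
                  gcongr; exact hs.trans hz.le
            _ ≤ _ := by
              rw [one_mul, ← WithZero.exp_add, WithZero.exp_le_exp]; push_cast; omega
        · rw [huz, lt_exp_iff] at hs'
          refine hs'.trans ?_
          rw [WithZero.exp_le_exp]; push_cast; omega
  obtain ⟨x, _, h⟩ := key (2 * e).toNat (by omega)
  refine absurd h (not_le.mpr ?_)
  have := (hcon x).1
  rw [he4] at this
  convert this using 3
  omega

end dy
end HM

open NumberField IsDedekindDomain
open scoped WithZero
namespace HM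
section dy
variable {F : Type*} [Field F] [NumberField F]

lemma scale_even {v : HeightOneSpectrum (𝓞 F)} {f g : Fˣ} (h : Even (ord v f - ord v g)) :
    ∃ y : F, y ≠ 0 ∧ vl v (f * y ^ 2 / g) = 1 := by
  obtain ⟨k, hk⟩ := h
  obtain ⟨y, hy⟩ := exists_ord v (F := F) (-k)
  refine ⟨y, y.ne_zero, ?_⟩
  have := vl_eq_exp v (f * y ^ 2 / g)
  rw [ord_div, ord_mul, ord_sq, hy] at this
  push_cast at this
  rw [this, ← WithZero.exp_zero]; congr 1; omega

lemma scale_odd {v : HeightOneSpectrum (𝓞 F)} {f g : Fˣ} (h : Odd (ord v f - ord v g)) :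
    ∃ y : F, y ≠ 0 ∧ vl v (f * y ^ 2 / g) = WithZero.exp (-1) := by
  obtain ⟨k, hk⟩ := h
  obtain ⟨y, hy⟩ := exists_ord v (F := F) (-k - 1)
  refine ⟨y, y.ne_zero, ?_⟩
  have := vl_eq_exp v (f * y ^ 2 / g)
  rw [ord_div, ord_mul, ord_sq, hy] at this
  push_cast at this
  rw [this]; congr 1; omega

lemma lemA' {v : HeightOneSpectrum (𝓞 F)} (hv : vl v 2 < 1) {f₁ f₂ f₃ f₄ : Fˣ} (h₂ : Even (ord v f₂ - ord v f₁))
    (h₃ : Even (ord v f₃ - ord v f₁)) (h₄ : Odd (ord v f₄ - ord v f₁)) :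
    ∃ a b X Y : F, vl v (f₁ * a ^ 2 + f₂ * b ^ 2 + f₃ * X ^ 2 + f₄ * Y ^ 2) < vl v (4 * (f₁ * a ^ 2)) := by
  obtain ⟨y₂, _, g₂⟩ := scale_even h₂
  obtain ⟨y₃, _, g₃⟩ := scale_even h₃
  obtain ⟨y₄, _, g₄⟩ := scale_odd h₄
  obtain ⟨a, b, X, Y, h⟩ := lemA hv (map_one (vl v)) g₂ g₃ g₄
  have h0 := f₁.ne_zero
  refine ⟨a, y₂ * b, y₃ * X, y₄ * Y, ?_⟩
  have h1 := mul_lt_mul_of_pos_left h (show 0 < vl v (f₁ : F) by simp [zero_lt_iff])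
  rw [← map_mul, ← map_mul] at h1
  convert h1 using 2
  · field_simp
  · ring

lemma lemB' {v : HeightOneSpectrum (𝓞 F)} (hv : vl v 2 < 1) {f₁ f₂ f₃ f₄ f₅ : Fˣ} (h₂ : Even (ord v f₂ - ord v f₁))
    (h₃ : Even (ord v f₃ - ord v f₁)) (h₄ : Even (ord v f₄ - ord v f₁)) (h₅ : Even (ord v f₅ - ord v f₁)) :
    ∃ a b c d e : F, vl v (f₁ * a ^ 2 + f₂ * b ^ 2 + f₃ * c ^ 2 + f₄ * d ^ 2 + f₅ * e ^ 2) < vl v (4 * (f₂ * b ^ 2)) ∨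
      vl v (f₁ * a ^ 2 + f₂ * b ^ 2 + f₃ * c ^ 2 + f₄ * d ^ 2 + f₅ * e ^ 2) < vl v (4 * (f₃ * c ^ 2)) := by
  obtain ⟨y₂, hy₂, g₂⟩ := scale_even h₂
  obtain ⟨y₃, hy₃, g₃⟩ := scale_even h₃
  have h0 := f₁.ne_zero
  have h00 : 0 < vl v (f₁ : F) := by simp [zero_lt_iff]
  obtain ⟨x, hx | ⟨k, hk⟩⟩ := lemB hv (map_one (vl v)) g₂
  · obtain ⟨s, hs, hs'⟩ := exists_sqrt_scaled hv (E := -(1 * x ^ 2 + f₂ * y₂ ^ 2 / f₁)) (u := f₃ * y₃ ^ 2 / f₁)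
      (by simp [hy₃]) two_ne_zero (by
        rw [map_mul _ _ ((2 : F) ^ 2), g₃, one_mul, Valuation.map_neg]; norm_num; simpa using hx)
    refine ⟨x, y₂, y₃ * s, 0, 0, Or.inl ?_⟩
    rw [map_mul _ _ ((2 : F) ^ 2), g₃, one_mul, one_mul, show (2 : F) ^ 2 = 4 by norm_num] at hs'
    replace hs' := hs'.trans_eq (show vl v 4 = vl v (4 * (f₂ * y₂ ^ 2 / f₁)) by rw [map_mul _ (4 : F), g₂, mul_one])
    have h1 := mul_lt_mul_of_pos_left hs' h00
    rw [← map_mul, ← map_mul, ← Valuation.map_neg] at h1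
    convert h1 using 2
    · field_simp; ring
    · field_simp
  · set w : F := f₁ * x ^ 2 + f₂ * y₂ ^ 2 with hw
    have hw1 : w = f₁ * (1 * x ^ 2 + f₂ * y₂ ^ 2 / f₁) := by rw [hw]; field_simp
    have hw2 : vl v w = WithZero.exp (ord v f₁ + (2 * k + 1)) := by
      rw [hw1, map_mul, hk, vl_eq_exp, ← WithZero.exp_add]
    have hw0 : w ≠ 0 := by
      intro h; rw [h, map_zero] at hw2; exact WithZero.exp_ne_zero hw2.symm
    have hwo : ord v (Units.mk0 w hw0) = ord v f₁ + (2 * k + 1) := by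
      have := vl_eq_exp v (Units.mk0 w hw0)
      rw [Units.val_mk0, hw2, WithZero.exp_inj] at this; exact this.symm
    obtain ⟨a, b, X, Y, h⟩ := lemA' hv (f₁ := f₃) (f₂ := f₄) (f₃ := f₅) (f₄ := Units.mk0 w hw0)
      (by rw [← sub_sub_sub_cancel_right _ _ (ord v f₁)]; exact h₄.sub h₃) (by rw [← sub_sub_sub_cancel_right _ _ (ord v f₁)]; exact h₅.sub h₃)
      (by
        rw [hwo]
        obtain ⟨j, hj⟩ := h₃
        exact ⟨k - j, by omega⟩)
    refine ⟨x * Y, y₂ * Y, a, b, X, Or.inr ?_⟩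
    convert h using 2
    rw [Units.val_mk0, hw]; ring

lemma sum_extend {n : ℕ} (c : Fin 6 → F) {e : Fin n → Fin 6} (he : Function.Injective e) (y : Fin n → F) :
    ∑ i, c i * (Function.extend e y 0 i) ^ 2 = ∑ k, c (e k) * y k ^ 2 := by
  classical
  have h1 : ∑ k, c (e k) * y k ^ 2 = ∑ i ∈ Finset.univ.map ⟨e, he⟩, c i * (Function.extend e y 0 i) ^ 2 := by
    rw [Finset.sum_map]
    refine Finset.sum_congr rfl fun k _ => ?_
    simp [he.extend_apply]
  rw [h1]
  symm
  apply Finset.sum_subset (Finset.subset_univ _)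
  intro i _ hi
  have : ¬ ∃ k, e k = i := by
    rintro ⟨k, rfl⟩; exact hi (by simp)
  rw [Function.extend_apply' _ _ _ this]; simp

theorem dyadic_local {v : HeightOneSpectrum (𝓞 F)} (hv : vl v 2 < 1) (c : Fin 6 → Fˣ) :
    ∃ x : Fin 6 → F, ∃ i, vl v (∑ j, c j * x j ^ 2) < vl v (4 * (c i * x i ^ 2)) := by
  classical
  -- the mixed case
  have mixed : ∀ i j k l : Fin 6, i ≠ j → i ≠ k → j ≠ k → Even (ord v (c j) - ord v (c i)) →
      Even (ord v (c k) - ord v (c i)) → Odd (ord v (c l) - ord v (c i)) →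
      ∃ x : Fin 6 → F, ∃ i, vl v (∑ j, c j * x j ^ 2) < vl v (4 * (c i * x i ^ 2)) := by
    intro i j k l hij hik hjk h2 h3 h4
    have hil : i ≠ l := by rintro rfl; simp at h4
    have hjl : j ≠ l := by rintro rfl; exact (Int.not_even_iff_odd.mpr h4) h2
    have hkl : k ≠ l := by rintro rfl; exact (Int.not_even_iff_odd.mpr h4) h3
    obtain ⟨a, b, X, Y, h⟩ := lemA' hv h2 h3 h4
    have he : Function.Injective ![i, j, k, l] := by
      intro p q hpq
      fin_cases p <;> fin_cases q <;> simp_all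
    refine ⟨Function.extend ![i, j, k, l] ![a, b, X, Y] 0, i, ?_⟩
    rw [sum_extend (fun i => (c i : F)) he]
    have := he.extend_apply ![a, b, X, Y] 0 0
    simp only [Matrix.cons_val_zero] at this
    rw [this]
    simpa [Fin.sum_univ_four] using h
  set s := Finset.univ.filter (fun i : Fin 6 => Even (ord v (c i))) with hs
  set t := Finset.univ.filter (fun i : Fin 6 => ¬ Even (ord v (c i))) with ht
  have hst : s.card + t.card = 6 := by
    have := Finset.card_filter_add_card_filter_not (s := (Finset.univ : Finset (Fin 6))) (fun i : Fin 6 => Even (ord v (c i)))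
    rw [hs, ht, this]; simp
  by_cases hall : ∀ i, Even (ord v (c i) - ord v (c 0))
  · obtain ⟨a, b, X, d, e, h⟩ := lemB' hv (hall 1) (hall 2) (hall 3) (hall 4)
    refine ⟨![a, b, X, d, e, 0], ?_⟩
    rcases h with h | h
    · refine ⟨1, ?_⟩
      simpa [Fin.sum_univ_six] using h
    · refine ⟨2, ?_⟩
      simpa [Fin.sum_univ_six] using h
  · push Not at hall
    obtain ⟨l, hl⟩ := hall
    rw [Int.even_sub] at hl
    have hsn : s.Nonempty := by
      by_cases h : Even (ord v (c 0))
      · exact ⟨0, by simp [hs, h]⟩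
      · exact ⟨l, by simp [hs]; tauto⟩
    have htn : t.Nonempty := by
      by_cases h : Even (ord v (c 0))
      · refine ⟨l, ?_⟩
        simp only [ht, Finset.mem_filter, Finset.mem_univ, true_and]; tauto
      · refine ⟨0, ?_⟩
        simp only [ht, Finset.mem_filter, Finset.mem_univ, true_and]; tauto
    rcases (by omega : 2 < s.card ∨ 2 < t.card) with h | h
    · obtain ⟨i, hi, j, hj, k, hk, hij, hik, hjk⟩ := Finset.two_lt_card.mp h
      obtain ⟨l, hl⟩ := htn
      simp only [hs, ht, Finset.mem_filter, Finset.mem_univ, true_and] at hi hj hk hl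
      exact mixed i j k l hij hik hjk (hj.sub hi) (hk.sub hi) ((Int.not_even_iff_odd.mp hl).sub_even hi)
    · obtain ⟨i, hi, j, hj, k, hk, hij, hik, hjk⟩ := Finset.two_lt_card.mp h
      obtain ⟨l, hl⟩ := hsn
      simp only [hs, ht, Finset.mem_filter, Finset.mem_univ, true_and] at hi hj hk hl
      rw [Int.not_even_iff_odd] at hi hj hk
      exact mixed i j k l hij hik hjk (hj.sub_odd hi) (hk.sub_odd hi) (hl.sub_odd hi)
end dy
end HM

open NumberField IsDedekindDomain
open scoped WithZero
namespace HM
section cont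
variable {F : Type*} [Field F] [NumberField F] {ι : Type*}

/-- elementary continuity of a function of several variables at a point, for the `v`-adic topology -/
def Cont (v : HeightOneSpectrum (𝓞 F)) (f : (ι → F) → F) (a : ι → F) : Prop :=
  ∀ ε : ℤᵐ⁰, ε ≠ 0 → ∃ γ : ℤᵐ⁰, γ ≠ 0 ∧ ∀ x : ι → F, (∀ i, vl v (x i - a i) < γ) → vl v (f x - f a) < ε

variable {v : HeightOneSpectrum (𝓞 F)} {a : ι → F}

lemma Cont.const (c : F) : Cont v (fun _ : ι → F => c) a := by
  intro ε hε
  exact ⟨1, one_ne_zero, fun x _ => by simpa [zero_lt_iff] using hε⟩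

lemma Cont.coord (i : ι) : Cont v (fun x : ι → F => x i) a :=
  fun ε hε => ⟨ε, hε, fun _ hx => hx i⟩

lemma Cont.add {f g : (ι → F) → F} (hf : Cont v f a) (hg : Cont v g a) :
    Cont v (fun x => f x + g x) a := by
  intro ε hε
  obtain ⟨γ, h0, h⟩ := hf ε hε
  obtain ⟨γ', h0', h'⟩ := hg ε hε
  refine ⟨min γ γ', by rcases min_choice γ γ' with e | e <;> rw [e] <;> assumption, fun x hx => ?_⟩
  have e : f x + g x - (f a + g a) = (f x - f a) + (g x - g a) := by ring
  rw [e]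
  exact Valuation.map_add_lt _ (h x fun i => (hx i).trans_le (min_le_left _ _))
    (h' x fun i => (hx i).trans_le (min_le_right _ _))

lemma Cont.mul {f g : (ι → F) → F} (hf : Cont v f a) (hg : Cont v g a) :
    Cont v (fun x => f x * g x) a := by
  intro ε hε
  set M : ℤᵐ⁰ := max 1 (max (vl v (f a)) (vl v (g a))) with hM
  have hM0 : 0 < M := zero_lt_one.trans_le (le_max_left _ _)
  have hd : ε / M ≠ 0 := div_ne_zero hε hM0.ne'
  have hδ0 : min 1 (ε / M) ≠ 0 := by
    rcases min_choice 1 (ε / M) with e | e <;> rw [e]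
    · exact one_ne_zero
    · exact hd
  obtain ⟨γ, h0, h⟩ := hf _ hδ0
  obtain ⟨γ', h0', h'⟩ := hg _ hδ0
  refine ⟨min γ γ', by rcases min_choice γ γ' with e | e <;> rw [e] <;> assumption, fun x hx => ?_⟩
  have hA := h x fun i => (hx i).trans_le (min_le_left _ _)
  have hB := h' x fun i => (hx i).trans_le (min_le_right _ _)
  have hA' : vl v (f x - f a) * M < ε := (lt_div_iff₀ hM0).mp (hA.trans_le (min_le_right _ _))
  have hB' : vl v (g x - g a) * M < ε := (lt_div_iff₀ hM0).mp (hB.trans_le (min_le_right _ _))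
  have e : f x * g x - f a * g a = (f x - f a) * (g x - g a) + ((f x - f a) * g a + (g x - g a) * f a) := by ring
  rw [e]
  refine Valuation.map_add_lt _ ?_ (Valuation.map_add_lt _ ?_ ?_)
  · rw [map_mul]
    refine lt_of_le_of_lt ?_ hA'
    gcongr
    exact (hB.le.trans (min_le_left _ _)).trans (le_max_left _ _)
  · rw [map_mul]
    refine lt_of_le_of_lt ?_ hA'
    gcongr
    exact (le_max_right _ _).trans (le_max_right _ _)
  · rw [map_mul]
    refine lt_of_le_of_lt ?_ hB'
    gcongr
    exact (le_max_left _ _).trans (le_max_right _ _)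

lemma Cont.sum {κ : Type*} (s : Finset κ) {f : κ → (ι → F) → F} (hf : ∀ k, Cont v (f k) a) :
    Cont v (fun x => ∑ k ∈ s, f k x) a := by
  classical
  induction s using Finset.induction_on with
  | empty => simpa using Cont.const 0
  | insert k s hk ih =>
    simp only [Finset.sum_insert hk]
    exact (hf k).add ih

lemma Cont.lt {f g : (ι → F) → F} (hf : Cont v f a) (hg : Cont v g a) (h : vl v (f a) < vl v (g a)) :
    ∃ γ : ℤᵐ⁰, γ ≠ 0 ∧ ∀ x : ι → F, (∀ i, vl v (x i - a i) < γ) → vl v (f x) < vl v (g x) := by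
  have hg0 : vl v (g a) ≠ 0 := (zero_le.trans_lt h).ne'
  obtain ⟨γ, h0, h1⟩ := hf _ hg0
  obtain ⟨γ', h0', h1'⟩ := hg _ hg0
  refine ⟨min γ γ', by rcases min_choice γ γ' with e | e <;> rw [e] <;> assumption, fun x hx => ?_⟩
  have hA := h1 x fun i => (hx i).trans_le (min_le_left _ _)
  have hB := h1' x fun i => (hx i).trans_le (min_le_right _ _)
  have e1 : vl v (g x) = vl v (g a) := by
    have := Valuation.map_add_eq_of_lt_left (vl v) hB
    simpa using this
  rw [e1]
  have := Valuation.map_add_lt (vl v) hA h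
  simpa using this
end cont

section real
variable {F : Type*} [Field F] [NumberField F]

lemma real_approx (t : (F →+* ℝ) → F) {ε : ℝ} (hε : 0 < ε) :
    ∃ z : F, ∀ σ : F →+* ℝ, |σ z - σ (t σ)| < ε := by
  classical
  let pl : (F →+* ℝ) → InfinitePlace F := fun σ => InfinitePlace.mk (Complex.ofRealHom.comp σ)
  have hinj : Function.Injective pl := by
    intro σ τ h
    have h' := InfinitePlace.mk_eq_iff.mp h
    have hc : ComplexEmbedding.conjugate (Complex.ofRealHom.comp σ) = Complex.ofRealHom.comp σ := by
      ext x; simp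
    rw [hc, or_self] at h'
    ext x
    have := RingHom.congr_fun h' x
    simpa using this
  have hd := InfinitePlace.denseRange_algebraMap_pi F
  rw [Metric.denseRange_iff] at hd
  obtain ⟨z, hz⟩ := hd (fun v => WithAbs.toAbs v.1 (Function.extend pl t 0 v)) ε hε
  refine ⟨z, fun σ => ?_⟩
  have h1 := (dist_le_pi_dist _ _ (pl σ)).trans_lt hz
  rw [dist_comm, dist_eq_norm] at h1
  have h2 : Function.extend pl t 0 (pl σ) = t σ := hinj.extend_apply _ _ _
  rw [h2] at h1
  have h3 : algebraMap F ((v : InfinitePlace F) → WithAbs v.1) z (pl σ) = WithAbs.toAbs (pl σ).1 z := rfl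
  rw [h3, ← WithAbs.toAbs_sub, WithAbs.norm_toAbs_eq] at h1
  have h4 : (pl σ).1 (z - t σ) = |σ z - σ (t σ)| := by
    have : (pl σ) (z - t σ) = _ := InfinitePlace.apply (Complex.ofRealHom.comp σ) (z - t σ)
    rw [← map_sub]
    change (pl σ) (z - t σ) = _
    rw [this, RingHom.comp_apply, Complex.ofRealHom_eq_coe, Complex.norm_real, Real.norm_eq_abs]
  rwa [h4] at h1

open Filter Topology in
lemma mixed_approx (S : Finset (HeightOneSpectrum (𝓞 F))) (hS : ∀ v ∈ S, vl v (2 : F) < 1)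
    (a : HeightOneSpectrum (𝓞 F) → F) (γ : HeightOneSpectrum (𝓞 F) → ℤᵐ⁰) (hγ : ∀ v, γ v ≠ 0)
    (t : (F →+* ℝ) → F) {ε : ℝ} (hε : 0 < ε) :
    ∃ w : F, (∀ v ∈ S, vl v (w - a v) < γ v) ∧ ∀ σ : F →+* ℝ, |σ w - σ (t σ)| < ε := by
  obtain ⟨f, hf⟩ := weak_approx S a γ hγ
  obtain ⟨z, hz⟩ := real_approx (fun σ => t σ - f) (half_pos hε)
  haveI := (card_realEmb F).1
  have hv : ∀ᶠ N : ℕ in atTop, ∀ v ∈ S, vl v (2 ^ N * z) < γ v := by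
    rw [eventually_all_finset]
    intro v hv
    by_cases hz0 : z = 0
    · simp [hz0, zero_lt_iff, hγ v]
    have hz1 : 0 < vl v z := by simp [zero_lt_iff, hz0]
    have hu : γ v / vl v z ≠ 0 := div_ne_zero (hγ v) hz1.ne'
    obtain ⟨n, hn⟩ := exists_pow_lt₀ (hS v hv) (Units.mk0 _ hu)
    filter_upwards [eventually_ge_atTop n] with N hN
    rw [map_mul, map_pow, ← lt_div_iff₀ hz1]
    exact lt_of_le_of_lt (pow_le_pow_of_le_one zero_le (hS v hv).le hN) hn
  have hr : ∀ᶠ N : ℕ in atTop, ∀ σ : F →+* ℝ, |σ z| / (1 + 2 ^ N) < ε / 2 := by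
    rw [eventually_all]
    intro σ
    have h1 : Tendsto (fun N : ℕ => |σ z| / (1 + (2 : ℝ) ^ N)) atTop (𝓝 0) :=
      Tendsto.const_div_atTop (tendsto_atTop_add_const_left _ _ (tendsto_pow_atTop_atTop_of_one_lt one_lt_two)) _
    exact h1.eventually_lt_const (half_pos hε)
  obtain ⟨N, hN1, hN2, hN3⟩ := (hv.and (hr.and (eventually_ge_atTop 1))).exists
  refine ⟨f + 2 ^ N * z / (1 + 2 ^ N), fun v hv => ?_, fun σ => ?_⟩
  · have h1 : vl v (1 + 2 ^ N : F) = 1 := by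
      apply Valuation.map_one_add_of_lt
      rw [map_pow]
      exact pow_lt_one₀ zero_le (hS v hv) (by omega)
    have e : f + 2 ^ N * z / (1 + 2 ^ N) - a v = (f - a v) + 2 ^ N * z / (1 + 2 ^ N) := by ring
    rw [e]
    refine Valuation.map_add_lt _ (hf v hv) ?_
    rw [map_div₀, h1, div_one]; exact hN1 v hv
  · have hp : (0 : ℝ) < 1 + 2 ^ N := by positivity
    have e : σ (f + 2 ^ N * z / (1 + 2 ^ N)) - σ (t σ) = (σ z - σ (t σ - f)) - σ z / (1 + 2 ^ N) := by
      simp only [map_add, map_div₀, map_mul, map_pow, map_ofNat, map_one, map_sub]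
      field_simp
      ring
    rw [e]
    have h1 := abs_sub (σ z - σ (t σ - f)) (σ z / (1 + 2 ^ N))
    have h2 := hz σ
    have h3 := hN2 σ
    rw [abs_div, abs_of_pos hp] at h1
    linarith

end real
end HM

open NumberField IsDedekindDomain
open scoped WithZero
namespace HM

open Filter Topology in
lemma sign_near (c : Fin 6 → ℝ) (i : Fin 6) (h : 0 < c i) :
    ∀ᶠ ε : ℝ in 𝓝[>] 0, ∀ z : Fin 6 → ℝ, (∀ k, |z k - (Pi.single i 1 : Fin 6 → ℝ) k| < ε) →
      0 < ∑ k, c k * z k ^ 2 := by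
  have hc : Continuous fun z : Fin 6 → ℝ => ∑ k, c k * z k ^ 2 := by fun_prop
  have h1 : ∀ᶠ z in 𝓝 (Pi.single i 1 : Fin 6 → ℝ), 0 < ∑ k, c k * z k ^ 2 := by
    apply hc.continuousAt.eventually_const_lt
    simpa [Pi.single_apply] using h
  obtain ⟨δ, hδ, h2⟩ := Metric.eventually_nhds_iff.mp h1
  filter_upwards [Ioo_mem_nhdsGT hδ] with ε hε z hz
  apply h2
  rw [dist_pi_lt_iff hδ]
  intro k
  rw [Real.dist_eq]
  exact (hz k).trans hε.2

section fin
variable {F : Type*} [Field F] [NumberField F]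

lemma exists_dyadic (F : Type*) [Field F] [NumberField F] :
    ∃ v : HeightOneSpectrum (𝓞 F), vl v (2 : F) < 1 := by
  have hu : ¬ IsUnit (2 : 𝓞 F) := by
    intro h
    obtain ⟨u, hu⟩ := h.exists_left_inv
    have h1 : IsIntegral ℤ (algebraMap ℚ F (1 / 2)) := by
      have e : (algebraMap ℚ F (1 / 2)) = (u : F) := by
        have := congrArg (algebraMap (𝓞 F) F) hu
        simp only [map_mul, map_ofNat, map_one] at this
        have h2 : (algebraMap ℚ F (1 / 2)) = 1 / 2 := by simp
        rw [h2, ← this]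
        field_simp
      rw [e]
      exact u.isIntegral_coe
    rw [isIntegral_algebraMap_iff (algebraMap ℚ F).injective] at h1
    obtain ⟨n, hn⟩ := IsIntegrallyClosed.isIntegral_iff.mp h1
    have h3 : ((2 * n : ℤ) : ℚ) = (1 : ℤ) := by
      push_cast
      have : (n : ℚ) = 1 / 2 := by simpa using hn
      rw [this]; norm_num
    have h4 : 2 * n = 1 := by exact_mod_cast h3
    omega
  obtain ⟨m, hm, h2⟩ := exists_max_ideal_of_mem_nonunits hu
  have hne : m ≠ ⊥ := by
    rintro rfl
    simp at h2
  refine ⟨⟨m, hm.isPrime, hne⟩, ?_⟩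
  have := (vl_lt_one_iff ⟨m, hm.isPrime, hne⟩ (2 : 𝓞 F)).mpr h2
  rwa [map_ofNat (algebraMap (𝓞 F) F)] at this

open Filter Topology in
lemma choose_xy (c : Fin 6 → Fˣ) (hp : ∀ σ : F →+* ℝ, ∃ i, 0 < σ (c i))
    (hn : ∀ σ : F →+* ℝ, ∃ i, σ (c i) < 0) :
    ∃ x y : Fin 6 → F,
      (∀ v : HeightOneSpectrum (𝓞 F), vl v (2 : F) < 1 →
        vl v ((∑ k, c k * x k * x k) * (∑ k, c k * y k * y k)) < vl v (4 * (∑ k, c k * x k * y k) ^ 2)) ∧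
      ∀ σ : F →+* ℝ, 0 < σ (∑ k, c k * x k * x k) ∧ σ (∑ k, c k * y k * y k) < 0 := by
  classical
  choose ip hip using hp
  choose iq hiq using hn
  haveI := (card_realEmb F).1
  have hε : ∀ᶠ ε : ℝ in 𝓝[>] 0, ∀ σ : F →+* ℝ,
      (∀ z : Fin 6 → ℝ, (∀ k, |z k - (Pi.single (ip σ) 1 : Fin 6 → ℝ) k| < ε) →
        0 < ∑ k, σ (c k) * z k ^ 2) ∧
      (∀ z : Fin 6 → ℝ, (∀ k, |z k - (Pi.single (iq σ) 1 : Fin 6 → ℝ) k| < ε) →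
        0 < ∑ k, (-σ (c k)) * z k ^ 2) := by
    rw [eventually_all]
    intro σ
    exact (sign_near (fun k => σ (c k)) (ip σ) (hip σ)).and
      (sign_near (fun k => -σ (c k)) (iq σ) (by simpa using hiq σ))
  obtain ⟨ε, hε1, hε0⟩ := (hε.and self_mem_nhdsWithin).exists
  have hε0 : 0 < ε := hε0
  -- dyadic targets
  have hdy : ∀ v : HeightOneSpectrum (𝓞 F), ∃ a : Fin 6 ⊕ Fin 6 → F, ∃ γ : ℤᵐ⁰, γ ≠ 0 ∧
      (vl v (2 : F) < 1 → ∀ w : Fin 6 ⊕ Fin 6 → F, (∀ i, vl v (w i - a i) < γ) →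
        vl v ((∑ k, c k * w (.inl k) * w (.inl k)) * (∑ k, c k * w (.inr k) * w (.inr k))) <
          vl v (4 * (∑ k, c k * w (.inl k) * w (.inr k)) ^ 2)) := by
    intro v
    by_cases hv : vl v (2 : F) < 1
    · obtain ⟨x, i, h⟩ := dyadic_local hv c
      have cont : ∀ (a : Fin 6 ⊕ Fin 6 → F) (f g : Fin 6 → Fin 6 ⊕ Fin 6),
          Cont v (fun w => ∑ k, c k * w (f k) * w (g k)) a := fun a f g =>
        Cont.sum _ fun k => ((Cont.const _).mul (Cont.coord _)).mul (Cont.coord _)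
      have c1 := (cont (Sum.elim x (Pi.single i 1)) Sum.inl Sum.inl).mul
        (cont (Sum.elim x (Pi.single i 1)) Sum.inr Sum.inr)
      have c3 := cont (Sum.elim x (Pi.single i 1)) Sum.inl Sum.inr
      have c2 := (Cont.const (v := v) (a := Sum.elim x (Pi.single i 1)) (4 : F)).mul (c3.mul c3)
      obtain ⟨γ, h0, hγ⟩ := c1.lt c2 (by
        have e1 : ∑ k, (c k : F) * x k * x k = ∑ k, (c k : F) * x k ^ 2 :=
          Finset.sum_congr rfl fun k _ => by ring
        have e2 : ∑ k, (c k : F) * (Pi.single i 1 : Fin 6 → F) k * (Pi.single i 1 : Fin 6 → F) k = c i := by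
          simp [Pi.single_apply]
        have e3 : ∑ k, (c k : F) * x k * (Pi.single i 1 : Fin 6 → F) k = c i * x i := by
          simp [Pi.single_apply]
        simp only [Sum.elim_inl, Sum.elim_inr]
        rw [e1, e2, e3, map_mul]
        have e4 : (4 : F) * (c i * x i * (c i * x i)) = (4 * (c i * x i ^ 2)) * c i := by ring
        rw [e4, map_mul (vl v) (4 * _)]
        exact mul_lt_mul_of_pos_right h (by simp [zero_lt_iff]))
      refine ⟨Sum.elim x (Pi.single i 1), γ, h0, fun _ w hw => ?_⟩
      have := hγ w hw
      rwa [← pow_two] at this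
    · exact ⟨0, 1, one_ne_zero, fun h => absurd h hv⟩
  choose a γ hγ0 hγ using hdy
  let S := (finite_dyadic F).toFinset
  have hS : ∀ v, v ∈ S ↔ vl v (2 : F) < 1 := fun v => by simp [S]
  have hw : ∀ i : Fin 6 ⊕ Fin 6, ∃ w : F, (∀ v ∈ S, vl v (w - a v i) < γ v) ∧
      ∀ σ : F →+* ℝ, |σ w - σ (Sum.elim (Pi.single (ip σ) 1) (Pi.single (iq σ) 1) i : F)| < ε := fun i =>
    mixed_approx S (fun v => (hS v).mp) (fun v => a v i) γ hγ0 _ hε0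
  choose w hw1 hw2 using hw
  refine ⟨fun k => w (.inl k), fun k => w (.inr k), fun v hv => ?_, fun σ => ⟨?_, ?_⟩⟩
  · exact hγ v hv w fun i => hw1 i v ((hS v).mpr hv)
  · have := (hε1 σ).1 (fun k => σ (w (.inl k))) (fun k => by
      have := hw2 (.inl k) σ
      simp only [Sum.elim_inl] at this
      convert this using 3
      simp only [Pi.single_apply]
      split_ifs <;> simp)
    rw [map_sum]
    convert this using 2 with k
    simp only [map_mul]; ring
  · have := (hε1 σ).2 (fun k => σ (w (.inr k))) (fun k => by
      have := hw2 (.inr k) σ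
      simp only [Sum.elim_inr] at this
      convert this using 3
      simp only [Pi.single_apply]
      split_ifs <;> simp)
    rw [map_sum]
    simp only [neg_mul, Finset.sum_neg_distrib] at this
    have e : ∑ k, σ (c k * w (.inr k) * w (.inr k)) = ∑ k, σ (c k) * σ (w (.inr k)) ^ 2 :=
      Finset.sum_congr rfl fun k _ => by simp only [map_mul]; ring
    rw [e]; linarith

/-- the bilinear form -/
def Bf (c : Fin 6 → F) : (Fin 6 → F) →ₗ[F] (Fin 6 → F) →ₗ[F] F :=
  LinearMap.mk₂ F (fun x y => ∑ k, c k * x k * y k)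
    (fun x x' y => by simp [mul_add, add_mul, Finset.sum_add_distrib])
    (fun r x y => by simp only [Pi.smul_apply, smul_eq_mul, Finset.mul_sum]; exact Finset.sum_congr rfl fun k _ => by ring)
    (fun x x' y => by simp [mul_add, Finset.sum_add_distrib])
    (fun r x y => by simp only [Pi.smul_apply, smul_eq_mul, Finset.mul_sum]; exact Finset.sum_congr rfl fun k _ => by ring)

lemma Bf_apply (c x y : Fin 6 → F) : Bf c x y = ∑ k, c k * x k * y k := rfl
lemma Bf_comm (c x y : Fin 6 → F) : Bf c x y = Bf c y x := by
  rw [Bf_apply, Bf_apply]; exact Finset.sum_congr rfl fun k _ => by ring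

lemma exists_orth (c : Fin 6 → F) {k : ℕ} (hk : k < 6) (w : Fin k → Fin 6 → F) :
    ∃ z : Fin 6 → F, z ≠ 0 ∧ ∀ j, Bf c (w j) z = 0 := by
  have h := LinearMap.ker_ne_bot_of_finrank_lt (f := LinearMap.pi fun j => Bf c (w j)) (by simpa using hk)
  obtain ⟨z, hz, h0⟩ := Submodule.exists_mem_ne_zero_of_ne_bot h
  refine ⟨z, h0, fun j => ?_⟩
  have := congrFun (LinearMap.mem_ker.mp hz) j
  simpa using this

theorem main6 (c : Fin 6 → Fˣ) (hp : ∀ σ : F →+* ℝ, ∃ i, 0 < σ (c i))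
    (hn : ∀ σ : F →+* ℝ, ∃ i, σ (c i) < 0) :
    ∃ x : Fin 6 → F, x ≠ 0 ∧ Bf (fun k => (c k : F)) x x = 0 := by
  by_contra! hani
  set B := Bf (fun k => (c k : F)) with hB
  obtain ⟨x, y, hdy, hre⟩ := choose_xy c hp hn
  have hdy : ∀ v : HeightOneSpectrum (𝓞 F), vl v (2 : F) < 1 →
    vl v (B x x * B y y) < vl v (4 * (B x y) ^ 2) := hdy
  have hre : ∀ σ : F →+* ℝ, 0 < σ (B x x) ∧ σ (B y y) < 0 := hre
  -- consequences of the dyadic inequality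
  have hsq : ∀ v : HeightOneSpectrum (𝓞 F), vl v (2 : F) < 1 →
      B x y ≠ 0 ∧ vl v ((B x y) ^ 2 - B x x * B y y) = vl v ((B x y) ^ 2) := by
    intro v hv
    have h := hdy v hv
    constructor
    · intro h0
      rw [h0] at h
      simp at h
    · have h1 : vl v (B x x * B y y) < vl v ((B x y) ^ 2) := by
        refine h.trans_le ?_
        rw [map_mul]
        exact mul_le_of_le_one_left' (vl_four_le v)
      exact Valuation.map_sub_eq_of_lt_left _ h1
  obtain ⟨v0, hv0⟩ := exists_dyadic F
  have hB0 := (hsq v0 hv0).1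
  have hb0 : (B x y) ^ 2 - B x x * B y y ≠ 0 := by
    intro h
    have := (hsq v0 hv0).2
    rw [h, map_zero, eq_comm, map_eq_zero] at this
    exact hB0 (pow_eq_zero_iff two_ne_zero |>.mp this)
  have hx0 : x ≠ 0 := by
    rintro rfl
    simp at hB0
  have hg1 : B x x ≠ 0 := hani x hx0
  set e2 := y - (B x y / B x x) • x with he2
  have h12 : B x e2 = 0 := by
    simp only [he2, map_sub, map_smul, smul_eq_mul]
    field_simp
    ring
  have h21 : B e2 x = 0 := by rw [hB, Bf_comm, ← hB, h12]
  have hyx : B y x = B x y := Bf_comm _ _ _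
  have h22 : B e2 e2 = B y y - (B x y) ^ 2 / B x x := by
    conv_lhs => rw [he2]
    simp only [map_sub, map_smul, smul_eq_mul, LinearMap.sub_apply, LinearMap.smul_apply, hyx]
    field_simp
    ring
  have hprod : -(B x x * B e2 e2) = (B x y) ^ 2 - B x x * B y y := by
    rw [h22]; field_simp; ring
  have hg2 : B e2 e2 ≠ 0 := by
    intro h
    rw [h, mul_zero, neg_zero] at hprod
    exact hb0 hprod.symm
  obtain ⟨e3, h30, h3⟩ := exists_orth (fun k => (c k : F)) (by norm_num : 2 < 6) ![x, e2]
  obtain ⟨e4, h40, h4⟩ := exists_orth (fun k => (c k : F)) (by norm_num : 3 < 6) ![x, e2, e3]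
  obtain ⟨e5, h50, h5⟩ := exists_orth (fun k => (c k : F)) (by norm_num : 4 < 6) ![x, e2, e3, e4]
  have h13 : B x e3 = 0 := h3 0
  have h23 : B e2 e3 = 0 := h3 1
  have h14 : B x e4 = 0 := h4 0
  have h24 : B e2 e4 = 0 := h4 1
  have h34 : B e3 e4 = 0 := h4 2
  have h15 : B x e5 = 0 := h5 0
  have h25 : B e2 e5 = 0 := h5 1
  have h35 : B e3 e5 = 0 := h5 2
  have h45 : B e4 e5 = 0 := h5 3
  have h31 : B e3 x = 0 := (Bf_comm _ _ _).trans h13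
  have h32 : B e3 e2 = 0 := (Bf_comm _ _ _).trans h23
  have h41 : B e4 x = 0 := (Bf_comm _ _ _).trans h14
  have h42 : B e4 e2 = 0 := (Bf_comm _ _ _).trans h24
  have h43 : B e4 e3 = 0 := (Bf_comm _ _ _).trans h34
  have h51 : B e5 x = 0 := (Bf_comm _ _ _).trans h15
  have h52 : B e5 e2 = 0 := (Bf_comm _ _ _).trans h25
  have h53 : B e5 e3 = 0 := (Bf_comm _ _ _).trans h35
  have h54 : B e5 e4 = 0 := (Bf_comm _ _ _).trans h45
  have hg3 := hani e3 h30
  have hg4 := hani e4 h40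
  have hg5 := hani e5 h50
  have hbu : ((-(Units.mk0 _ hg1 * Units.mk0 _ hg2) : Fˣ) : F) = (B x y) ^ 2 - B x x * B y y := by
    rw [← hprod]; simp
  obtain ⟨p, q, r, s, t, hne, hsum⟩ := core5 (Units.mk0 _ hg1) (Units.mk0 _ hg2) (Units.mk0 _ hg3)
    (Units.mk0 _ hg4) (Units.mk0 _ hg5)
    (by
      rw [mem_Pos]
      intro σ
      rw [hbu, map_sub, map_pow, map_mul]
      have := mul_neg_of_pos_of_neg (hre σ).1 (hre σ).2
      have := sq_nonneg (σ (B x y))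
      linarith)
    (by
      intro v hv
      rw [mem_Sq]
      refine ⟨B x y, hB0, ?_⟩
      rw [hbu, map_mul, (hsq v hv).2, ← map_mul]
      have e : (B x y) ^ 2 - B x x * B y y - (B x y) ^ 2 = -(B x x * B y y) := by ring
      rw [e, Valuation.map_neg]
      exact hdy v hv)
  simp only [Units.val_mk0] at hsum
  refine hani (p • x + q • e2 + r • e3 + s • e4 + t • e5) ?_ ?_
  · intro h0
    have key : ∀ u, B (p • x + q • e2 + r • e3 + s • e4 + t • e5) u = 0 := fun u => by rw [h0]; simp
    have k1 := key x
    have k2 := key e2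
    have k3 := key e3
    have k4 := key e4
    have k5 := key e5
    simp only [map_add, map_smul, LinearMap.add_apply, LinearMap.smul_apply, smul_eq_mul, h12, h13, h14, h15,
      h21, h23, h24, h25, h31, h32, h34, h35, h41, h42, h43, h45, h51, h52, h53, h54, mul_zero, add_zero,
      zero_add, mul_eq_zero, hg1, hg2, hg3, hg4, hg5, or_false] at k1 k2 k3 k4 k5
    simp [k1, k2, k3, k4, k5] at hne
  · rw [← hsum]
    simp only [map_add, map_smul, LinearMap.add_apply, LinearMap.smul_apply, smul_eq_mul, h12, h13, h14, h15,
      h21, h23, h24, h25, h31, h32, h34, h35, h41, h42, h43, h45, h51, h52, h53, h54, mul_zero, add_zero,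
      zero_add]
    ring
end fin
end HM

/-- Hasse–Minkowski step: a diagonal quadratic form in 6 variables over a
number field `K` which has a nontrivial zero in every real embedding of `K`
has a nontrivial zero over `K`. -/
theorem hasse_minkowski_six_variables
    (K : Type*) [Field K] [NumberField K] (c : Fin 6 → K)
    (hreal : ∀ σ : K →+* ℝ, ∃ x : Fin 6 → ℝ, x ≠ 0 ∧ ∑ i, σ (c i) * x i ^ 2 = 0) :
    ∃ x : Fin 6 → K, x ≠ 0 ∧ ∑ i, c i * x i ^ 2 = 0 := by
  classical
  by_cases hc : ∃ i, c i = 0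
  · obtain ⟨i, hi⟩ := hc
    exact ⟨Pi.single i 1, by simp, by simp [Pi.single_apply, hi]⟩
  push Not at hc
  have key : ∀ (d : Fin 6 → ℝ), (∀ i, 0 < d i) → ∀ x : Fin 6 → ℝ, x ≠ 0 → ∑ i, d i * x i ^ 2 ≠ 0 := by
    intro d hd x hx h
    rw [Finset.sum_eq_zero_iff_of_nonneg (fun i _ => mul_nonneg (hd i).le (sq_nonneg _))] at h
    apply hx
    ext i
    have := h i (Finset.mem_univ i)
    simpa [(hd i).ne'] using this
  obtain ⟨x, hx, h⟩ := HM.main6 (fun i => Units.mk0 (c i) (hc i))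
    (fun σ => by
      obtain ⟨x, hx, h⟩ := hreal σ
      by_contra! hcon
      refine key (fun i => -σ (c i)) (fun i => ?_) x hx (by simpa using h)
      have h1 := hcon i
      have h2 : σ (c i) ≠ 0 := by simpa using hc i
      simpa using lt_of_le_of_ne h1 h2)
    (fun σ => by
      obtain ⟨x, hx, h⟩ := hreal σ
      by_contra! hcon
      refine key (fun i => σ (c i)) (fun i => ?_) x hx h
      have h1 := hcon i
      have h2 : σ (c i) ≠ 0 := by simpa using hc i
      exact lt_of_le_of_ne h1 h2.symm)
  refine ⟨x, hx, ?_⟩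
  rw [← h, HM.Bf_apply]
  exact Finset.sum_congr rfl fun k _ => by simp only [Units.val_mk0]; ring
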